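/- arXiv:0706.0545 — 2 statements merged into one kernel-verified Lean document; each statement's English description precedes it below -/
import Mathlib

section
/- There exist universal constants a, b > 0 such that every metric tree T satisfies a · √(1 + log(1/δ*(T))) ≤ c_2(T) ≤ b · √(1 + log(1/δ*(T))). -/
open scoped ENNReal

namespace TreePaper

/-- `HasEmbedding dX dY D`: there is a bi-Lipschitz embedding of the distance space
`(X, dX)` into `(Y, dY)` with distortion at most `D`. -/
def HasEmbedding {X Y : Type*} (dX : X → X → ℝ) (dY : Y → Y → ℝ) (D : ℝ) : Prop :=
  ∃ f : X → Y, ∃ s : ℝ, 0 < s ∧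
    ∀ x x' : X, s * dX x x' ≤ dY (f x) (f x') ∧ dY (f x) (f x') ≤ s * D * dX x x'

/-- `cDist dX dY` is the infimal distortion of bi-Lipschitz embeddings of `X` into `Y`
(`⊤` if no bi-Lipschitz embedding exists); it is at least `1` by convention. -/
noncomputable def cDist {X Y : Type*} (dX : X → X → ℝ) (dY : Y → Y → ℝ) : ℝ≥0∞ :=
  1 ⊔ sInf {c : ℝ≥0∞ | ∃ r : ℝ, c = ENNReal.ofReal r ∧ HasEmbedding dX dY r}

/-- The Lebesgue space `L_p(ℝ)`. -/
noncomputable def LpSpace (p : ℝ) : Type :=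
  MeasureTheory.Lp ℝ (ENNReal.ofReal p) (MeasureTheory.volume : MeasureTheory.Measure ℝ)

noncomputable instance (p : ℝ) : Dist (LpSpace p) :=
  inferInstanceAs (Dist (MeasureTheory.Lp ℝ (ENNReal.ofReal p) MeasureTheory.volume))

/-- `cLp p dX` is the `L_p`-distortion of the distance space `(X, dX)`. -/
noncomputable def cLp (p : ℝ) {X : Type*} (dX : X → X → ℝ) : ℝ≥0∞ :=
  cDist dX (fun g h : LpSpace p => dist g h)

/-- A metric tree: a connected graph-theoretic tree together with positive edge weights.
The associated metric is the induced weighted shortest-path metric on the vertices. -/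
structure MetricTree where
  V : Type
  G : SimpleGraph V
  isTree : G.IsTree
  w : Sym2 V → ℝ
  w_pos : ∀ e ∈ G.edgeSet, 0 < w e

/-- The unique path between two vertices of a metric tree. -/
noncomputable def MetricTree.path (T : MetricTree) (u v : T.V) : T.G.Walk u v :=
  (T.isTree.existsUnique_path u v).exists.choose

/-- The weighted shortest-path metric of a metric tree. -/
noncomputable def MetricTree.dist (T : MetricTree) (u v : T.V) : ℝ :=
  ((T.path u v).edges.map T.w).sum

/-- `ℓ^χ_k(u,v)`: total weight of the edges of color `k` on the path from `u` to `v`. -/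
noncomputable def colorLen (T : MetricTree) (χ : Sym2 T.V → ℤ) (k : ℤ) (u v : T.V) : ℝ :=
  (((T.path u v).edges.filter (fun e => χ e = k)).map T.w).sum

/-- An edge coloring of the tree `T` rooted at `r` is monotone if each color class is the
edge set of a monotone path, i.e. of a path joining a vertex `a` to a descendant `b`. -/
def IsMonotoneColoring (T : MetricTree) (r : T.V) (χ : Sym2 T.V → ℤ) : Prop :=
  ∀ m : ℤ, ∃ a b : T.V, a ∈ (T.path r b).support ∧
    ∀ e ∈ T.G.edgeSet, (χ e = m ↔ e ∈ (T.path a b).edges)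

/-- The total length of the path from `u` to `v` covered by color classes whose length
along this path is at least `α · d_T(u,v)`. -/
noncomputable def coveredLen (T : MetricTree) (χ : Sym2 T.V → ℤ) (α : ℝ) (u v : T.V) : ℝ :=
  ∑ k ∈ ((T.path u v).edges.map χ).toFinset,
    (if α * T.dist u v ≤ colorLen T χ k u v then colorLen T χ k u v else 0)

/-- A `δ`-strong coloring: monotone, and for all `u,v` at least half of the length of the
path joining `u` and `v` is covered by color classes of length at least `δ · d_T(u,v)`. -/
def IsStrongColoring (T : MetricTree) (r : T.V) (δ : ℝ) (χ : Sym2 T.V → ℤ) : Prop :=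
  IsMonotoneColoring T r χ ∧ ∀ u v : T.V, T.dist u v / 2 ≤ coveredLen T χ δ u v

/-- `δ*(T)`: the supremal `δ ∈ (0,1)` for which `T` admits a `δ`-strong coloring. -/
noncomputable def deltaStar (T : MetricTree) (r : T.V) : ℝ :=
  sSup {δ : ℝ | 0 < δ ∧ δ < 1 ∧ ∃ χ : Sym2 T.V → ℤ, IsStrongColoring T r δ χ}

/-- An `ε`-good coloring: monotone, and every path from `u` to `v` contains a monochromatic
segment of length at least `ε · d_T(u,v)`. -/
def IsGoodColoring (T : MetricTree) (r : T.V) (ε : ℝ) (χ : Sym2 T.V → ℤ) : Prop :=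
  IsMonotoneColoring T r χ ∧ ∀ u v : T.V, u ≠ v → ∃ a b : T.V,
    a ∈ (T.path u v).support ∧ b ∈ (T.path u v).support ∧
    (∃ k : ℤ, ∀ e ∈ (T.path a b).edges, χ e = k) ∧ ε * T.dist u v ≤ T.dist a b

/-- `ε*(T)`: the supremal `ε ∈ (0,1]` for which `T` admits an `ε`-good coloring. -/
noncomputable def epsilonStar (T : MetricTree) (r : T.V) : ℝ :=
  sSup {ε : ℝ | 0 < ε ∧ ε ≤ 1 ∧ ∃ χ : Sym2 T.V → ℤ, IsGoodColoring T r ε χ}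

section Model
open scoped Classical

/-- A rooted weighted tree given by a parent map; the edge joining `v ≠ root` to its parent is
identified with `v`, and `lev` is the combinatorial depth. -/
structure ParentTree (V : Type*) where
  root : V
  par : V → V
  lev : V → ℕ
  w : V → ℝ
  lev_root : lev root = 0
  lev_par : ∀ v, v ≠ root → lev v = lev (par v) + 1
  w_pos : ∀ v, v ≠ root → 0 < w v

namespace ParentTree

variable {V : Type*} (P : ParentTree V)

/-- The non-root vertices on the path from the root to `v`, that is, the edges of this path. -/
noncomputable def A (v : V) : Finset V :=
  (Finset.range (P.lev v)).image (fun i => P.par^[i] v)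

lemma A_root : P.A P.root = ∅ := by simp [A, P.lev_root]

lemma A_of_ne {v : V} (hv : v ≠ P.root) : P.A v = insert v (P.A (P.par v)) := by
  ext x
  simp only [A, Finset.mem_image, Finset.mem_range, Finset.mem_insert, P.lev_par v hv]
  constructor
  · rintro ⟨i, hi, rfl⟩
    cases i with
    | zero => exact Or.inl rfl
    | succ i => exact Or.inr ⟨i, by omega, by simp⟩
  · rintro (rfl | ⟨i, hi, rfl⟩)
    · exact ⟨0, by omega, rfl⟩
    · exact ⟨i + 1, by omega, by simp⟩

lemma induct {motive : V → Prop} (hroot : motive P.root)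
    (hstep : ∀ v, v ≠ P.root → motive (P.par v) → motive v) (v : V) : motive v := by
  obtain ⟨n, hn⟩ : ∃ n, P.lev v = n := ⟨_, rfl⟩
  induction n generalizing v with
  | zero =>
    by_cases hv : v = P.root
    · exact hv ▸ hroot
    · have := P.lev_par v hv
      omega
  | succ n ih =>
    by_cases hv : v = P.root
    · exact hv ▸ hroot
    · have := P.lev_par v hv
      exact hstep v hv (ih _ (by omega))

lemma self_mem {v : V} (hv : v ≠ P.root) : v ∈ P.A v := by
  rw [P.A_of_ne hv]; exact Finset.mem_insert_self _ _

lemma A_par_subset {v : V} (hv : v ≠ P.root) : P.A (P.par v) ⊆ P.A v := by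
  rw [P.A_of_ne hv]; exact Finset.subset_insert _ _

lemma mem_facts (v : V) :
    ∀ x ∈ P.A v, x ≠ P.root ∧ P.A x ⊆ P.A v ∧ P.lev x ≤ P.lev v := by
  induction v using P.induct with
  | hroot => simp [A_root]
  | hstep v hv ih =>
    intro x hx
    rw [P.A_of_ne hv, Finset.mem_insert] at hx
    rcases hx with rfl | hx
    · exact ⟨hv, subset_rfl, le_rfl⟩
    · obtain ⟨h1, h2, h3⟩ := ih x hx
      exact ⟨h1, h2.trans (P.A_par_subset hv), by rw [P.lev_par v hv]; omega⟩

variable {P}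

lemma ne_root_of_mem {x v : V} (h : x ∈ P.A v) : x ≠ P.root := (P.mem_facts v x h).1

lemma subset_of_mem {x v : V} (h : x ∈ P.A v) : P.A x ⊆ P.A v := (P.mem_facts v x h).2.1

lemma lev_le_of_mem {x v : V} (h : x ∈ P.A v) : P.lev x ≤ P.lev v := (P.mem_facts v x h).2.2

lemma mem_of_subset {x v : V} (hx : x ≠ P.root) (h : P.A x ⊆ P.A v) : x ∈ P.A v :=
  h (P.self_mem hx)

lemma notMem_A_par {v : V} (hv : v ≠ P.root) : v ∉ P.A (P.par v) := by
  intro h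
  have := lev_le_of_mem h
  have := P.lev_par v hv
  omega

lemma lev_lt_of_mem_ne {x v : V} (h : x ∈ P.A v) (hne : x ≠ v) : P.lev x < P.lev v := by
  have hv : v ≠ P.root := by rintro rfl; simp [A_root] at h
  rw [P.A_of_ne hv, Finset.mem_insert] at h
  have := lev_le_of_mem (h.resolve_left hne)
  have := P.lev_par v hv
  omega

lemma mem_A_par {x v : V} (h : x ∈ P.A v) (hne : x ≠ v) : x ∈ P.A (P.par v) := by
  have hv : v ≠ P.root := by rintro rfl; simp [A_root] at h
  rw [P.A_of_ne hv, Finset.mem_insert] at h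
  exact h.resolve_left hne

lemma chain {v x y : V} (hx : x ∈ P.A v) (hy : y ∈ P.A v) : x ∈ P.A y ∨ y ∈ P.A x := by
  induction v using P.induct with
  | hroot => simp [A_root] at hx
  | hstep v hv ih =>
    by_cases hxv : x = v
    · subst hxv; exact Or.inr hy
    by_cases hyv : y = v
    · subst hyv; exact Or.inl hx
    exact ih (mem_A_par hx hxv) (mem_A_par hy hyv)

lemma eq_of_mem_mem {x y : V} (hx : x ∈ P.A y) (hy : y ∈ P.A x) : x = y := by
  by_contra h
  have := lev_lt_of_mem_ne hx h
  have := lev_le_of_mem hy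
  omega

lemma eq_root_or_mem {a v : V} (h : P.A a ⊆ P.A v) : a = P.root ∨ a ∈ P.A v := by
  by_cases ha : a = P.root
  · exact Or.inl ha
  · exact Or.inr (mem_of_subset ha h)

lemma A_inj {a b : V} (h : P.A a = P.A b) : a = b := by
  by_cases ha : a = P.root
  · by_cases hb : b = P.root
    · rw [ha, hb]
    · have := P.self_mem hb
      rw [← h, ha, A_root] at this
      simp at this
  · by_cases hb : b = P.root
    · have := P.self_mem ha
      rw [h, hb, A_root] at this
      simp at this
    · exact eq_of_mem_mem (h ▸ P.self_mem ha) (h ▸ P.self_mem hb)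

lemma A_subset_par {a x v : V} (ha : P.A a ⊆ P.A v) (hx : x ∈ P.A v) (hxa : x ∉ P.A a) :
    P.A a ⊆ P.A (P.par x) := by
  rcases eq_root_or_mem ha with rfl | ha'
  · simp [A_root]
  · rcases chain ha' hx with h | h
    · have hne : a ≠ x := by rintro rfl; exact hxa (P.self_mem (ne_root_of_mem ha'))
      exact subset_of_mem (mem_A_par h hne)
    · exact absurd h hxa

lemma A_total {a b v : V} (ha : P.A a ⊆ P.A v) (hb : P.A b ⊆ P.A v) :
    P.A a ⊆ P.A b ∨ P.A b ⊆ P.A a := by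
  rcases eq_root_or_mem ha with rfl | ha'
  · simp [A_root]
  rcases eq_root_or_mem hb with rfl | hb'
  · simp [A_root]
  exact (chain ha' hb').imp subset_of_mem subset_of_mem

lemma exists_lca (u v : V) : ∃ m, P.A m = P.A u ∩ P.A v := by
  induction u using P.induct with
  | hroot => exact ⟨P.root, by simp [A_root]⟩
  | hstep u hu ih =>
    obtain ⟨m, hm⟩ := ih
    by_cases h : u ∈ P.A v
    · exact ⟨u, (Finset.inter_eq_left.2 (subset_of_mem h)).symm⟩
    · exact ⟨m, by rw [hm, P.A_of_ne hu, Finset.insert_inter_of_notMem h]⟩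

lemma exists_first {m u : V} (h : P.A m ⊆ P.A u) (hne : m ≠ u) :
    ∃ x ∈ P.A u \ P.A m, P.par x = m := by
  induction u using P.induct with
  | hroot =>
    rw [A_root] at h
    exact absurd (A_inj (by rw [A_root]; exact Finset.subset_empty.1 h)) hne
  | hstep u hu ih =>
    by_cases hm : m = P.par u
    · subst hm
      exact ⟨u, by simp [P.self_mem hu, notMem_A_par hu], rfl⟩
    · have h' : P.A m ⊆ P.A (P.par u) := by
        rcases eq_root_or_mem h with rfl | h1
        · simp [A_root]
        · exact subset_of_mem (mem_A_par h1 hne)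
      obtain ⟨x, hx, hxm⟩ := ih h' hm
      rw [Finset.mem_sdiff] at hx
      exact ⟨x, Finset.mem_sdiff.2 ⟨P.A_par_subset hu hx.1, hx.2⟩, hxm⟩

lemma w_pos_of_mem {x v : V} (h : x ∈ P.A v) : 0 < P.w x := P.w_pos x (ne_root_of_mem h)

variable (P)

/-- The distance from the root. -/
noncomputable def dep (v : V) : ℝ := ∑ x ∈ P.A v, P.w x

lemma dep_root : P.dep P.root = 0 := by simp [dep, A_root]

lemma dep_of_ne {v : V} (hv : v ≠ P.root) : P.dep v = P.dep (P.par v) + P.w v := by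
  rw [dep, P.A_of_ne hv, Finset.sum_insert (notMem_A_par hv), dep, add_comm]

variable {P}

lemma dep_nonneg (v : V) : 0 ≤ P.dep v :=
  Finset.sum_nonneg fun _ hx => (w_pos_of_mem hx).le

lemma sum_sdiff_w {a b : V} (h : P.A a ⊆ P.A b) :
    ∑ x ∈ P.A b \ P.A a, P.w x = P.dep b - P.dep a := by
  rw [dep, dep, ← Finset.sum_sdiff h]; ring

lemma dep_mono {a b : V} (h : P.A a ⊆ P.A b) : P.dep a ≤ P.dep b :=
  Finset.sum_le_sum_of_subset_of_nonneg h fun _ hx _ => (w_pos_of_mem hx).le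

lemma dep_lt {a b : V} (h : P.A a ⊆ P.A b) (hne : a ≠ b) : P.dep a < P.dep b := by
  obtain ⟨x, hx, -⟩ := exists_first h hne
  rw [Finset.mem_sdiff] at hx
  exact Finset.sum_lt_sum_of_subset h hx.1 hx.2 (w_pos_of_mem hx.1)
    fun _ hx _ => (w_pos_of_mem hx).le

/-- Among comparable vertices the order is detected by depth. -/
lemma subset_of_dep_le {a b v : V} (ha : P.A a ⊆ P.A v) (hb : P.A b ⊆ P.A v)
    (h : P.dep a ≤ P.dep b) : P.A a ⊆ P.A b := by
  rcases A_total ha hb with h1 | h1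
  · exact h1
  · by_cases hab : b = a
    · rw [hab]
    · exact absurd (dep_lt h1 hab) (not_lt.2 h)

lemma A_par_subset_of_mem {x v : V} (h : x ∈ P.A v) : P.A (P.par x) ⊆ P.A v :=
  (P.A_par_subset (ne_root_of_mem h)).trans (subset_of_mem h)

variable (P)

/-- The edges of the path joining `u` and `v`. -/
noncomputable def X (u v : V) : Finset V := symmDiff (P.A u) (P.A v)

/-- The weighted distance. -/
noncomputable def d (u v : V) : ℝ := ∑ x ∈ P.X u v, P.w x

/-- The total weight of the edges of color `k` between `u` and `v`. -/
noncomputable def cl (col : V → ℤ) (k : ℤ) (u v : V) : ℝ :=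
  ∑ x ∈ P.X u v with col x = k, P.w x

/-- Monotone colorings of the edges of a parent tree. -/
def Mono (col : V → ℤ) : Prop :=
  ∀ m : ℤ, ∃ a b : V, P.A a ⊆ P.A b ∧ ∀ x, x ≠ P.root → (col x = m ↔ x ∈ P.A b \ P.A a)

/-- Strong colorings of the edges of a parent tree. -/
def Strong (δ : ℝ) (col : V → ℤ) : Prop :=
  P.Mono col ∧ ∀ u v : V, P.d u v / 2 ≤
    ∑ x ∈ P.X u v with δ * P.d u v ≤ P.cl col (col x) u v, P.w x

variable {P}

lemma X_comm (u v : V) : P.X u v = P.X v u := symmDiff_comm _ _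

lemma d_comm (u v : V) : P.d u v = P.d v u := by rw [d, X_comm, d]

lemma X_of_subset {a b : V} (h : P.A a ⊆ P.A b) : P.X a b = P.A b \ P.A a := by
  rw [X, symmDiff_of_le h]

lemma d_of_subset {a b : V} (h : P.A a ⊆ P.A b) : P.d a b = P.dep b - P.dep a := by
  rw [d, X_of_subset h, sum_sdiff_w h]

lemma ne_root_of_mem_X {x u v : V} (h : x ∈ P.X u v) : x ≠ P.root := by
  rw [X, Finset.mem_symmDiff] at h
  rcases h with h | h
  · exact ne_root_of_mem h.1
  · exact ne_root_of_mem h.1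

lemma d_nonneg (u v : V) : 0 ≤ P.d u v :=
  Finset.sum_nonneg fun x hx => (P.w_pos x (ne_root_of_mem_X hx)).le

lemma sum_X (f : V → ℝ) (u v : V) :
    ∑ x ∈ P.X u v, f x = ∑ x ∈ P.A u \ P.A v, f x + ∑ x ∈ P.A v \ P.A u, f x := by
  rw [X, symmDiff, Finset.sup_eq_union, Finset.sum_union]
  exact disjoint_sdiff_sdiff

lemma d_eq_of_lca {m u v : V} (hm : P.A m = P.A u ∩ P.A v) :
    P.d u v = (P.dep u - P.dep m) + (P.dep v - P.dep m) := by
  have h1 : P.A m ⊆ P.A u := hm ▸ Finset.inter_subset_left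
  have h2 : P.A m ⊆ P.A v := hm ▸ Finset.inter_subset_right
  rw [d, sum_X, ← sum_sdiff_w h1, ← sum_sdiff_w h2, hm]
  simp

end ParentTree
end Model

section Bridge
open scoped Classical
open SimpleGraph

namespace MetricTree

variable (T : MetricTree) (r : T.V)

lemma path_isPath (u v : T.V) : (T.path u v).IsPath :=
  (T.isTree.existsUnique_path u v).exists.choose_spec

variable {T} in
lemma path_eq {u v : T.V} {p : T.G.Walk u v} (hp : p.IsPath) : p = T.path u v :=
  (T.isTree.existsUnique_path u v).unique hp (T.path_isPath u v)

lemma not_nil {v : T.V} (hv : v ≠ r) : ¬ (T.path r v).Nil := fun h => hv h.eq.symm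

lemma path_eq_concat {v : T.V} (hv : v ≠ r) :
    T.path r v = (T.path r (T.path r v).penultimate).concat
      (Walk.adj_penultimate (T.not_nil r hv)) := by
  rw [← path_eq (T.path_isPath r v).dropLast]
  exact (Walk.concat_dropLast _).symm

/-- The parent tree of a metric tree rooted at `r`. -/
noncomputable def parentTree : ParentTree T.V where
  root := r
  par v := (T.path r v).penultimate
  lev v := (T.path r v).length
  w v := T.w s((T.path r v).penultimate, v)
  lev_root := by
    rw [← path_eq (p := Walk.nil) Walk.IsPath.nil]; rfl
  lev_par v hv := by
    conv_lhs => rw [T.path_eq_concat r hv]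
    rw [Walk.length_concat]
  w_pos v hv := T.w_pos _ (Walk.adj_penultimate (T.not_nil r hv))

/-- The edge joining a vertex to its parent. -/
noncomputable def parEdge (v : T.V) : Sym2 T.V := s((T.parentTree r).par v, v)

lemma adj_par {v : T.V} (hv : v ≠ r) : T.G.Adj ((T.parentTree r).par v) v :=
  Walk.adj_penultimate (T.not_nil r hv)

lemma adj_cases {u v : T.V} (h : T.G.Adj u v) :
    (u ≠ r ∧ (T.parentTree r).par u = v) ∨ (v ≠ r ∧ (T.parentTree r).par v = u) := by
  by_cases hv : v ∈ (T.path r u).support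
  · left
    refine ⟨?_, (T.isTree.isAcyclic.eq_penultimate_of_adj_end (T.path_isPath r u) h hv).symm⟩
    rintro rfl
    rw [← path_eq (p := Walk.nil) Walk.IsPath.nil] at hv
    simp only [Walk.support_nil, List.mem_singleton] at hv
    exact h.ne hv.symm
  · right
    have hp : ((T.path r u).concat h).IsPath := (T.path_isPath r u).concat hv h
    refine ⟨?_, ?_⟩
    · rintro rfl
      exact hv (Walk.start_mem_support _)
    · change (T.path r v).penultimate = u
      rw [← path_eq hp, Walk.penultimate_concat]

lemma parEdge_inj {x y : T.V} (hx : x ≠ r) (hy : y ≠ r) (h : T.parEdge r x = T.parEdge r y) :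
    x = y := by
  have h1 := (T.parentTree r).lev_par x hx
  have h2 := (T.parentTree r).lev_par y hy
  rw [parEdge, parEdge, Sym2.eq_iff] at h
  rcases h with h | h
  · exact h.2
  · rw [← h.2] at h2
    rw [h.1] at h1
    omega

lemma exists_parEdge {e : Sym2 T.V} (he : e ∈ T.G.edgeSet) : ∃ x, x ≠ r ∧ T.parEdge r x = e := by
  induction e using Sym2.ind with
  | _ u v =>
    rcases T.adj_cases r he with ⟨h, h'⟩ | ⟨h, h'⟩
    · exact ⟨u, h, by rw [parEdge, h', Sym2.eq_swap]⟩
    · exact ⟨v, h, by rw [parEdge, h']⟩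

lemma parEdge_mem {x : T.V} (hx : x ≠ r) : T.parEdge r x ∈ T.G.edgeSet := T.adj_par r hx

lemma odd_count {x : T.V} (hx : x ≠ r) {u v : T.V} (p : T.G.Walk u v) :
    Odd (p.edges.count (T.parEdge r x)) ↔ x ∈ (T.parentTree r).X u v := by
  induction p with
  | nil => simp [ParentTree.X]
  | @cons u u' v h p ih =>
    rw [Walk.edges_cons, List.count_cons]
    have key : ∀ y z : T.V, y ≠ r → (T.parentTree r).par y = z →
        ((s(y, z) == T.parEdge r x) = true ↔ x = y) ∧
        (x ∈ (T.parentTree r).A y ↔ x = y ∨ x ∈ (T.parentTree r).A z) ∧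
        (x = y → x ∉ (T.parentTree r).A z) := by
      rintro y z hy rfl
      refine ⟨?_, ?_, ?_⟩
      · rw [beq_iff_eq]
        constructor
        · intro h
          exact (T.parEdge_inj r hy hx (by rw [← h, parEdge, Sym2.eq_swap])).symm
        · rintro rfl; rw [parEdge, Sym2.eq_swap]
      · rw [(T.parentTree r).A_of_ne (v := y) hy, Finset.mem_insert]
      · rintro rfl; exact ParentTree.notMem_A_par hx
    have hX : ∀ a b, x ∈ (T.parentTree r).X a b ↔
        ¬ (x ∈ (T.parentTree r).A a ↔ x ∈ (T.parentTree r).A b) := by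
      intro a b
      rw [ParentTree.X, Finset.mem_symmDiff]; tauto
    rw [hX] at ih ⊢
    rcases T.adj_cases r h with ⟨h1, h2⟩ | ⟨h1, h2⟩
    · obtain ⟨k1, k2, k3⟩ := key u u' h1 h2
      by_cases hxy : x = u
      · have k1' := k1.2 hxy
        rw [if_pos k1', Nat.odd_add_one, ih, k2, iff_false_intro (k3 hxy)]; simp [hxy]
      · rw [if_neg (fun h => hxy (k1.1 h)), add_zero, ih, k2, or_iff_right hxy]
    · obtain ⟨k1, k2, k3⟩ := key u' u h1 h2
      rw [Sym2.eq_swap]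
      by_cases hxy : x = u'
      · have k1' := k1.2 hxy
        rw [if_pos k1', Nat.odd_add_one, ih, k2, iff_false_intro (k3 hxy)]; simp [hxy]
      · rw [if_neg (fun h => hxy (k1.1 h)), add_zero, ih, k2, or_iff_right hxy]

lemma parEdge_mem_path {x : T.V} (hx : x ≠ r) (u v : T.V) :
    T.parEdge r x ∈ (T.path u v).edges ↔ x ∈ (T.parentTree r).X u v := by
  rw [← T.odd_count r hx (T.path u v)]
  have hnd : (T.path u v).edges.Nodup := (T.path_isPath u v).isTrail.edges_nodup
  by_cases h : T.parEdge r x ∈ (T.path u v).edges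
  · simp [h, List.count_eq_one_of_mem hnd h]
  · simp [h, List.count_eq_zero_of_not_mem h]

lemma edges_toFinset (u v : T.V) :
    (T.path u v).edges.toFinset = ((T.parentTree r).X u v).image (T.parEdge r) := by
  ext e
  rw [List.mem_toFinset, Finset.mem_image]
  constructor
  · intro he
    obtain ⟨x, hx, rfl⟩ := T.exists_parEdge r (Walk.edges_subset_edgeSet _ he)
    exact ⟨x, (T.parEdge_mem_path r hx u v).1 he, rfl⟩
  · rintro ⟨x, hx, rfl⟩
    exact (T.parEdge_mem_path r (ParentTree.ne_root_of_mem_X hx) u v).2 hx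

lemma sum_path (u v : T.V) (f : Sym2 T.V → ℝ) :
    ((T.path u v).edges.map f).sum = ∑ x ∈ (T.parentTree r).X u v, f (T.parEdge r x) := by
  have hnd : (T.path u v).edges.Nodup := (T.path_isPath u v).isTrail.edges_nodup
  rw [← List.sum_toFinset f hnd, T.edges_toFinset r, Finset.sum_image]
  intro x hx y hy h
  exact T.parEdge_inj r (ParentTree.ne_root_of_mem_X hx) (ParentTree.ne_root_of_mem_X hy) h

lemma dist_eq (u v : T.V) : T.dist u v = (T.parentTree r).d u v := by
  rw [MetricTree.dist, T.sum_path r]; rfl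

lemma colorLen_eq (χ : Sym2 T.V → ℤ) (k : ℤ) (u v : T.V) :
    colorLen T χ k u v = (T.parentTree r).cl (fun x => χ (T.parEdge r x)) k u v := by
  have h : ∀ l : List (Sym2 T.V), ((l.filter (fun e => χ e = k)).map T.w).sum =
      (l.map (fun e => if χ e = k then T.w e else 0)).sum := by
    intro l
    induction l with
    | nil => simp
    | cons e l ih => by_cases he : χ e = k <;> simp [he, ih]
  rw [colorLen, h, T.sum_path r, ParentTree.cl, Finset.sum_filter]
  rfl

lemma coveredLen_eq (χ : Sym2 T.V → ℤ) (δ : ℝ) (u v : T.V) :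
    coveredLen T χ δ u v =
      ∑ x ∈ (T.parentTree r).X u v with δ * (T.parentTree r).d u v ≤
        (T.parentTree r).cl (fun x => χ (T.parEdge r x)) (χ (T.parEdge r x)) u v,
        (T.parentTree r).w x := by
  set P := T.parentTree r
  set col : T.V → ℤ := fun x => χ (T.parEdge r x)
  have himg : ((T.path u v).edges.map χ).toFinset = (P.X u v).image col := by
    ext k
    have := T.edges_toFinset r u v
    simp only [List.mem_toFinset, List.mem_map, Finset.mem_image]
    constructor
    · rintro ⟨e, he, rfl⟩
      rw [← List.mem_toFinset, this, Finset.mem_image] at he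
      obtain ⟨x, hx, rfl⟩ := he
      exact ⟨x, hx, rfl⟩
    · rintro ⟨x, hx, rfl⟩
      refine ⟨T.parEdge r x, ?_, rfl⟩
      rw [← List.mem_toFinset, this]
      exact Finset.mem_image_of_mem _ hx
  rw [coveredLen, himg, Finset.sum_filter,
    ← Finset.sum_fiberwise_of_maps_to (t := (P.X u v).image col) (g := col)
      (fun x hx => Finset.mem_image_of_mem _ hx)]
  refine Finset.sum_congr rfl fun k _ => ?_
  rw [T.dist_eq r, T.colorLen_eq r]
  change (if δ * P.d u v ≤ P.cl col k u v then P.cl col k u v else 0) =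
    ∑ x ∈ P.X u v with col x = k, if δ * P.d u v ≤ P.cl col (col x) u v then P.w x else 0
  by_cases h : δ * P.d u v ≤ P.cl col k u v
  · rw [if_pos h, ParentTree.cl]
    refine Finset.sum_congr rfl fun x hx => ?_
    rw [(Finset.mem_filter.1 hx).2, if_pos h]
  · rw [if_neg h]
    symm
    refine Finset.sum_eq_zero fun x hx => ?_
    rw [(Finset.mem_filter.1 hx).2, if_neg h]

lemma mem_support_iff (a b : T.V) :
    a ∈ (T.path r b).support ↔ (T.parentTree r).A a ⊆ (T.parentTree r).A b := by
  set P := T.parentTree r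
  induction b using P.induct with
  | hroot =>
    change a ∈ (T.path r r).support ↔ _
    rw [← path_eq (p := Walk.nil) Walk.IsPath.nil, P.A_root]
    simp only [Walk.support_nil, List.mem_singleton]
    constructor
    · rintro rfl; exact P.A_root.subset
    · intro h; exact ParentTree.A_inj ((Finset.subset_empty.1 h).trans P.A_root.symm)
  | hstep b hb ih =>
    rw [T.path_eq_concat r hb, Walk.support_concat, List.mem_append,
      List.mem_singleton]
    change a ∈ (T.path r (P.par b)).support ∨ a = b ↔ _
    rw [ih]
    constructor
    · rintro (h | rfl)
      · exact h.trans (P.A_par_subset hb)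
      · exact subset_rfl
    · intro h
      by_cases hab : a = b
      · exact Or.inr hab
      · rcases ParentTree.eq_root_or_mem h with h' | h'
        · left; rw [h', P.A_root]; exact Finset.empty_subset _
        · exact Or.inl (ParentTree.subset_of_mem (ParentTree.mem_A_par h' hab))

lemma mono_iff (χ : Sym2 T.V → ℤ) :
    IsMonotoneColoring T r χ ↔ (T.parentTree r).Mono (fun x => χ (T.parEdge r x)) := by
  refine forall_congr' fun m => exists_congr fun a => exists_congr fun b => ?_
  rw [T.mem_support_iff r]
  refine and_congr_right fun hab => ?_
  have key : ∀ x, x ≠ r → (T.parEdge r x ∈ (T.path a b).edges ↔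
      x ∈ (T.parentTree r).A b \ (T.parentTree r).A a) := by
    intro x hx
    rw [T.parEdge_mem_path r hx, ParentTree.X_of_subset hab]
  constructor
  · intro h x hx
    rw [← key x hx]
    exact h _ (T.parEdge_mem r hx)
  · intro h e he
    obtain ⟨x, hx, rfl⟩ := T.exists_parEdge r he
    rw [key x hx]
    exact h x hx

lemma strong_iff (δ : ℝ) (χ : Sym2 T.V → ℤ) :
    IsStrongColoring T r δ χ ↔ (T.parentTree r).Strong δ (fun x => χ (T.parEdge r x)) := by
  refine and_congr (T.mono_iff r χ) (forall_congr' fun u => forall_congr' fun v => ?_)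
  rw [T.dist_eq r, T.coveredLen_eq r]

/-- Every coloring of the vertices of the parent tree comes from an edge coloring. -/
lemma exists_strong {δ : ℝ} {col : T.V → ℤ} (h : (T.parentTree r).Strong δ col) :
    ∃ χ, IsStrongColoring T r δ χ := by
  set P := T.parentTree r
  let χ : Sym2 T.V → ℤ := fun e =>
    if he : ∃ x, x ≠ r ∧ T.parEdge r x = e then col he.choose else 0
  have hχ : ∀ x, x ≠ r → χ (T.parEdge r x) = col x := by
    intro x hx
    have he : ∃ y, y ≠ r ∧ T.parEdge r y = T.parEdge r x := ⟨x, hx, rfl⟩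
    simp only [χ, dif_pos he]
    rw [T.parEdge_inj r he.choose_spec.1 hx he.choose_spec.2]
  refine ⟨χ, (T.strong_iff r δ χ).2 ⟨fun m => ?_, fun u v => ?_⟩⟩
  · obtain ⟨a, b, hab, hm⟩ := h.1 m
    refine ⟨a, b, hab, fun x hx => ?_⟩
    rw [← hm x hx, ← hχ x hx]
  · have hcl : ∀ k, P.cl (fun x => χ (T.parEdge r x)) k u v = P.cl col k u v := by
      intro k
      rw [ParentTree.cl, ParentTree.cl]
      refine Finset.sum_congr (Finset.filter_congr fun x hx => ?_) fun _ _ => rfl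
      rw [hχ x (ParentTree.ne_root_of_mem_X hx)]
    refine (h.2 u v).trans (le_of_eq ?_)
    refine Finset.sum_congr (Finset.filter_congr fun x hx => ?_) fun _ _ => rfl
    rw [hcl, ← hχ x (ParentTree.ne_root_of_mem_X hx)]

end MetricTree
end Bridge

section Upper
open scoped Classical

namespace ParentTree

variable {V : Type*} {P : ParentTree V}

lemma sum_telescope (g : V → ℝ) (v : V) :
    ∑ x ∈ P.A v, (g (P.par x) - g x) = g P.root - g v := by
  induction v using P.induct with
  | hroot => simp [A_root]
  | hstep v hv ih =>
    rw [P.A_of_ne hv, Finset.sum_insert (notMem_A_par hv), ih]; ring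

lemma edge_lipschitz {H : Type*} [SeminormedAddCommGroup H] {f : V → H} {C : ℝ}
    (h : ∀ v, v ≠ P.root → ‖f v - f (P.par v)‖ ≤ C * P.w v) (u v : V) :
    ‖f u - f v‖ ≤ C * P.d u v := by
  have key : ∀ m u, P.A m ⊆ P.A u → ‖f u - f m‖ ≤ C * (P.dep u - P.dep m) := by
    intro m u
    induction u using P.induct with
    | hroot =>
      intro hm
      have : m = P.root := A_inj (by rw [A_root] at hm ⊢; exact Finset.subset_empty.1 hm)
      simp [this]
    | hstep u hu ih =>
      intro hm
      by_cases hmu : m = u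
      · simp [hmu]
      · have hm' : P.A m ⊆ P.A (P.par u) := by
          rcases eq_root_or_mem hm with rfl | h1
          · simp [A_root]
          · exact subset_of_mem (mem_A_par h1 hmu)
        have h1 := norm_sub_le_norm_sub_add_norm_sub (f u) (f (P.par u)) (f m)
        have h2 := h u hu
        have h3 := ih hm'
        rw [P.dep_of_ne hu]
        linarith
  obtain ⟨m, hm⟩ := exists_lca (P := P) u v
  have h1 := key m u (hm ▸ Finset.inter_subset_left)
  have h2 := key m v (hm ▸ Finset.inter_subset_right)
  have h3 := norm_sub_le_norm_sub_add_norm_sub (f u) (f m) (f v)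
  rw [norm_sub_rev (f m) (f v)] at h3
  rw [d_eq_of_lca hm]
  linarith

variable (P) in
/-- The length of color `k` between the root and `v`. -/
noncomputable def rl (col : V → ℤ) (k : ℤ) (v : V) : ℝ := ∑ x ∈ P.A v with col x = k, P.w x

lemma rl_nonneg (col : V → ℤ) (k : ℤ) (v : V) : 0 ≤ P.rl col k v :=
  Finset.sum_nonneg fun _ hx => (w_pos_of_mem (Finset.mem_filter.1 hx).1).le

lemma rl_eq_zero {col : V → ℤ} {k : ℤ} {v : V} (h : ∀ x ∈ P.A v, col x ≠ k) :
    P.rl col k v = 0 := by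
  rw [rl, Finset.filter_false_of_mem h, Finset.sum_empty]

lemma sum_short_le (col : V → ℤ) (m : ℤ) {θ : ℝ} (hθ : 0 ≤ θ) (v : V) :
    ∑ x ∈ P.A v with col x = m ∧ P.rl col m x < θ, P.w x ≤ θ := by
  induction v using P.induct with
  | hroot => simpa [A_root] using hθ
  | hstep v hv ih =>
    by_cases h : P.rl col m v < θ
    · refine le_trans ?_ h.le
      refine Finset.sum_le_sum_of_subset_of_nonneg ?_
        fun x hx _ => (w_pos_of_mem (Finset.mem_filter.1 hx).1).le
      intro x hx
      rw [Finset.mem_filter] at hx ⊢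
      exact ⟨hx.1, hx.2.1⟩
    · rw [P.A_of_ne hv, Finset.filter_insert, if_neg (fun h' => h h'.2)]
      exact ih

lemma sum_long_ge {δ : ℝ} {col : V → ℤ} (hδ : 0 < δ) (hs : P.Strong δ col) {a v : V}
    (h : P.A a ⊆ P.A v) :
    (P.dep v - P.dep a) / 4 ≤ ∑ x ∈ P.A v \ P.A a with
      δ / 2 * (P.dep v - P.dep a) ≤ P.rl col (col x) x, P.w x := by
  have hs' := hs.2 a v
  set D := P.dep v - P.dep a with hD
  have hD0 : 0 ≤ D := sub_nonneg.2 (dep_mono h)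
  rw [d_of_subset h, X_of_subset h, ← hD] at hs'
  set X := P.A v \ P.A a with hX
  have hXA : ∀ x ∈ X, x ∈ P.A v := fun x hx => (Finset.mem_sdiff.1 hx).1
  have hcl : ∀ k, P.cl col k a v = ∑ x ∈ X with col x = k, P.w x := by
    intro k; rw [cl, X_of_subset h]
  set Y := X.filter (fun x => δ * D ≤ P.cl col (col x) a v) with hY
  have key : ∑ x ∈ Y with P.rl col (col x) x < δ / 2 * D, P.w x ≤ (∑ x ∈ Y, P.w x) / 2 := by
    rw [← Finset.sum_fiberwise_of_maps_to (s := Y) (t := Y.image col) (g := col)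
      (fun x hx => Finset.mem_image_of_mem _ hx),
      ← Finset.sum_fiberwise_of_maps_to (s := Y.filter _) (t := Y.image col) (g := col)
      (fun x hx => Finset.mem_image_of_mem _ (Finset.filter_subset _ _ hx)), Finset.sum_div]
    refine Finset.sum_le_sum fun m hm => ?_
    obtain ⟨y, hy, rfl⟩ := Finset.mem_image.1 hm
    have hlong : δ * D ≤ P.cl col (col y) a v := (Finset.mem_filter.1 hy).2
    have h1 : ∑ x ∈ Y with col x = col y, P.w x = P.cl col (col y) a v := by
      rw [hcl]
      refine Finset.sum_congr ?_ fun _ _ => rfl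
      ext x
      simp only [hY, Finset.mem_filter]
      constructor
      · rintro ⟨⟨h1, -⟩, h2⟩; exact ⟨h1, h2⟩
      · rintro ⟨h1, h2⟩; exact ⟨⟨h1, h2 ▸ hlong⟩, h2⟩
    rw [h1]
    refine le_trans ?_ (show δ / 2 * D ≤ _ by linarith)
    refine le_trans ?_ (sum_short_le (P := P) col (col y) (by positivity : 0 ≤ δ / 2 * D) v)
    refine Finset.sum_le_sum_of_subset_of_nonneg ?_
      fun x hx _ => (w_pos_of_mem (Finset.mem_filter.1 hx).1).le
    intro x hx
    simp only [hY, Finset.mem_filter] at hx ⊢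
    exact ⟨hXA x hx.1.1.1, hx.2, hx.2 ▸ hx.1.2⟩
  have hsplit := Finset.sum_filter_add_sum_filter_not Y
    (fun x => P.rl col (col x) x < δ / 2 * D) P.w
  have hle : ∑ x ∈ Y with ¬ P.rl col (col x) x < δ / 2 * D, P.w x ≤
      ∑ x ∈ X with δ / 2 * D ≤ P.rl col (col x) x, P.w x := by
    refine Finset.sum_le_sum_of_subset_of_nonneg ?_
      fun x hx _ => (w_pos_of_mem (hXA x (Finset.mem_filter.1 hx).1)).le
    intro x hx
    simp only [hY, Finset.mem_filter, not_lt] at hx ⊢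
    exact ⟨hx.1.1, hx.2⟩
  linarith

/-- The vertices `bot k`, `tp k` are the ends of the color class of `k`. -/
structure MonoData (P : ParentTree V) (col : V → ℤ) where
  tp : ℤ → V
  bot : ℤ → V
  sub : ∀ k, P.A (tp k) ⊆ P.A (bot k)
  mem : ∀ k x, x ≠ P.root → (col x = k ↔ x ∈ P.A (bot k) \ P.A (tp k))

lemma Mono.exists_data {col : V → ℤ} (h : P.Mono col) : Nonempty (MonoData P col) := by
  choose a b hab hm using h
  exact ⟨⟨a, b, hab, hm⟩⟩

namespace MonoData

variable {col : V → ℤ} (M : MonoData P col)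

include M

lemma mem_bot {x : V} (hx : x ≠ P.root) : x ∈ P.A (M.bot (col x)) :=
  (Finset.mem_sdiff.1 ((M.mem (col x) x hx).1 rfl)).1

lemma notMem_tp {x : V} (hx : x ≠ P.root) : x ∉ P.A (M.tp (col x)) :=
  (Finset.mem_sdiff.1 ((M.mem (col x) x hx).1 rfl)).2

lemma tp_sub_par {x : V} (hx : x ≠ P.root) : P.A (M.tp (col x)) ⊆ P.A (P.par x) :=
  A_subset_par (M.sub _) (M.mem_bot hx) (M.notMem_tp hx)

lemma tp_sub {x : V} (hx : x ≠ P.root) : P.A (M.tp (col x)) ⊆ P.A x :=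
  (M.tp_sub_par hx).trans (P.A_par_subset hx)

lemma col_of_notMem_tp {x y : V} (hx : x ≠ P.root) (hy : y ∈ P.A x)
    (h : y ∉ P.A (M.tp (col x))) : col y = col x :=
  (M.mem _ y (ne_root_of_mem hy)).2
    (Finset.mem_sdiff.2 ⟨subset_of_mem (M.mem_bot hx) hy, h⟩)

lemma col_between {v y z : V} (hy : y ∈ P.A v) (hz : z ∈ P.A y) (h : col z = col v) :
    col y = col v := by
  by_cases hv : v = P.root
  · subst hv; simp [A_root] at hy
  refine M.col_of_notMem_tp hv hy fun hmem => ?_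
  rw [← h] at hmem
  exact M.notMem_tp (ne_root_of_mem hz) (subset_of_mem hmem hz)

/-- Vertices of the same color are comparable. -/
lemma comparable {x y : V} (hx : x ≠ P.root) (hy : y ≠ P.root) (h : col x = col y) :
    x ∈ P.A y ∨ y ∈ P.A x :=
  chain (M.mem_bot hx) (h ▸ M.mem_bot hy)

lemma rl_eq {v : V} (hv : v ≠ P.root) :
    P.rl col (col v) v = P.dep v - P.dep (M.tp (col v)) := by
  rw [rl, ← sum_sdiff_w (M.tp_sub hv)]
  refine Finset.sum_congr ?_ fun _ _ => rfl
  ext x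
  simp only [Finset.mem_filter, Finset.mem_sdiff]
  constructor
  · rintro ⟨h1, h2⟩
    exact ⟨h1, h2 ▸ M.notMem_tp (ne_root_of_mem h1)⟩
  · rintro ⟨h1, h2⟩
    exact ⟨h1, M.col_of_notMem_tp hv h1 h2⟩

/-- The long part of the path from the top of color `k` to `v`. -/
noncomputable def S (δ : ℝ) (k : ℤ) (v : V) : ℝ :=
  ∑ x ∈ P.A v \ P.A (M.tp k) with
    δ / 2 * (P.dep x - P.dep (M.tp k)) ≤ P.rl col (col x) x, P.w x

/-- The second coordinate of the embedding. -/
noncomputable def sc (δ : ℝ) (k : ℤ) (v : V) : ℝ := √(P.rl col k v * M.S δ k v)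

lemma S_nonneg (δ : ℝ) (k : ℤ) (v : V) : 0 ≤ M.S δ k v :=
  Finset.sum_nonneg fun _ hx =>
    (w_pos_of_mem (Finset.mem_sdiff.1 (Finset.mem_filter.1 hx).1).1).le

lemma S_ge {δ : ℝ} (hδ : 0 < δ) (hs : P.Strong δ col) {k : ℤ} {v : V}
    (h : P.A (M.tp k) ⊆ P.A v) : (P.dep v - P.dep (M.tp k)) / 4 ≤ M.S δ k v := by
  refine (sum_long_ge hδ hs h).trans ?_
  refine Finset.sum_le_sum_of_subset_of_nonneg ?_
      fun x hx _ => (w_pos_of_mem (Finset.mem_sdiff.1 (Finset.mem_filter.1 hx).1).1).le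
  intro x hx
  simp only [Finset.mem_filter] at hx ⊢
  refine ⟨hx.1, le_trans ?_ hx.2⟩
  have := dep_mono (subset_of_mem (Finset.mem_sdiff.1 hx.1).1)
  gcongr

lemma sc_eq {δ : ℝ} (hδ : δ ≤ 1) {v : V} (hv : v ≠ P.root) :
    M.sc δ (col v) v = P.rl col (col v) v := by
  have : M.S δ (col v) v = P.rl col (col v) v := by
    rw [M.rl_eq hv, S, ← sum_sdiff_w (M.tp_sub hv), Finset.filter_true_of_mem]
    intro x hx
    rw [Finset.mem_sdiff] at hx
    have hc := M.col_of_notMem_tp hv hx.1 hx.2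
    have hx0 := ne_root_of_mem hx.1
    have h1 := M.rl_eq hx0
    have h2 := rl_nonneg (P := P) col (col x) x
    rw [h1, hc] at *
    nlinarith
  rw [sc, this, Real.sqrt_mul_self (rl_nonneg _ _ _)]

end MonoData

end ParentTree
end Upper

section Upper
open scoped Classical

namespace ParentTree

variable {V : Type*} {P : ParentTree V}

lemma rl_par_of_ne {col : V → ℤ} {v : V} (hv : v ≠ P.root) {k : ℤ} (hk : k ≠ col v) :
    P.rl col k v = P.rl col k (P.par v) := by
  rw [rl, P.A_of_ne hv, Finset.filter_insert, if_neg hk.symm, rl]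

lemma rl_par_self {col : V → ℤ} {v : V} (hv : v ≠ P.root) :
    P.rl col (col v) v = P.rl col (col v) (P.par v) + P.w v := by
  rw [rl, P.A_of_ne hv, Finset.filter_insert, if_pos rfl, Finset.sum_insert, rl, add_comm]
  exact fun h => notMem_A_par hv (Finset.mem_filter.1 h).1

namespace MonoData

variable {col : V → ℤ} (M : MonoData P col)

include M

lemma sum_log_le {δ : ℝ} (hδ : 0 < δ) (hδ1 : δ < 1) {v : V} (hv : v ≠ P.root) :
    ∑ x ∈ P.A (P.par v) with col x ≠ col v ∧
      δ / 2 * (P.dep v - P.dep (M.tp (col x))) ≤ P.rl col (col v) v,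
      P.w x / (P.dep v - P.dep (M.tp (col x))) ≤ Real.log (2 / δ) := by
  set c := P.rl col (col v) v with hc
  have hcv : c = P.dep v - P.dep (M.tp (col v)) := M.rl_eq hv
  have hc0 : 0 < c := by
    have h1 := dep_mono (M.tp_sub_par hv)
    have h2 := P.dep_of_ne hv
    have h3 := P.w_pos v hv
    linarith
  set C := 2 / δ * c with hC
  have hcC : c ≤ C := by
    have : 1 ≤ 2 / δ := by rw [le_div_iff₀ hδ]; linarith
    nlinarith
  set cp : ℝ → ℝ := fun t => max c (min C t) with hcp
  have hcp0 : ∀ t, 0 < cp t := fun t => lt_max_of_lt_left hc0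
  have hcpm : ∀ s t, s ≤ t → cp s ≤ cp t := fun s t h =>
    max_le_max le_rfl (min_le_min le_rfl h)
  have hcpi : ∀ t, c ≤ t → t ≤ C → cp t = t := by
    intro t h1 h2
    simp only [hcp, min_eq_right h2, max_eq_right h1]
  set g : V → ℝ := fun y => Real.log (cp (P.dep v - P.dep y)) with hg
  have hmono : ∀ x ∈ P.A (P.par v), 0 ≤ g (P.par x) - g x := by
    intro x hx
    have := dep_mono (P.A_par_subset (ne_root_of_mem hx))
    exact sub_nonneg.2 (Real.log_le_log (hcp0 _) (hcpm _ _ (by linarith)))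
  have hterm : ∀ x ∈ (P.A (P.par v)).filter (fun x => col x ≠ col v ∧
      δ / 2 * (P.dep v - P.dep (M.tp (col x))) ≤ c),
      P.w x / (P.dep v - P.dep (M.tp (col x))) ≤ g (P.par x) - g x := by
    intro x hx
    obtain ⟨hxp, hne, hcond⟩ := Finset.mem_filter.1 hx
    have hx0 := ne_root_of_mem hxp
    have hxtp : x ∈ P.A (M.tp (col v)) := by
      by_contra h
      exact hne (M.col_of_notMem_tp hv (P.A_par_subset hv hxp) h)
    have h1 := dep_mono (subset_of_mem hxtp)
    have h2 := dep_mono (M.tp_sub_par hx0)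
    have h3 := P.dep_of_ne hx0
    have h4 := P.w_pos x hx0
    set R := P.dep v - P.dep (M.tp (col x))
    set s := P.dep v - P.dep (P.par x) with hs
    set t := P.dep v - P.dep x with ht
    have hst : s = t + P.w x := by rw [hs, ht, h3]; ring
    have hsR : s ≤ R := by simp only [hs, R]; linarith
    have hct : c ≤ t := by linarith
    have hRC : R ≤ C := by
      rw [hC, div_mul_eq_mul_div, le_div_iff₀ hδ]; linarith
    have ht0 : 0 < t := hc0.trans_le hct
    have hs0 : 0 < s := by linarith
    simp only [hg]
    rw [← hs, ← ht, hcpi s (by linarith) (hsR.trans hRC), hcpi t hct (by linarith),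
      ← Real.log_div hs0.ne' ht0.ne']
    have h5 := Real.one_sub_inv_le_log_of_pos (div_pos hs0 ht0)
    refine le_trans ?_ h5
    rw [inv_div, one_sub_div hs0.ne', hst, add_sub_cancel_left, ← hst]
    exact div_le_div_of_nonneg_left h4.le hs0 hsR
  calc _ ≤ ∑ x ∈ (P.A (P.par v)).filter (fun x => col x ≠ col v ∧
      δ / 2 * (P.dep v - P.dep (M.tp (col x))) ≤ c), (g (P.par x) - g x) :=
        Finset.sum_le_sum hterm
    _ ≤ ∑ x ∈ P.A (P.par v), (g (P.par x) - g x) :=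
        Finset.sum_le_sum_of_subset_of_nonneg (Finset.filter_subset _ _)
          fun x hx _ => hmono x hx
    _ = g P.root - g (P.par v) := sum_telescope g _
    _ ≤ Real.log C - Real.log c := by
        refine sub_le_sub (Real.log_le_log (hcp0 _) (max_le hcC (min_le_left _ _)))
          (Real.log_le_log hc0 (le_max_left _ _))
    _ = Real.log (2 / δ) := by
        rw [← Real.log_div (hc0.trans_le hcC).ne' hc0.ne', hC, mul_div_assoc, div_self hc0.ne',
          mul_one]

lemma sc_par_self {δ : ℝ} (hδ : δ ≤ 1) {v : V} (hv : v ≠ P.root) :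
    M.sc δ (col v) (P.par v) = P.rl col (col v) (P.par v) := by
  by_cases h : ∃ z ∈ P.A (P.par v), col z = col v
  · obtain ⟨z, hz, hzc⟩ := h
    have hp : P.par v ≠ P.root := by intro h; rw [h, A_root] at hz; simp at hz
    have : col (P.par v) = col v :=
      M.col_between (P.A_par_subset hv (P.self_mem hp)) hz hzc
    rw [← this, M.sc_eq hδ hp]
  · push Not at h
    rw [sc, rl_eq_zero h, zero_mul, Real.sqrt_zero]

lemma S_par {δ : ℝ} {v : V} (hv : v ≠ P.root) {k : ℤ} (hk : P.A (M.tp k) ⊆ P.A (P.par v)) :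
    M.S δ k v = M.S δ k (P.par v) +
      if δ / 2 * (P.dep v - P.dep (M.tp k)) ≤ P.rl col (col v) v then P.w v else 0 := by
  have hv' : v ∉ P.A (M.tp k) := fun h => notMem_A_par hv (hk h)
  rw [S, P.A_of_ne hv, Finset.insert_sdiff_of_notMem _ hv', Finset.filter_insert]
  split_ifs
  · rw [Finset.sum_insert, S, add_comm]
    exact fun h => notMem_A_par hv (Finset.mem_sdiff.1 (Finset.mem_filter.1 h).1).1
  · rw [S, add_zero]

lemma sc_diff_le {δ : ℝ} (hδ : 0 < δ) (hs : P.Strong δ col) {v : V} (hv : v ≠ P.root) {k : ℤ}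
    (hk : k ≠ col v) {z : V} (hz : z ∈ P.A (P.par v)) (hzk : col z = k) :
    (M.sc δ k v - M.sc δ k (P.par v)) ^ 2 ≤
      if δ / 2 * (P.dep v - P.dep (M.tp k)) ≤ P.rl col (col v) v then
        4 * P.w v ^ 2 * (P.rl col k (P.par v) / (P.dep v - P.dep (M.tp k))) else 0 := by
  have hw := P.w_pos v hv
  have htp : P.A (M.tp k) ⊆ P.A (P.par v) :=
    hzk ▸ (M.tp_sub (ne_root_of_mem hz)).trans (subset_of_mem hz)
  have hS := M.S_par (δ := δ) hv htp
  have hL : 0 ≤ P.rl col k (P.par v) := rl_nonneg _ _ _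
  have hS0 := M.S_nonneg δ k (P.par v)
  rw [sc, sc, rl_par_of_ne hv hk]
  split_ifs at hS ⊢ with hc
  · have hR : 0 < P.dep v - P.dep (M.tp k) := by
      have h1 := dep_mono htp
      have h2 := P.dep_of_ne hv
      linarith
    have hge := M.S_ge hδ hs (htp.trans (P.A_par_subset hv))
    rw [hS] at hge ⊢
    set S0 := M.S δ k (P.par v)
    set Lk := P.rl col k (P.par v)
    set w := P.w v
    set R := P.dep v - P.dep (M.tp k)
    have hSw : 0 < S0 + w := by linarith
    have e1 : (√(Lk * (S0 + w)) - √(Lk * S0)) ^ 2 = Lk * (√(S0 + w) - √S0) ^ 2 := by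
      rw [Real.sqrt_mul hL, Real.sqrt_mul hL, ← mul_sub, mul_pow, Real.sq_sqrt hL]
    have e2 : (√(S0 + w) - √S0) ^ 2 * (S0 + w) ≤ w ^ 2 := by
      have a1 := Real.sq_sqrt hSw.le
      have a2 := Real.sq_sqrt hS0
      have a3 := Real.sqrt_nonneg S0
      have a4 : √S0 ≤ √(S0 + w) := Real.sqrt_le_sqrt (by linarith)
      have : (√(S0 + w) - √S0) * √(S0 + w) ≤ w := by nlinarith
      have h0 : 0 ≤ (√(S0 + w) - √S0) * √(S0 + w) :=
        mul_nonneg (sub_nonneg.2 a4) (Real.sqrt_nonneg _)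
      calc _ = ((√(S0 + w) - √S0) * √(S0 + w)) ^ 2 := by rw [mul_pow, a1]
        _ ≤ w ^ 2 := pow_le_pow_left₀ h0 this 2
    rw [e1]
    have e3 : (√(S0 + w) - √S0) ^ 2 ≤ 4 * w ^ 2 / R := by
      rw [le_div_iff₀ hR]
      have := sq_nonneg (√(S0 + w) - √S0)
      nlinarith
    calc Lk * (√(S0 + w) - √S0) ^ 2 ≤ Lk * (4 * w ^ 2 / R) := by gcongr
      _ = _ := by ring
  · rw [hS, add_zero, sub_self]; simp

/-- The squared distance of the embedding, restricted to a finite set of colors. -/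
noncomputable def sqDist (δ : ℝ) (K : Finset ℤ) (u v : V) : ℝ :=
  ∑ k ∈ K, ((P.rl col k u - P.rl col k v) ^ 2 + (M.sc δ k u - M.sc δ k v) ^ 2)

lemma sqDist_edge {δ : ℝ} (hδ : 0 < δ) (hδ1 : δ < 1) (hs : P.Strong δ col) {v : V}
    (hv : v ≠ P.root) :
    M.sqDist δ ((P.A v).image col) v (P.par v) ≤
      P.w v ^ 2 * (2 + 4 * Real.log (2 / δ)) := by
  have hκ : col v ∈ (P.A v).image col := Finset.mem_image_of_mem _ (P.self_mem hv)
  rw [sqDist, ← Finset.add_sum_erase _ _ hκ, rl_par_self hv, M.sc_par_self hδ1.le hv,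
    M.sc_eq hδ1.le hv, rl_par_self hv, add_sub_cancel_left, mul_add]
  refine add_le_add (by linarith) ?_
  set K := ((P.A v).image col).erase (col v) with hK
  have hKz : ∀ k ∈ K, k ≠ col v ∧ ∃ z ∈ P.A (P.par v), col z = k := by
    intro k hk
    obtain ⟨h1, h2⟩ := Finset.mem_erase.1 hk
    obtain ⟨z, hz, rfl⟩ := Finset.mem_image.1 h2
    exact ⟨h1, z, mem_A_par hz (fun h => h1 (by rw [h])), rfl⟩
  set F := (P.A (P.par v)).filter (fun x => col x ≠ col v ∧
      δ / 2 * (P.dep v - P.dep (M.tp (col x))) ≤ P.rl col (col v) v) with hF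
  have hFK : ∀ x ∈ F, col x ∈ K := by
    intro x hx
    obtain ⟨h1, h2, -⟩ := Finset.mem_filter.1 hx
    exact Finset.mem_erase.2 ⟨h2, Finset.mem_image_of_mem _ (P.A_par_subset hv h1)⟩
  have hlog := M.sum_log_le hδ hδ1 hv
  rw [← hF, ← Finset.sum_fiberwise_of_maps_to hFK] at hlog
  calc _ ≤ ∑ k ∈ K, 4 * P.w v ^ 2 *
      ∑ x ∈ F with col x = k, P.w x / (P.dep v - P.dep (M.tp (col x))) := by
        refine Finset.sum_le_sum fun k hk => ?_
        obtain ⟨hne, z, hz, hzk⟩ := hKz k hk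
        rw [rl_par_of_ne hv hne, sub_self, zero_pow two_ne_zero, zero_add]
        refine (M.sc_diff_le hδ hs hv hne hz hzk).trans ?_
        split_ifs with hc
        · refine mul_le_mul_of_nonneg_left (le_of_eq ?_) (by positivity)
          rw [rl, Finset.sum_div]
          refine Finset.sum_congr ?_ fun x hx => ?_
          · ext x
            simp only [hF, Finset.mem_filter]
            constructor
            · rintro ⟨h1, rfl⟩; exact ⟨⟨h1, hne, hc⟩, rfl⟩
            · rintro ⟨⟨h1, -⟩, h2⟩; exact ⟨h1, h2⟩
          · rw [(Finset.mem_filter.1 hx).2]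
        · refine mul_nonneg (by positivity) (Finset.sum_nonneg fun x hx => ?_)
          have hxp := (Finset.mem_filter.1 (Finset.mem_filter.1 hx).1).1
          have hx0 := ne_root_of_mem hxp
          refine div_nonneg (P.w_pos x hx0).le (sub_nonneg.2 (dep_mono ?_))
          exact (M.tp_sub hx0).trans ((subset_of_mem hxp).trans (P.A_par_subset hv))
    _ ≤ P.w v ^ 2 * (4 * Real.log (2 / δ)) := by
        rw [← Finset.mul_sum]
        have := sq_nonneg (P.w v)
        nlinarith

end MonoData

end ParentTree
end Upper

section Upper
open scoped Classical

namespace ParentTree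

variable {V : Type*} {P : ParentTree V}

/-- Half of the pairs in a chain are comparable in a given direction. -/
lemma sum_chain_ge {v : V} {Y : Finset V} (hY : Y ⊆ P.A v) :
    (∑ x ∈ Y, P.w x) ^ 2 / 2 ≤ ∑ x ∈ Y, P.w x * ∑ y ∈ Y with x ∈ P.A y, P.w y := by
  have hw : ∀ x ∈ Y, 0 < P.w x := fun x hx => w_pos_of_mem (hY hx)
  set B := ∑ x ∈ Y, ∑ y ∈ Y, if x ∈ P.A y then P.w x * P.w y else 0 with hB
  have e1 : ∑ x ∈ Y, P.w x * ∑ y ∈ Y with x ∈ P.A y, P.w y = B := by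
    refine Finset.sum_congr rfl fun x _ => ?_
    rw [Finset.sum_filter, Finset.mul_sum]
    refine Finset.sum_congr rfl fun y _ => ?_
    split_ifs <;> simp
  have e2 : B = ∑ x ∈ Y, ∑ y ∈ Y, if y ∈ P.A x then P.w x * P.w y else 0 := by
    rw [hB, Finset.sum_comm]
    simp_rw [mul_comm]
  have e3 : (∑ x ∈ Y, P.w x) ^ 2 ≤ B + B := by
    conv_rhs => enter [2]; rw [e2]
    rw [hB, sq, Finset.sum_mul_sum, ← Finset.sum_add_distrib]
    refine Finset.sum_le_sum fun x hx => ?_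
    rw [← Finset.sum_add_distrib]
    refine Finset.sum_le_sum fun y hy => ?_
    have := mul_pos (hw x hx) (hw y hy)
    rcases chain (hY hx) (hY hy) with h | h
    · rw [if_pos h]; split_ifs <;> linarith
    · rw [if_pos h]; split_ifs <;> linarith
  rw [e1]; linarith

namespace MonoData

variable {col : V → ℤ} (M : MonoData P col)

include M

/-- Beyond a branch point only the color of the first edge can occur on the other branch. -/
lemma col_eq_first {m u v x0 x y : V} (hm : P.A m = P.A u ∩ P.A v)
    (hx0 : x0 ∈ P.A u) (hpar : P.par x0 = m) (hx : x ∈ P.A u) (hxv : x ∉ P.A v)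
    (hy : y ∈ P.A v) (hxy : col x = col y) : col x0 = col x := by
  have hyx : y ∈ P.A x := by
    rcases M.comparable (ne_root_of_mem hx) (ne_root_of_mem hy) hxy with h | h
    · exact absurd (subset_of_mem hy h) hxv
    · exact h
  have hym : y ∈ P.A m := by
    rw [hm]; exact Finset.mem_inter.2 ⟨subset_of_mem hx hyx, hy⟩
  have hyx0 : y ∈ P.A x0 := P.A_par_subset (ne_root_of_mem hx0) (hpar ▸ hym)
  have hx0x : x0 ∈ P.A x := by
    rcases chain hx0 hx with h | h
    · exact h
    · by_cases hne : x = x0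
      · exact hne ▸ P.self_mem (ne_root_of_mem hx)
      · have := mem_A_par h hne
        rw [hpar, hm] at this
        exact absurd (Finset.mem_inter.1 this).2 hxv
  exact M.col_between hx0x hyx0 hxy.symm

lemma sqDist_ge_of_lca {δ : ℝ} (hδ : 0 < δ) (hs : P.Strong δ col) {m u v : V}
    (hm : P.A m = P.A u ∩ P.A v) :
    ((P.dep u - P.dep m) / 16) ^ 2 ≤
      M.sqDist δ ((P.A u).image col ∪ (P.A v).image col) u v := by
  have hmu : P.A m ⊆ P.A u := hm ▸ Finset.inter_subset_left
  have hmv : P.A m ⊆ P.A v := hm ▸ Finset.inter_subset_right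
  set K := (P.A u).image col ∪ (P.A v).image col with hK
  have hnn : ∀ k ∈ K, 0 ≤ (P.rl col k u - P.rl col k v) ^ 2 +
      (M.sc δ k u - M.sc δ k v) ^ 2 := fun k _ => by positivity
  by_cases hne : m = u
  · subst hne
    rw [sub_self, zero_div, zero_pow two_ne_zero]
    exact Finset.sum_nonneg hnn
  obtain ⟨x0, hx0, hpar⟩ := exists_first hmu hne
  set X := P.A u \ P.A m with hX
  have hXu : ∀ x ∈ X, x ∈ P.A u := fun x hx => (Finset.mem_sdiff.1 hx).1
  have hXv : ∀ x ∈ X, x ∉ P.A v := fun x hx h => (Finset.mem_sdiff.1 hx).2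
    (hm ▸ Finset.mem_inter.2 ⟨hXu x hx, h⟩)
  have hX0 : ∀ x ∈ X, x ≠ P.root := fun x hx => ne_root_of_mem (hXu x hx)
  have hXw : ∀ x ∈ X, 0 < P.w x := fun x hx => P.w_pos x (hX0 x hx)
  set D1 := P.dep u - P.dep m with hD1
  have hD0 : 0 ≤ D1 := sub_nonneg.2 (dep_mono hmu)
  have hfirst : ∀ x ∈ X, ∀ y ∈ P.A v, col x = col y → col x = col x0 := fun x hx y hy h =>
    (M.col_eq_first hm (hXu _ hx0) hpar (hXu x hx) (hXv x hx) hy h).symm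
  set ξ := ∑ x ∈ X with col x = col x0, P.w x with hξ
  have hξeq : P.rl col (col x0) u - P.rl col (col x0) v = ξ := by
    have e1 : P.rl col (col x0) u = ξ + P.rl col (col x0) m := by
      rw [rl, hξ, rl, hX, ← Finset.sum_union]
      · congr 1
        rw [← Finset.filter_union, Finset.sdiff_union_of_subset hmu]
      · exact Finset.disjoint_filter_filter Finset.sdiff_disjoint
    have e2 : P.rl col (col x0) v = P.rl col (col x0) m := by
      rw [rl, rl]
      refine Finset.sum_congr ?_ fun _ _ => rfl
      ext y
      simp only [Finset.mem_filter]
      refine ⟨fun ⟨h1, h2⟩ => ⟨?_, h2⟩, fun ⟨h1, h2⟩ => ⟨hmv h1, h2⟩⟩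
      rw [hm]
      refine Finset.mem_inter.2 ⟨?_, h1⟩
      rcases M.comparable (hX0 _ hx0) (ne_root_of_mem h1) h2.symm with h | h
      · exact absurd (subset_of_mem h1 h) (hXv _ hx0)
      · exact subset_of_mem (hXu _ hx0) h
    rw [e1, e2]; ring
  have hκK : ∀ x ∈ X, col x ∈ K := fun x hx =>
    Finset.mem_union_left _ (Finset.mem_image_of_mem _ (hXu x hx))
  by_cases hbig : D1 / 16 ≤ ξ
  · calc (D1 / 16) ^ 2 ≤ ξ ^ 2 := pow_le_pow_left₀ (by positivity) hbig 2
      _ ≤ (P.rl col (col x0) u - P.rl col (col x0) v) ^ 2 +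
          (M.sc δ (col x0) u - M.sc δ (col x0) v) ^ 2 := by
          rw [hξeq]; nlinarith [sq_nonneg (M.sc δ (col x0) u - M.sc δ (col x0) v)]
      _ ≤ _ := Finset.single_le_sum hnn (hκK _ hx0)
  push Not at hbig
  set Y := X.filter (fun x => δ / 2 * D1 ≤ P.rl col (col x) x) with hY
  have hYX : Y ⊆ X := Finset.filter_subset _ _
  set g := ∑ x ∈ Y, P.w x with hg
  have hgD : D1 / 4 ≤ g := sum_long_ge hδ hs hmu
  have hchain := sum_chain_ge (P := P) (Y := Y) (v := u) fun x hx => hXu x (hYX hx)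
  rw [← hg] at hchain
  set X' := X.filter (fun x => col x ≠ col x0) with hX'
  have hS : ∀ x ∈ X', ∑ y ∈ Y with x ∈ P.A y, P.w y ≤ M.S δ (col x) u := by
    intro x hx
    obtain ⟨hxX, hxne⟩ := Finset.mem_filter.1 hx
    have hmtp : P.dep m ≤ P.dep (M.tp (col x)) := by
      by_contra hlt
      push Not at hlt
      have htu : P.A (M.tp (col x)) ⊆ P.A u :=
        (M.tp_sub (hX0 x hxX)).trans (subset_of_mem (hXu x hxX))
      have hsub : P.A (M.tp (col x)) ⊆ P.A m := subset_of_dep_le htu hmu hlt.le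
      have hne' : M.tp (col x) ≠ m := by rintro h; rw [h] at hlt; exact lt_irrefl _ hlt
      obtain ⟨t, ht, -⟩ := exists_first hsub hne'
      rw [Finset.mem_sdiff] at ht
      have hmx : P.A m ⊆ P.A x := by
        refine (A_total hmu (subset_of_mem (hXu x hxX))).resolve_right fun h => ?_
        exact (Finset.mem_sdiff.1 hxX).2 (mem_of_subset (hX0 x hxX) h)
      have htc : col t = col x := M.col_of_notMem_tp (hX0 x hxX) (hmx ht.1) ht.2
      exact hxne (hfirst x hxX t (hmv ht.1) htc.symm)
    refine Finset.sum_le_sum_of_subset_of_nonneg ?_ fun y hy _ =>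
      (w_pos_of_mem (Finset.mem_sdiff.1 (Finset.mem_filter.1 hy).1).1).le
    intro y hy
    obtain ⟨hyY, hxy⟩ := Finset.mem_filter.1 hy
    obtain ⟨hyX, hyl⟩ := Finset.mem_filter.1 hyY
    rw [Finset.mem_filter, Finset.mem_sdiff]
    refine ⟨⟨hXu y hyX, fun h => M.notMem_tp (hX0 x hxX) (subset_of_mem h hxy)⟩,
      le_trans ?_ hyl⟩
    have := dep_mono (subset_of_mem (hXu y hyX))
    refine mul_le_mul_of_nonneg_left ?_ (by positivity)
    linarith
  have hmain : g ^ 2 / 2 - ξ * g ≤ ∑ x ∈ X', P.w x * M.S δ (col x) u := by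
    have h1 := Finset.sum_filter_add_sum_filter_not Y (fun x => col x = col x0)
      (fun x => P.w x * ∑ y ∈ Y with x ∈ P.A y, P.w y)
    have h2 : ∑ x ∈ Y with col x = col x0, P.w x * ∑ y ∈ Y with x ∈ P.A y, P.w y ≤ ξ * g := by
      rw [hξ, Finset.sum_mul]
      calc _ ≤ ∑ x ∈ Y with col x = col x0, P.w x * g := by
            refine Finset.sum_le_sum fun x hx => ?_
            refine mul_le_mul_of_nonneg_left ?_ (hXw x (hYX (Finset.mem_filter.1 hx).1)).le
            exact Finset.sum_le_sum_of_subset_of_nonneg (Finset.filter_subset _ _)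
              fun y hy _ => (hXw y (hYX hy)).le
        _ ≤ _ := by
            refine Finset.sum_le_sum_of_subset_of_nonneg
              (Finset.filter_subset_filter _ hYX) fun x hx _ => ?_
            exact mul_nonneg (hXw x (Finset.mem_filter.1 hx).1).le (by linarith)
    have h3 : ∑ x ∈ Y with ¬ col x = col x0, P.w x * ∑ y ∈ Y with x ∈ P.A y, P.w y ≤
        ∑ x ∈ X', P.w x * M.S δ (col x) u := by
      calc _ ≤ ∑ x ∈ X', P.w x * ∑ y ∈ Y with x ∈ P.A y, P.w y := by
            refine Finset.sum_le_sum_of_subset_of_nonneg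
              (Finset.filter_subset_filter _ hYX) fun x hx _ => ?_
            exact mul_nonneg (hXw x (Finset.mem_filter.1 hx).1).le
              (Finset.sum_nonneg fun y hy => (hXw y (hYX (Finset.mem_filter.1 hy).1)).le)
        _ ≤ _ := Finset.sum_le_sum fun x hx =>
            mul_le_mul_of_nonneg_left (hS x hx) (hXw x (Finset.mem_filter.1 hx).1).le
    linarith
  have hsum : ∑ x ∈ X', P.w x * M.S δ (col x) u ≤ M.sqDist δ K u v := by
    rw [← Finset.sum_fiberwise_of_maps_to (s := X') (t := K) (g := col)
      (fun x hx => hκK x (Finset.mem_filter.1 hx).1)]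
    refine Finset.sum_le_sum fun k _ => ?_
    by_cases hk : ∃ x ∈ X', col x = k
    · obtain ⟨x, hx, rfl⟩ := hk
      obtain ⟨hxX, hxne⟩ := Finset.mem_filter.1 hx
      have hv0 : ∀ y ∈ P.A v, col y ≠ col x := fun y hy h =>
        hxne (hfirst x hxX y hy h.symm)
      have hscv : M.sc δ (col x) v = 0 := by
        rw [sc, rl_eq_zero hv0, zero_mul, Real.sqrt_zero]
      have hle : ∑ y ∈ X' with col y = col x, P.w y * M.S δ (col y) u ≤
          P.rl col (col x) u * M.S δ (col x) u := by
        rw [rl, Finset.sum_mul]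
        calc _ = ∑ y ∈ X' with col y = col x, P.w y * M.S δ (col x) u :=
              Finset.sum_congr rfl fun y hy => by rw [(Finset.mem_filter.1 hy).2]
          _ ≤ _ := by
              refine Finset.sum_le_sum_of_subset_of_nonneg ?_ fun y hy _ =>
                mul_nonneg (w_pos_of_mem (Finset.mem_filter.1 hy).1).le (M.S_nonneg _ _ _)
              refine Finset.filter_subset_filter _ fun y hy => ?_
              exact hXu y (Finset.mem_filter.1 hy).1
      rw [hscv, sub_zero]
      have : M.sc δ (col x) u ^ 2 = P.rl col (col x) u * M.S δ (col x) u :=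
        Real.sq_sqrt (mul_nonneg (rl_nonneg _ _ _) (M.S_nonneg _ _ _))
      rw [this]
      nlinarith [sq_nonneg (P.rl col (col x) u - P.rl col (col x) v)]
    · push Not at hk
      rw [Finset.filter_false_of_mem hk, Finset.sum_empty]
      positivity
  refine le_trans ?_ (hmain.trans hsum)
  have : D1 / 4 * (D1 / 8 - D1 / 16) ≤ g * (g / 2 - ξ) :=
    mul_le_mul hgD (by linarith) (by linarith) (by linarith)
  nlinarith

lemma sqDist_comm (δ : ℝ) (K : Finset ℤ) (u v : V) : M.sqDist δ K u v = M.sqDist δ K v u := by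
  rw [sqDist, sqDist]
  exact Finset.sum_congr rfl fun k _ => by ring

lemma sqDist_ge {δ : ℝ} (hδ : 0 < δ) (hs : P.Strong δ col) (u v : V) :
    (P.d u v / 32) ^ 2 ≤ M.sqDist δ ((P.A u).image col ∪ (P.A v).image col) u v := by
  obtain ⟨m, hm⟩ := exists_lca (P := P) u v
  have h1 := dep_mono (P := P) (a := m) (b := u) (hm ▸ Finset.inter_subset_left)
  have h2 := dep_mono (P := P) (a := m) (b := v) (hm ▸ Finset.inter_subset_right)
  have hd := d_eq_of_lca hm
  have hd0 := d_nonneg (P := P) u v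
  rcases le_total (P.dep v - P.dep m) (P.dep u - P.dep m) with h | h
  · refine le_trans (pow_le_pow_left₀ (by positivity) ?_ 2) (M.sqDist_ge_of_lca hδ hs hm)
    linarith
  · rw [Finset.inter_comm] at hm
    rw [sqDist_comm, Finset.union_comm]
    refine le_trans (pow_le_pow_left₀ (by positivity) ?_ 2) (M.sqDist_ge_of_lca hδ hs hm)
    linarith

variable {H : Type*} [NormedAddCommGroup H] [InnerProductSpace ℝ H]

/-- The embedding associated with a monotone coloring. -/
noncomputable def emb (δ : ℝ) (e : ℤ ⊕ ℤ → H) (v : V) : H :=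
  ∑ i ∈ ((P.A v).image col).disjSum ((P.A v).image col),
    Sum.elim (fun k => P.rl col k v) (fun k => M.sc δ k v) i • e i

lemma emb_eq (δ : ℝ) (e : ℤ ⊕ ℤ → H) {v : V} {K : Finset ℤ} (hK : (P.A v).image col ⊆ K) :
    M.emb δ e v = ∑ i ∈ K.disjSum K,
      Sum.elim (fun k => P.rl col k v) (fun k => M.sc δ k v) i • e i := by
  refine Finset.sum_subset (Finset.disjSum_mono hK hK) fun i _ hi => ?_
  have h0 : ∀ k, k ∉ (P.A v).image col → P.rl col k v = 0 := fun k hk =>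
    rl_eq_zero fun x hx h => hk (h ▸ Finset.mem_image_of_mem _ hx)
  cases i with
  | inl k =>
    rw [Finset.inl_mem_disjSum] at hi
    simp [h0 k hi]
  | inr k =>
    rw [Finset.inr_mem_disjSum] at hi
    simp [sc, h0 k hi]

lemma norm_emb_sub_sq (δ : ℝ) {e : ℤ ⊕ ℤ → H} (he : Orthonormal ℝ e) {u v : V} {K : Finset ℤ}
    (hu : (P.A u).image col ⊆ K) (hv : (P.A v).image col ⊆ K) :
    ‖M.emb δ e u - M.emb δ e v‖ ^ 2 = M.sqDist δ K u v := by
  rw [M.emb_eq δ e hu, M.emb_eq δ e hv, ← Finset.sum_sub_distrib]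
  simp_rw [← sub_smul]
  rw [← real_inner_self_eq_norm_sq, he.inner_sum, Finset.sum_disjSum, sqDist,
    Finset.sum_add_distrib]
  simp [sq]

end MonoData

/-- A strong coloring yields a Euclidean embedding. -/
theorem Strong.exists_embedding {δ : ℝ} (hδ : 0 < δ) (hδ1 : δ < 1) {col : V → ℤ}
    (hs : P.Strong δ col) {H : Type*} [NormedAddCommGroup H] [InnerProductSpace ℝ H]
    {e : ℤ ⊕ ℤ → H} (he : Orthonormal ℝ e) :
    ∃ f : V → H, ∀ u v, P.d u v / 32 ≤ ‖f u - f v‖ ∧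
      ‖f u - f v‖ ≤ √(2 + 4 * Real.log (2 / δ)) * P.d u v := by
  obtain ⟨M⟩ := hs.1.exists_data
  have hlog : 0 ≤ Real.log (2 / δ) := Real.log_nonneg (by rw [le_div_iff₀ hδ]; linarith)
  refine ⟨M.emb δ e, fun u v => ⟨?_, ?_⟩⟩
  · refine le_of_sq_le_sq ?_ (norm_nonneg _)
    rw [M.norm_emb_sub_sq δ he Finset.subset_union_left Finset.subset_union_right]
    exact M.sqDist_ge hδ hs u v
  · refine edge_lipschitz (fun v hv => ?_) u v
    refine le_of_sq_le_sq ?_ (mul_nonneg (Real.sqrt_nonneg _) (P.w_pos v hv).le)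
    rw [M.norm_emb_sub_sq δ he subset_rfl (Finset.image_subset_image (P.A_par_subset hv)),
      mul_pow, Real.sq_sqrt (by positivity), mul_comm]
    exact M.sqDist_edge hδ hδ1 hs hv

end ParentTree
end Upper

section Hilbert
open MeasureTheory

/-- The normalized indicators of unit intervals form an orthonormal family. -/
lemma exists_orthonormal :
    ∃ e : ℤ ⊕ ℤ → Lp ℝ 2 (volume : Measure ℝ), Orthonormal ℝ e := by
  have hfin : ∀ n : ℤ, volume (Set.Ico (n : ℝ) (n + 1)) ≠ ∞ := fun n => by simp
  let g : ℤ → Lp ℝ 2 (volume : Measure ℝ) := fun n =>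
    indicatorConstLp 2 (measurableSet_Ico (a := (n : ℝ)) (b := n + 1)) (hfin n) 1
  have hg : Orthonormal ℝ g := by
    classical
    rw [orthonormal_iff_ite]
    intro m n
    simp only [g]
    rw [L2.real_inner_indicatorConstLp_one_indicatorConstLp_one
      measurableSet_Ico measurableSet_Ico (hfin m) (hfin n)]
    split_ifs with h
    · subst h
      simp [Measure.real]
    · have : Set.Ico (m : ℝ) (m + 1) ∩ Set.Ico (n : ℝ) (n + 1) = ∅ := by
        ext x
        simp only [Set.mem_inter_iff, Set.mem_Ico, Set.mem_empty_iff_false, iff_false]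
        rintro ⟨⟨h1, h2⟩, h3, h4⟩
        have h5 : m < n + 1 := by exact_mod_cast h1.trans_lt h4
        have h6 : n < m + 1 := by exact_mod_cast h3.trans_lt h2
        omega
      simp [this]
  obtain ⟨i, hi⟩ := Countable.exists_injective_nat (ℤ ⊕ ℤ)
  exact ⟨g ∘ fun x => (i x : ℤ), hg.comp _ (Nat.cast_injective.comp hi)⟩

lemma hasEmbedding_iff_of_eq {p : ℝ≥0∞} (hp : p = 2) {X : Type*} (Q : ℝ → X → X → Prop) :
    (∃ f : X → Lp ℝ p (volume : Measure ℝ), ∀ x y, Q (dist (f x) (f y)) x y) ↔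
      ∃ f : X → Lp ℝ 2 (volume : Measure ℝ), ∀ x y, Q ‖f x - f y‖ x y := by
  subst hp
  simp_rw [dist_eq_norm]

lemma hasEmbedding_iff {X : Type*} (dX : X → X → ℝ) (D : ℝ) :
    HasEmbedding dX (fun g h : LpSpace 2 => dist g h) D ↔
      ∃ s : ℝ, 0 < s ∧ ∃ f : X → Lp ℝ 2 (volume : Measure ℝ),
        ∀ x y, s * dX x y ≤ ‖f x - f y‖ ∧ ‖f x - f y‖ ≤ s * D * dX x y := by
  have h2 : ENNReal.ofReal 2 = 2 := by simp
  rw [HasEmbedding, exists_comm]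
  refine exists_congr fun s => ?_
  rw [exists_and_left]
  refine and_congr_right fun _ => ?_
  exact hasEmbedding_iff_of_eq h2 fun t x y => s * dX x y ≤ t ∧ t ≤ s * D * dX x y

lemma cLp_le_of_strong (T : MetricTree) (r : T.V) {δ : ℝ} (hδ : 0 < δ) (hδ1 : δ < 1)
    {χ : Sym2 T.V → ℤ} (h : IsStrongColoring T r δ χ) :
    cLp 2 T.dist ≤ ENNReal.ofReal (32 * √(2 + 4 * Real.log (2 / δ))) := by
  obtain ⟨e, he⟩ := exists_orthonormal
  obtain ⟨f, hf⟩ := ((T.strong_iff r δ χ).1 h).exists_embedding hδ hδ1 he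
  have hlog : 0 ≤ Real.log (2 / δ) := Real.log_nonneg (by rw [le_div_iff₀ hδ]; linarith)
  refine sup_le ?_ (sInf_le ⟨_, rfl, (hasEmbedding_iff _ _).2 ⟨1 / 32, by norm_num, f, ?_⟩⟩)
  · rw [← ENNReal.ofReal_one]
    refine ENNReal.ofReal_le_ofReal ?_
    have : 1 ≤ √(2 + 4 * Real.log (2 / δ)) := Real.one_le_sqrt.2 (by linarith)
    linarith
  · intro x y
    rw [T.dist_eq r]
    obtain ⟨h1, h2⟩ := hf x y
    exact ⟨by linarith, h2.trans (le_of_eq (by ring))⟩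

end Hilbert

section Energy

variable {H : Type*} [NormedAddCommGroup H] [InnerProductSpace ℝ H]

lemma sum_norm_sq_ge (b : ℕ) (x : ℕ → H) :
    ‖∑ c ∈ Finset.range b, x c‖ ^ 2 / b +
      ∑ c ∈ Finset.range (b - 1), ‖x (c + 1) - x c‖ ^ 2 / 4 ≤
      ∑ c ∈ Finset.range b, ‖x c‖ ^ 2 := by
  rcases Nat.eq_zero_or_pos b with rfl | hb
  · simp
  have hb' : (0 : ℝ) < b := by exact_mod_cast hb
  set s := ∑ c ∈ Finset.range b, x c with hs
  set μ : H := (b : ℝ)⁻¹ • s with hμ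
  have h1 : ∑ c ∈ Finset.range b, ‖x c - μ‖ ^ 2 =
      ∑ c ∈ Finset.range b, ‖x c‖ ^ 2 - ‖s‖ ^ 2 / b := by
    simp_rw [norm_sub_sq_real, Finset.sum_add_distrib, Finset.sum_sub_distrib, ← Finset.mul_sum,
      ← sum_inner, ← hs]
    rw [hμ, real_inner_smul_right, real_inner_self_eq_norm_sq, norm_smul, Finset.sum_const,
      Finset.card_range, nsmul_eq_mul, norm_inv, Real.norm_natCast]
    field_simp
    ring
  have h2 : ∑ c ∈ Finset.range (b - 1), ‖x (c + 1) - x c‖ ^ 2 / 4 ≤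
      ∑ c ∈ Finset.range b, ‖x c - μ‖ ^ 2 := by
    have e1 : ∀ c, ‖x (c + 1) - x c‖ ^ 2 / 4 ≤
        (‖x (c + 1) - μ‖ ^ 2 + ‖x c - μ‖ ^ 2) / 2 := by
      intro c
      have := norm_sub_le (x (c + 1) - μ) (x c - μ)
      rw [sub_sub_sub_cancel_right] at this
      nlinarith [norm_nonneg (x (c + 1) - x c), norm_nonneg (x (c + 1) - μ),
        norm_nonneg (x c - μ), sq_nonneg (‖x (c + 1) - μ‖ - ‖x c - μ‖)]
    have e2 : ∑ c ∈ Finset.range b, ‖x c - μ‖ ^ 2 =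
        ∑ c ∈ Finset.range (b - 1), ‖x (c + 1) - μ‖ ^ 2 + ‖x 0 - μ‖ ^ 2 := by
      rw [← Finset.sum_range_succ' (fun c => ‖x c - μ‖ ^ 2), Nat.sub_add_cancel hb]
    have e3 : ∑ c ∈ Finset.range b, ‖x c - μ‖ ^ 2 =
        ∑ c ∈ Finset.range (b - 1), ‖x c - μ‖ ^ 2 + ‖x (b - 1) - μ‖ ^ 2 := by
      rw [← Finset.sum_range_succ (fun c => ‖x c - μ‖ ^ 2), Nat.sub_add_cancel hb]
    have e4 := Finset.sum_le_sum (s := Finset.range (b - 1)) fun c _ => e1 c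
    rw [← Finset.sum_div, ← Finset.sum_div, Finset.sum_add_distrib] at e4
    rw [← Finset.sum_div]
    nlinarith [sq_nonneg ‖x 0 - μ‖, sq_nonneg ‖x (b - 1) - μ‖]
  linarith

lemma sum_Ico_mul (b : ℕ) (f : ℕ → ℝ) (M N : ℕ) (h : M ≤ N) :
    ∑ n ∈ Finset.Ico (M * b) (N * b), f n =
      ∑ m ∈ Finset.Ico M N, ∑ c ∈ Finset.range b, f (m * b + c) := by
  induction N, h using Nat.le_induction with
  | base => simp
  | succ N hN ih =>
    rw [Finset.sum_Ico_succ_top hN, ← ih,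
      ← Finset.sum_Ico_consecutive f (Nat.mul_le_mul_right b hN)
        (Nat.mul_le_mul_right b N.le_succ)]
    congr 1
    rw [Finset.sum_Ico_eq_sum_range]
    congr 2
    rw [Nat.succ_mul, Nat.add_sub_cancel_left]

/-- The second differences inside the blocks of length `b` are controlled by the loss of
energy under coarsening. -/
lemma energy_step {b : ℕ} (g : ℕ → H) {M N : ℕ} (h : M ≤ N) :
    ∑ n ∈ Finset.Ico (M * b) (N * b) with n % b ≠ 0,
        ‖g (n + 1) - (2 : ℝ) • g n + g (n - 1)‖ ^ 2 / 4 +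
      ∑ m ∈ Finset.Ico M N, ‖g ((m + 1) * b) - g (m * b)‖ ^ 2 / b ≤
      ∑ n ∈ Finset.Ico (M * b) (N * b), ‖g (n + 1) - g n‖ ^ 2 := by
  rw [Finset.sum_filter, sum_Ico_mul b _ M N h, sum_Ico_mul b _ M N h,
    ← Finset.sum_add_distrib]
  refine Finset.sum_le_sum fun m _ => ?_
  have key := sum_norm_sq_ge b fun c => g (m * b + c + 1) - g (m * b + c)
  have e1 : ∑ c ∈ Finset.range b, (g (m * b + c + 1) - g (m * b + c)) =
      g ((m + 1) * b) - g (m * b) := by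
    have := Finset.sum_range_sub (fun c => g (m * b + c)) b
    simpa [Nat.succ_mul, add_assoc] using this
  rw [e1] at key
  refine le_trans (le_of_eq ?_) key
  rw [add_comm]
  congr 1
  rcases Nat.eq_zero_or_pos b with rfl | hb
  · simp
  obtain ⟨b', rfl⟩ : ∃ b', b = b' + 1 := ⟨b - 1, by omega⟩
  rw [Finset.sum_range_succ', Nat.add_sub_cancel, if_neg (by simp), add_zero]
  refine Finset.sum_congr rfl fun c hc => ?_
  rw [Finset.mem_range] at hc
  rw [if_pos]
  · congr 3
    rw [two_smul, show m * (b' + 1) + (c + 1) - 1 = m * (b' + 1) + c by omega]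
    rw [← add_assoc (m * (b' + 1)) c 1]
    abel
  · rw [Nat.mul_add_mod', Nat.mod_eq_of_lt (by omega)]
    omega

lemma energy_sum {b : ℕ} (u : ℕ → H) {M N : ℕ} (h : M ≤ N) (K : ℕ) :
    ∑ i ∈ Finset.range K,
      ∑ n ∈ Finset.Ico (M * b ^ (K - i)) (N * b ^ (K - i)) with n % b ≠ 0,
        ‖u ((n + 1) * b ^ i) - (2 : ℝ) • u (n * b ^ i) + u ((n - 1) * b ^ i)‖ ^ 2 / 4 /
          (b : ℝ) ^ i ≤
      ∑ n ∈ Finset.Ico (M * b ^ K) (N * b ^ K), ‖u (n + 1) - u n‖ ^ 2 := by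
  have key : ∀ k ≤ K, ∑ i ∈ Finset.range k,
      ∑ n ∈ Finset.Ico (M * b ^ (K - i)) (N * b ^ (K - i)) with n % b ≠ 0,
        ‖u ((n + 1) * b ^ i) - (2 : ℝ) • u (n * b ^ i) + u ((n - 1) * b ^ i)‖ ^ 2 / 4 /
          (b : ℝ) ^ i +
      ∑ n ∈ Finset.Ico (M * b ^ (K - k)) (N * b ^ (K - k)),
        ‖u ((n + 1) * b ^ k) - u (n * b ^ k)‖ ^ 2 / (b : ℝ) ^ k ≤
      ∑ n ∈ Finset.Ico (M * b ^ K) (N * b ^ K), ‖u (n + 1) - u n‖ ^ 2 := by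
    intro k
    induction k with
    | zero => simp
    | succ k ih =>
      intro hk
      refine le_trans ?_ (ih (by omega))
      rw [Finset.sum_range_succ, add_assoc]
      refine add_le_add le_rfl ?_
      have hKk : K - k = (K - (k + 1)) + 1 := by omega
      have step := energy_step (b := b) (fun n => u (n * b ^ k))
        (Nat.mul_le_mul_right (b ^ (K - (k + 1))) h)
      rw [hKk, pow_succ b (K - (k + 1)), ← mul_assoc, ← mul_assoc, ← Finset.sum_div]
      have e : ∑ n ∈ Finset.Ico (M * b ^ (K - (k + 1))) (N * b ^ (K - (k + 1))),
          ‖u ((n + 1) * b ^ (k + 1)) - u (n * b ^ (k + 1))‖ ^ 2 / (b : ℝ) ^ (k + 1) =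
          (∑ n ∈ Finset.Ico (M * b ^ (K - (k + 1))) (N * b ^ (K - (k + 1))),
            ‖u ((n + 1) * b * b ^ k) - u (n * b * b ^ k)‖ ^ 2 / b) / (b : ℝ) ^ k := by
        rw [Finset.sum_div]
        refine Finset.sum_congr rfl fun n _ => ?_
        rw [div_div, pow_succ' b k, pow_succ' (b : ℝ) k, mul_assoc, mul_assoc]
      rw [e, ← add_div]
      exact (div_le_div_of_nonneg_right step (pow_nonneg (Nat.cast_nonneg b) k)).trans
        (Finset.sum_div ..).le
  refine le_trans (le_add_of_nonneg_right ?_) (key K le_rfl)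
  positivity

end Energy

section Interpolation
open scoped Classical

namespace ParentTree

lemma sum_vector_telescope {V H : Type*} {P : ParentTree V} [AddCommGroup H] (f : V → H) (v : V) :
    ∑ x ∈ P.A v, (f x - f (P.par x)) = f v - f P.root := by
  induction v using P.induct with
  | hroot => simp [A_root]
  | hstep v hv ih =>
    rw [P.A_of_ne hv, Finset.sum_insert (notMem_A_par hv), ih]; abel

variable {V : Type*} (P : ParentTree V) {H : Type*} [NormedAddCommGroup H] [NormedSpace ℝ H]

/-- The point at height `t` on the piecewise linear interpolation of `f` along the path from the
root to `v`. -/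
noncomputable def interp (f : V → H) (v : V) (t : ℝ) : H :=
  f P.root + ∑ x ∈ P.A v,
    ((min t (P.dep x) - min t (P.dep (P.par x))) / P.w x) • (f x - f (P.par x))

variable {P}

lemma dep_par_le {x : V} (hx : x ≠ P.root) : P.dep (P.par x) ≤ P.dep x :=
  dep_mono (P.A_par_subset hx)

lemma interp_of_le (f : V → H) {v : V} {t : ℝ} (h : P.dep v ≤ t) : P.interp f v t = f v := by
  have : ∀ x ∈ P.A v,
      ((min t (P.dep x) - min t (P.dep (P.par x))) / P.w x) • (f x - f (P.par x)) =
        f x - f (P.par x) := by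
    intro x hx
    have h1 := dep_mono (subset_of_mem hx)
    have hx0 := ne_root_of_mem hx
    have h2 := dep_par_le hx0
    rw [min_eq_right (by linarith), min_eq_right (by linarith), P.dep_of_ne hx0,
      add_sub_cancel_left, div_self (P.w_pos x hx0).ne', one_smul]
  rw [interp, Finset.sum_congr rfl this, sum_vector_telescope]
  abel

lemma interp_congr (f : V → H) {m v : V} {t : ℝ} (hm : P.A m ⊆ P.A v) (h : t ≤ P.dep m) :
    P.interp f v t = P.interp f m t := by
  rw [interp, interp]
  congr 1
  refine (Finset.sum_subset hm fun x hx hxm => ?_).symm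
  have h1 := dep_mono (A_subset_par hm hx hxm)
  have h2 := dep_par_le (ne_root_of_mem hx)
  rw [min_eq_left (by linarith), min_eq_left (by linarith), sub_self, zero_div, zero_smul]

lemma interp_lipschitz {f : V → H} {D : ℝ} (hD : 0 ≤ D)
    (hf : ∀ v, v ≠ P.root → ‖f v - f (P.par v)‖ ≤ D * P.w v) (v : V) {s t : ℝ} (hst : s ≤ t) :
    ‖P.interp f v t - P.interp f v s‖ ≤ D * (t - s) := by
  have e : P.interp f v t - P.interp f v s = ∑ x ∈ P.A v,
      (((min t (P.dep x) - min t (P.dep (P.par x))) -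
        (min s (P.dep x) - min s (P.dep (P.par x)))) / P.w x) • (f x - f (P.par x)) := by
    rw [interp, interp, add_sub_add_left_eq_sub, ← Finset.sum_sub_distrib]
    refine Finset.sum_congr rfl fun x _ => ?_
    rw [← sub_smul, ← sub_div]
  have bound : ∀ x ∈ P.A v,
      ‖(((min t (P.dep x) - min t (P.dep (P.par x))) -
        (min s (P.dep x) - min s (P.dep (P.par x)))) / P.w x) • (f x - f (P.par x))‖ ≤
      D * ((min s (P.dep (P.par x)) - min t (P.dep (P.par x))) -
        (min s (P.dep x) - min t (P.dep x))) := by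
    intro x hx
    have hx0 := ne_root_of_mem hx
    have hw := P.w_pos x hx0
    have h2 := dep_par_le hx0
    have hnn : 0 ≤ (min t (P.dep x) - min t (P.dep (P.par x))) -
        (min s (P.dep x) - min s (P.dep (P.par x))) := by
      rcases le_total t (P.dep x) with h3 | h3 <;> rcases le_total t (P.dep (P.par x)) with h4 | h4 <;>
      rcases le_total s (P.dep x) with h5 | h5 <;> rcases le_total s (P.dep (P.par x)) with h6 | h6 <;>
      simp only [min_eq_left, min_eq_right, h3, h4, h5, h6] <;> linarith
    rw [norm_smul, Real.norm_of_nonneg (div_nonneg hnn hw.le)]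
    refine (mul_le_mul_of_nonneg_left (hf x hx0) (div_nonneg hnn hw.le)).trans (le_of_eq ?_)
    field_simp
    ring
  rw [e]
  refine (norm_sum_le _ _).trans ((Finset.sum_le_sum bound).trans ?_)
  rw [← Finset.mul_sum, sum_telescope (fun x => min s (P.dep x) - min t (P.dep x))]
  refine mul_le_mul_of_nonneg_left ?_ hD
  have := P.dep_nonneg v
  rw [P.dep_root]
  rcases le_total t (P.dep v) with h3 | h3 <;> rcases le_total t 0 with h4 | h4 <;>
  rcases le_total s (P.dep v) with h5 | h5 <;> rcases le_total s 0 with h6 | h6 <;>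
  simp only [min_eq_left, min_eq_right, h3, h4, h5, h6] <;> linarith

end ParentTree
end Interpolation

section States
open scoped Classical

namespace ParentTree

variable {V : Type*} (P : ParentTree V)

/-- The greedy monotone coloring driven by a rule `g`. The state of a vertex `v` is the top vertex
of its color class together with the bottom vertex chosen for this class. When the class of the
parent of `v` does not continue to `v`, a new class is started at `v`, with bottom given by `g`. -/
noncomputable def state (g : V → V → V → V) (v : V) : V × V :=
  if _h : v = P.root then (P.root, P.root)
  else if v ∈ P.A (state g (P.par v)).2 then state g (P.par v)
  else (v, g (P.par (state g (P.par v)).1) (P.par v) v)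
termination_by P.lev v
decreasing_by all_goals (have := P.lev_par v ‹_›; omega)

variable {P} {g : V → V → V → V}

lemma state_root : P.state g P.root = (P.root, P.root) := by
  rw [state, dif_pos rfl]

lemma state_of_mem {v : V} (hv : v ≠ P.root) (h : v ∈ P.A (P.state g (P.par v)).2) :
    P.state g v = P.state g (P.par v) := by
  rw [state, dif_neg hv, if_pos h]

lemma state_of_notMem {v : V} (hv : v ≠ P.root) (h : v ∉ P.A (P.state g (P.par v)).2) :
    P.state g v = (v, g (P.par (P.state g (P.par v)).1) (P.par v) v) := by
  rw [state, dif_neg hv, if_neg h]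

lemma state_mem (hg : ∀ a q v, P.A v ⊆ P.A (g a q v)) {v : V} (hv : v ≠ P.root) :
    (P.state g v).1 ∈ P.A v ∧ v ∈ P.A (P.state g v).2 := by
  induction v using P.induct with
  | hroot => exact absurd rfl hv
  | hstep v hv' ih =>
    by_cases h : v ∈ P.A (P.state g (P.par v)).2
    · rw [state_of_mem hv h]
      refine ⟨?_, h⟩
      by_cases hp : P.par v = P.root
      · rw [hp, state_root] at h
        simp [A_root] at h
      · exact P.A_par_subset hv (ih hp).1
    · rw [state_of_notMem hv h]
      exact ⟨P.self_mem hv, mem_of_subset hv (hg _ _ _)⟩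

lemma state_congr {y v : V} (hy : y ∈ P.A v) (h : (P.state g v).1 ∈ P.A y) :
    P.state g y = P.state g v := by
  induction v using P.induct with
  | hroot => simp [A_root] at hy
  | hstep v hv ih =>
    by_cases hyv : y = v
    · rw [hyv]
    by_cases hm : v ∈ P.A (P.state g (P.par v)).2
    · rw [state_of_mem hv hm] at h ⊢
      exact ih (mem_A_par hy hyv) h
    · rw [state_of_notMem hv hm] at h
      exact absurd (eq_of_mem_mem hy h) hyv

lemma state_fst (hg : ∀ a q v, P.A v ⊆ P.A (g a q v)) {v : V} (hv : v ≠ P.root) :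
    P.state g (P.state g v).1 = P.state g v :=
  have h := (state_mem hg hv).1
  state_congr h (P.self_mem (ne_root_of_mem h))

lemma mem_A_state_fst {y v : V} (hy : (P.state g y).1 = y) (h : y ∈ P.A v) :
    y ∈ P.A (P.state g v).1 := by
  induction v using P.induct with
  | hroot => simp [A_root] at h
  | hstep v hv ih =>
    by_cases hyv : y = v
    · subst hyv
      rw [hy]
      exact P.self_mem hv
    by_cases hm : v ∈ P.A (P.state g (P.par v)).2
    · rw [state_of_mem hv hm]
      exact ih (mem_A_par h hyv)
    · rw [state_of_notMem hv hm]
      exact h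

lemma state_fst_eq_iff (hg : ∀ a q v, P.A v ⊆ P.A (g a q v)) {s x : V} (hs : s ≠ P.root)
    (hss : (P.state g s).1 = s) (hx : x ≠ P.root) :
    (P.state g x).1 = s ↔ x ∈ P.A (P.state g s).2 ∧ x ∉ P.A (P.par s) := by
  constructor
  · intro h
    have h1 := state_mem hg hx
    rw [h] at h1
    refine ⟨?_, fun h2 => notMem_A_par hs (subset_of_mem h2 h1.1)⟩
    rw [state_congr h1.1 (by rw [h]; exact P.self_mem hs)]
    exact h1.2
  · rintro ⟨h1, h2⟩
    have hsz := (state_mem hg hs).2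
    induction x using P.induct with
    | hroot => exact absurd rfl hx
    | hstep x hx' ih =>
      by_cases hxs : x = s
      · rw [hxs, hss]
      have hsx : s ∈ P.A x := by
        rcases chain h1 hsz with h | h
        · exact absurd (mem_A_par h hxs) h2
        · exact h
      have hsp := mem_A_par hsx (Ne.symm hxs)
      have hp : P.par x ≠ P.root := by
        intro h
        rw [h, A_root] at hsp
        simp at hsp
      have hc := ih hp (mem_of_subset hp ((P.A_par_subset hx').trans (subset_of_mem h1)))
        fun h => notMem_A_par hs (subset_of_mem h hsp)
      have := state_congr (g := g) hsp (by rw [hc]; exact P.self_mem hs)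
      rw [state_of_mem hx (by rw [← this]; exact h1), hc]

lemma state_snd_of_fst (hg : ∀ a q v, P.A v ⊆ P.A (g a q v)) {v : V} (hv : v ≠ P.root)
    (h : (P.state g v).1 = v) :
    (P.state g v).2 = g (P.par (P.state g (P.par v)).1) (P.par v) v := by
  by_cases hm : v ∈ P.A (P.state g (P.par v)).2
  · rw [state_of_mem hv hm] at h
    by_cases hp : P.par v = P.root
    · rw [hp, state_root] at h
      exact absurd h.symm hv
    · have := (state_mem hg hp).1
      rw [h] at this
      exact absurd this (notMem_A_par hv)
  · rw [state_of_notMem hv hm]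

lemma mono_state (hg : ∀ a q v, P.A v ⊆ P.A (g a q v)) {ι : V → ℤ}
    (hι : Function.Injective ι) : P.Mono fun v => ι (P.state g v).1 := by
  intro m
  by_cases h : ∃ s, s ≠ P.root ∧ (P.state g s).1 = s ∧ ι s = m
  · obtain ⟨s, hs, hss, rfl⟩ := h
    refine ⟨P.par s, (P.state g s).2,
      (P.A_par_subset hs).trans (subset_of_mem (state_mem hg hs).2), fun x hx => ?_⟩
    rw [Finset.mem_sdiff, ← state_fst_eq_iff hg hs hss hx]
    exact hι.eq_iff
  · refine ⟨P.root, P.root, subset_rfl, fun x hx => ?_⟩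
    rw [sdiff_self, Finset.bot_eq_empty]
    simp only [Finset.notMem_empty, iff_false]
    exact fun hm => h ⟨_, ne_root_of_mem (state_mem hg hx).1,
      congrArg Prod.fst (state_fst hg hx), hm⟩

end ParentTree
end States

section Rule
open scoped Classical

namespace ParentTree

variable {V : Type*} (P : ParentTree V)

/-- The index of the block of length `256 ^ j` containing the height of `x`. -/
noncomputable def bl (j : ℤ) (x : V) : ℕ := ⌊P.dep x / (256 : ℝ) ^ j⌋₊

variable {P}

lemma scale_pos (j : ℤ) : (0 : ℝ) < (256 : ℝ) ^ j := by positivity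

lemma bl_succ (j : ℤ) (x : V) : P.bl (j + 1) x = P.bl j x / 256 := by
  rw [bl, bl, zpow_add_one₀ (by norm_num), ← div_div]
  exact_mod_cast Nat.floor_div_natCast (P.dep x / (256 : ℝ) ^ j) 256

lemma bl_mul_le (j : ℤ) (x : V) : (P.bl j x : ℝ) * 256 ^ j ≤ P.dep x := by
  rw [← le_div_iff₀ (scale_pos j)]
  exact Nat.floor_le (div_nonneg (P.dep_nonneg x) (scale_pos j).le)

lemma lt_bl_mul (j : ℤ) (x : V) : P.dep x < ((P.bl j x : ℝ) + 1) * 256 ^ j := by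
  rw [← div_lt_iff₀ (scale_pos j)]
  exact Nat.lt_floor_add_one _

lemma bl_eq {j : ℤ} {x : V} {n : ℕ} (h1 : (n : ℝ) * 256 ^ j ≤ P.dep x)
    (h2 : P.dep x < ((n : ℝ) + 1) * 256 ^ j) : P.bl j x = n := by
  rw [bl, Nat.floor_eq_iff (div_nonneg (P.dep_nonneg x) (scale_pos j).le)]
  exact ⟨(le_div_iff₀ (scale_pos j)).2 h1, (div_lt_iff₀ (scale_pos j)).2 h2⟩

lemma bl_mono {j : ℤ} {x y : V} (h : P.dep x ≤ P.dep y) : P.bl j x ≤ P.bl j y :=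
  Nat.floor_mono (div_le_div_of_nonneg_right h (scale_pos j).le)

lemma bl_eq_of_le {i j : ℤ} (hij : i ≤ j) {x y : V} (h : P.bl i x = P.bl i y) :
    P.bl j x = P.bl j y := by
  induction j, hij using Int.leInduction with
  | base => exact h
  | succ j _ ih => rw [bl_succ, bl_succ, ih]

variable (P)

/-- The scale `256 ^ j` is the largest one at which `a` and `q` lie in different blocks. -/
def ExactScale (j : ℤ) (a q : V) : Prop :=
  P.bl j a ≠ P.bl j q ∧ P.bl (j + 1) a = P.bl (j + 1) q

variable {P} in
lemma ExactScale.unique {i j : ℤ} {a q : V} (hi : P.ExactScale i a q) (hj : P.ExactScale j a q) :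
    i = j := by
  rcases lt_trichotomy i j with h | h | h
  · exact absurd (bl_eq_of_le h hi.2) hj.1
  · exact h
  · exact absurd (bl_eq_of_le h hj.2) hi.1

variable {H : Type*} [NormedAddCommGroup H] [NormedSpace ℝ H]

/-- The linear extrapolation of the interpolation of `f` to the end of the block of `q`. -/
noncomputable def extrap (f : V → H) (j : ℤ) (q : V) : H :=
  (2 : ℝ) • P.interp f q (P.bl j q * 256 ^ j) - P.interp f q (((P.bl j q : ℝ) - 1) * 256 ^ j)

/-- The descendants of `v` near the end of the block of `q` whose image is close to the
extrapolation. -/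
def Target (f : V → H) (j : ℤ) (q v z : V) : Prop :=
  P.A v ⊆ P.A z ∧ ((P.bl j q : ℝ) + 1) * 256 ^ j - 256 ^ j / 128 ≤ P.dep z ∧
    ‖f z - P.extrap f j q‖ < 256 ^ j / 128

/-- The rule for choosing the bottom vertex of a color class. -/
noncomputable def goal (f : V → H) (a q v : V) : V :=
  if h : ∃ z j, P.ExactScale j a q ∧ P.Target f j q v z then h.choose else v

variable {P} {f : V → H}

lemma goal_spec {j : ℤ} {a q v z : V} (hj : P.ExactScale j a q) (hz : P.Target f j q v z) :
    P.Target f j q v (P.goal f a q v) := by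
  have h : ∃ z j, P.ExactScale j a q ∧ P.Target f j q v z := ⟨z, j, hj, hz⟩
  rw [goal, dif_pos h]
  obtain ⟨i, hi, hz'⟩ := h.choose_spec
  rwa [hi.unique hj] at hz'

lemma subset_goal (a q v : V) : P.A v ⊆ P.A (P.goal f a q v) := by
  rw [goal]
  split_ifs with h
  · obtain ⟨i, hi, hz'⟩ := h.choose_spec
    exact hz'.1
  · exact subset_rfl

lemma le_sum_color (c : V → V) (k : V) {u v a p : V} (hu : P.A u ⊆ P.A v) (ha : P.A a ⊆ P.A v)
    (hp : P.A p ⊆ P.A v) (h : ∀ y ∈ P.A p, y ∉ P.A a → c y = k) :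
    P.dep p - max (P.dep u) (P.dep a) ≤ ∑ y ∈ P.A v \ P.A u with c y = k, P.w y := by
  have hnn : ∀ y ∈ (P.A v \ P.A u).filter (fun y => c y = k), 0 ≤ P.w y := fun y hy =>
    (P.w_pos y (ne_root_of_mem (Finset.mem_sdiff.1 (Finset.mem_filter.1 hy).1).1)).le
  obtain ⟨m, hum, ham, hmv, hmd⟩ : ∃ m, P.A u ⊆ P.A m ∧ P.A a ⊆ P.A m ∧ P.A m ⊆ P.A v ∧
      P.dep m ≤ max (P.dep u) (P.dep a) := by
    rcases A_total hu ha with h1 | h1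
    · exact ⟨a, h1, subset_rfl, ha, le_max_right _ _⟩
    · exact ⟨u, subset_rfl, h1, hu, le_max_left _ _⟩
  rcases A_total hmv hp with h1 | h1
  · refine (sub_le_sub_left hmd _).trans ?_
    rw [← sum_sdiff_w h1]
    refine Finset.sum_le_sum_of_subset_of_nonneg (fun y hy => ?_) fun y hy _ => hnn y hy
    rw [Finset.mem_sdiff] at hy
    rw [Finset.mem_filter, Finset.mem_sdiff]
    exact ⟨⟨hp hy.1, fun h2 => hy.2 (hum h2)⟩, h y hy.1 fun h2 => hy.2 (ham h2)⟩
  · have := dep_mono h1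
    exact le_trans (by linarith) (Finset.sum_nonneg hnn)

end ParentTree
end Rule

section Trichotomy
open scoped Classical

namespace ParentTree

variable {V : Type*} (P : ParentTree V) {H : Type*} [NormedAddCommGroup H] [NormedSpace ℝ H]

/-- The top vertex of the color class of `x`. -/
noncomputable def top (f : V → H) (x : V) : V := (P.state (P.goal f) x).1

/-- The block `n` at scale `j` is the first one in its parent block in which a color class
starts. -/
def Spoiled (f : V → H) (j : ℤ) (v : V) (n : ℕ) : Prop :=
  ∃ y ∈ P.A v, P.top f y = y ∧ P.bl j (P.par y) = n ∧
    ∀ z ∈ P.A v, P.top f z = z → P.bl (j + 1) (P.par z) = n / 256 → n ≤ P.bl j (P.par z)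

/-- The interpolated path has a large second difference at the block `n`. -/
def Turned (f : V → H) (j : ℤ) (v : V) (n : ℕ) : Prop :=
  (256 : ℝ) ^ j / 256 ≤ ‖P.interp f v (((n : ℝ) + 1) * 256 ^ j) -
    (2 : ℝ) • P.interp f v (n * 256 ^ j) + P.interp f v (((n : ℝ) - 1) * 256 ^ j)‖

/-- The block `n` contains the top of a long edge. -/
def Killed (D : ℝ) (j : ℤ) (u v : V) (n : ℕ) : Prop :=
  ∃ x ∈ P.A v \ P.A u, P.bl j (P.par x) = n ∧ (256 : ℝ) ^ j ≤ 128 * D * P.w x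

/-- The total weight between `u` and `v` of the color class of `x`. -/
noncomputable def classLen (f : V → H) (u v x : V) : ℝ :=
  ∑ y ∈ P.A v \ P.A u with P.top f y = P.top f x, P.w y

variable {P} {f : V → H}

lemma w_le_classLen {u v x : V} (hx : x ∈ P.A v \ P.A u) : P.w x ≤ P.classLen f u v x := by
  refine Finset.single_le_sum (f := P.w) (fun y hy => ?_) (Finset.mem_filter.2 ⟨hx, rfl⟩)
  exact (P.w_pos y (ne_root_of_mem (Finset.mem_sdiff.1 (Finset.mem_filter.1 hy).1).1)).le

lemma top_mem {x : V} (hx : x ≠ P.root) : P.top f x ∈ P.A x :=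
  (state_mem subset_goal hx).1

lemma top_top {x : V} (hx : x ≠ P.root) : P.top f (P.top f x) = P.top f x :=
  congrArg Prod.fst (state_fst subset_goal hx)

lemma exists_first_height {v : V} {t : ℝ} (ht : 0 < t) (hv : t ≤ P.dep v) :
    ∃ y ∈ P.A v, t ≤ P.dep y ∧ P.dep (P.par y) < t := by
  induction v using P.induct with
  | hroot => rw [P.dep_root] at hv; linarith
  | hstep v hv0 ih =>
    by_cases h : t ≤ P.dep (P.par v)
    · obtain ⟨y, hy, h1⟩ := ih h
      exact ⟨y, P.A_par_subset hv0 hy, h1⟩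
    · exact ⟨v, P.self_mem hv0, hv, not_le.1 h⟩

/-- Inside a block with a badly colored edge, the first start of a color class precedes the
edge. -/
lemma exists_first_start {j : ℤ} {u v x : V} {n : ℕ}
    (huv : P.A u ⊆ P.A v) (hx : x ∈ P.A v \ P.A u)
    (hbad : P.classLen f u v x < 256 ^ j / 128)
    (hun : P.dep u ≤ ((n : ℝ) - 1) * 256 ^ j)
    (h1 : (n : ℝ) * 256 ^ j + 256 ^ j / 128 ≤ P.dep (P.par x))
    (h2 : P.dep (P.par x) ≤ ((n : ℝ) + 1) * 256 ^ j - 256 ^ j / 32) :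
    ∃ s ∈ P.A x, P.top f s = s ∧ P.bl j (P.par s) = n ∧
      ∀ y ∈ P.A v, P.top f y = y → P.bl j (P.par y) = n → s ∈ P.A y := by
  have hβ := scale_pos j
  rw [Finset.mem_sdiff] at hx
  have hx0 := ne_root_of_mem hx.1
  have hsx := top_mem (f := f) hx0
  have hs0 := ne_root_of_mem hsx
  have hss := top_top (f := f) hx0
  have hbs : P.bl j (P.par (P.top f x)) = n := by
    refine bl_eq ?_ ?_
    · by_contra hlt
      rw [not_le] at hlt
      have := le_sum_color (P.top f) (P.top f x) huv
        ((A_par_subset_of_mem hsx).trans (subset_of_mem hx.1)) (subset_of_mem hx.1) (by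
          intro y hy hy'
          have hcx := (state_fst_eq_iff (g := P.goal f) subset_goal hs0 hss hx0).1 rfl
          exact (state_fst_eq_iff (g := P.goal f) subset_goal hs0 hss (ne_root_of_mem hy)).2
            ⟨subset_of_mem hcx.1 hy, hy'⟩)
      have hmax : max (P.dep u) (P.dep (P.par (P.top f x))) ≤ (n : ℝ) * 256 ^ j :=
        max_le (by linarith) hlt.le
      have := dep_par_le hx0
      rw [classLen] at hbad
      linarith
    · have := dep_mono (P := P) (a := P.par (P.top f x)) (b := P.par x) (by
        by_cases h : P.top f x = x
        · rw [h]
        · exact A_par_subset_of_mem (mem_A_par hsx h))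
      linarith
  obtain ⟨s, hs, hmin⟩ := Finset.exists_min_image
    ((P.A v).filter fun y => P.top f y = y ∧ P.bl j (P.par y) = n) P.lev
    ⟨P.top f x, Finset.mem_filter.2 ⟨subset_of_mem hx.1 hsx, hss, hbs⟩⟩
  rw [Finset.mem_filter] at hs
  have hfirst : ∀ y ∈ P.A v, P.top f y = y → P.bl j (P.par y) = n → s ∈ P.A y := by
    intro y hy h3 h4
    have hle := hmin y (Finset.mem_filter.2 ⟨hy, h3, h4⟩)
    rcases chain hs.1 hy with h | h
    · exact h
    · by_cases hys : y = s
      · rw [← hys]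
        exact P.self_mem (ne_root_of_mem hy)
      · exact absurd (lev_lt_of_mem_ne h hys) (not_lt.2 hle)
  exact ⟨s, subset_of_mem hsx (hfirst _ (subset_of_mem hx.1 hsx) hss hbs), hs.2.1, hs.2.2, hfirst⟩

/-- Either the first start in the block is the first one in the parent block, or its class was
started with the rule at scale `j`. -/
lemma spoiled_or_exactScale {j : ℤ} {v s : V} {n : ℕ} (hn : 0 < n)
    (hs : s ∈ P.A v) (hss : P.top f s = s) (hbs : P.bl j (P.par s) = n)
    (hfirst : ∀ y ∈ P.A v, P.top f y = y → P.bl j (P.par y) = n → s ∈ P.A y) :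
    P.Spoiled f j v n ∨ P.ExactScale j (P.par (P.top f (P.par s))) (P.par s) := by
  have hs0 := ne_root_of_mem hs
  have hq0 : P.par s ≠ P.root := by
    intro h
    rw [h, bl, P.dep_root, zero_div, Nat.floor_zero] at hbs
    omega
  have hcq := top_mem (f := f) hq0
  have hcqs : P.top f (P.par s) ∈ P.A s := P.A_par_subset hs0 hcq
  have hdep := dep_mono (A_par_subset_of_mem hcq)
  have hne : P.bl j (P.par (P.top f (P.par s))) ≠ n := fun h => by
    have := hfirst _ (subset_of_mem hs hcqs) (top_top hq0) h
    exact notMem_A_par hs0 (subset_of_mem hcq this)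
  have hle : P.bl j (P.par (P.top f (P.par s))) ≤ n := hbs ▸ bl_mono hdep
  by_cases hdiv : P.bl j (P.par (P.top f (P.par s))) / 256 = n / 256
  · right
    exact ⟨by rwa [hbs], by rw [bl_succ, bl_succ, hbs, hdiv]⟩
  · left
    refine ⟨s, hs, hss, hbs, fun y hy hyy hby => ?_⟩
    by_contra hlt
    rw [not_le] at hlt
    have hys : y ∈ P.A (P.par s) := by
      rcases chain hy hs with h | h
      · refine mem_A_par h ?_
        rintro rfl
        omega
      · by_cases hys : s = y
        · subst hys
          omega
        · have h3 := dep_mono (subset_of_mem (mem_A_par h hys))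
          have h4 := bl_mono (j := j) ((dep_par_le hs0).trans h3)
          omega
    have h5 := mem_A_state_fst hyy hys
    have h6 : P.A (P.par y) ⊆ P.A (P.par (P.top f (P.par s))) := by
      by_cases h : y = P.top f (P.par s)
      · rw [← h]
      · exact A_par_subset_of_mem (mem_A_par h5 h)
    have h7 := bl_mono (j := j) (dep_mono h6)
    rw [bl_succ] at hby
    omega

end ParentTree
end Trichotomy

section Trichotomy
open scoped Classical

namespace ParentTree

variable {V : Type*} {P : ParentTree V} {H : Type*} [NormedAddCommGroup H] [NormedSpace ℝ H]
  {f : V → H}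

/-- If the class started at `s` was chosen at scale `j` and the block contains a badly colored
edge, then the path misses the extrapolation. -/
lemma far_of_exactScale (hlow : ∀ x y, P.d x y ≤ ‖f x - f y‖) {j : ℤ} {u v x s : V} {n : ℕ}
    (huv : P.A u ⊆ P.A v) (hx : x ∈ P.A v \ P.A u)
    (hbad : P.classLen f u v x < 256 ^ j / 128)
    (hun : P.dep u ≤ ((n : ℝ) - 1) * 256 ^ j)
    (h2 : P.dep (P.par x) ≤ ((n : ℝ) + 1) * 256 ^ j - 256 ^ j / 32)
    (hs : s ∈ P.A x) (hss : P.top f s = s) (hbs : P.bl j (P.par s) = n)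
    (hex : P.ExactScale j (P.par (P.top f (P.par s))) (P.par s))
    {z : V} (hz : P.A z ⊆ P.A v) (hsz : P.A s ⊆ P.A z)
    (hdz : ((n : ℝ) + 1) * 256 ^ j - 256 ^ j / 128 ≤ P.dep z) :
    256 ^ j / 128 ≤ ‖f z - P.extrap f j (P.par s)‖ := by
  have hβ := scale_pos j
  by_contra hlt
  rw [not_le] at hlt
  have hx' := Finset.mem_sdiff.1 hx
  have hx0 := ne_root_of_mem hx'.1
  have hs0 := ne_root_of_mem hs
  have htarget := goal_spec hex (v := s) (z := z) ⟨hsz, by rw [hbs]; exact hdz, hlt⟩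
  have hsnd : (P.state (P.goal f) s).2 = P.goal f (P.par (P.top f (P.par s))) (P.par s) s :=
    state_snd_of_fst subset_goal hs0 hss
  rw [← hsnd] at htarget
  obtain ⟨t1, t2, t3⟩ := htarget
  set z' := (P.state (P.goal f) s).2
  rw [hbs] at t2
  obtain ⟨m, hm⟩ := P.exists_lca z z'
  have hd := d_eq_of_lca hm
  have hzz : ‖f z - f z'‖ < 256 ^ j / 64 := by
    have := norm_sub_le (f z - P.extrap f j (P.par s)) (f z' - P.extrap f j (P.par s))
    rw [sub_sub_sub_cancel_right] at this
    linarith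
  have hmz : P.A m ⊆ P.A z := hm ▸ Finset.inter_subset_left
  have hmz' : P.A m ⊆ P.A z' := hm ▸ Finset.inter_subset_right
  have hlow' := hlow z z'
  have hdm' := dep_mono hmz'
  have hdm : ((n : ℝ) + 1) * 256 ^ j - 3 * 256 ^ j / 128 < P.dep m := by linarith
  have hwx := w_le_classLen (f := f) hx
  have hdx : P.dep x ≤ P.dep m := by
    rw [P.dep_of_ne hx0]
    linarith
  have hxm : x ∈ P.A m :=
    mem_of_subset hx0 (subset_of_dep_le (subset_of_mem hx'.1) (hmz.trans hz) hdx)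
  have hcol : ∀ y ∈ P.A m, y ∉ P.A (P.par s) → P.top f y = s := fun y hy hy' =>
    (state_fst_eq_iff (g := P.goal f) subset_goal hs0 hss (ne_root_of_mem hy)).2
      ⟨hmz' hy, hy'⟩
  have hxs : P.top f x = s := hcol x hxm fun h => notMem_A_par hs0 (subset_of_mem h hs)
  have hlen := le_sum_color (P.top f) s huv
    ((A_par_subset_of_mem hs).trans (subset_of_mem hx'.1)) (hmz.trans hz) hcol
  rw [classLen, hxs] at hbad
  have hps : P.dep (P.par s) ≤ P.dep (P.par x) := by
    refine dep_mono ?_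
    by_cases h : s = x
    · rw [h]
    · exact A_par_subset_of_mem (mem_A_par hs h)
  have hmax : max (P.dep u) (P.dep (P.par s)) ≤ ((n : ℝ) + 1) * 256 ^ j - 256 ^ j / 32 :=
    max_le (by linarith) (by linarith)
  linarith

/-- A block containing a badly colored edge is spoiled, turned or killed. -/
lemma spoiled_or_turned_or_killed (hlow : ∀ x y, P.d x y ≤ ‖f x - f y‖) {D : ℝ} (hD : 1 ≤ D)
    (hlip : ∀ v, v ≠ P.root → ‖f v - f (P.par v)‖ ≤ D * P.w v) {j : ℤ} {u v x : V} {n : ℕ}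
    (hn : 0 < n) (huv : P.A u ⊆ P.A v) (hx : x ∈ P.A v \ P.A u)
    (hbad : P.classLen f u v x < 256 ^ j / 128)
    (hun : P.dep u ≤ ((n : ℝ) - 1) * 256 ^ j) (hvn : ((n : ℝ) + 2) * 256 ^ j ≤ P.dep v)
    (h1 : (n : ℝ) * 256 ^ j + 256 ^ j / 128 ≤ P.dep (P.par x))
    (h2 : P.dep (P.par x) ≤ ((n : ℝ) + 1) * 256 ^ j - 256 ^ j / 32) :
    P.Spoiled f j v n ∨ P.Turned f j v n ∨ P.Killed D j u v n := by
  have hβ := scale_pos j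
  obtain ⟨s, hs, hss, hbs, hfirst⟩ := exists_first_start huv hx hbad hun h1 h2
  have hx' := Finset.mem_sdiff.1 hx
  have hx0 := ne_root_of_mem hx'.1
  have hsv := subset_of_mem hx'.1 hs
  rcases spoiled_or_exactScale hn hsv hss hbs hfirst with h | hex
  · exact Or.inl h
  right
  have hfar := fun z => far_of_exactScale (z := z) hlow huv hx hbad hun h2 hs hss hbs hex
  have hnβ := mul_pos (Nat.cast_pos (α := ℝ).2 hn) hβ
  have hwx := w_le_classLen (f := f) hx
  obtain ⟨g, hg, hg1, hg2⟩ := exists_first_height (v := v) (t := ((n : ℝ) + 1) * 256 ^ j)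
    (by linarith) (by linarith)
  have hg0 := ne_root_of_mem hg
  have hxg : x ∈ P.A g := by
    refine mem_of_subset hx0 (subset_of_dep_le (subset_of_mem hx'.1) (subset_of_mem hg) ?_)
    rw [P.dep_of_ne hx0]
    linarith
  have hxpg : x ∈ P.A (P.par g) := by
    refine mem_A_par hxg ?_
    rintro rfl
    rw [P.dep_of_ne hx0] at hg1
    linarith
  have hqv : P.A (P.par s) ⊆ P.A v := A_par_subset_of_mem hsv
  have hqd := bl_mul_le (P := P) j (P.par s)
  rw [hbs] at hqd
  have hextrap : P.extrap f j (P.par s) =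
      (2 : ℝ) • P.interp f v (n * 256 ^ j) - P.interp f v (((n : ℝ) - 1) * 256 ^ j) := by
    rw [extrap, hbs, interp_congr f hqv hqd, interp_congr f hqv (by linarith)]
  have hD0 : 0 < D := by linarith
  have hpg : P.A (P.par g) ⊆ P.A v := A_par_subset_of_mem hg
  have turned : ∀ z, P.A z ⊆ P.A v → P.A s ⊆ P.A z →
      |((n : ℝ) + 1) * 256 ^ j - P.dep z| ≤ 256 ^ j / (256 * D) → P.Turned f j v n := by
    intro z hz hsz habs
    have hβD : D * (256 ^ j / (256 * D)) = 256 ^ j / 256 := by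
      field_simp
    have hβD' : (256 : ℝ) ^ j / (256 * D) ≤ 256 ^ j / 256 :=
      div_le_div_of_nonneg_left hβ.le (by norm_num) (by linarith)
    have hfz : P.interp f v (P.dep z) = f z := by
      rw [interp_congr f hz le_rfl, interp_of_le f le_rfl]
    have hclose : ‖P.interp f v (((n : ℝ) + 1) * 256 ^ j) - f z‖ ≤ 256 ^ j / 256 := by
      rw [← hfz]
      rcases le_total (P.dep z) (((n : ℝ) + 1) * 256 ^ j) with h | h
      · refine (interp_lipschitz hD0.le hlip v h).trans ?_
        rw [← hβD]
        exact mul_le_mul_of_nonneg_left ((le_abs_self _).trans habs) hD0.le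
      · rw [norm_sub_rev]
        refine (interp_lipschitz hD0.le hlip v h).trans ?_
        rw [← hβD]
        rw [abs_sub_comm] at habs
        exact mul_le_mul_of_nonneg_left ((le_abs_self _).trans habs) hD0.le
    have hf := hfar z hz hsz (by linarith [(abs_le.1 habs).2])
    rw [hextrap] at hf
    rw [Turned, sub_add]
    have htri := norm_sub_le_norm_sub_add_norm_sub (f z)
      (P.interp f v (((n : ℝ) + 1) * 256 ^ j))
      ((2 : ℝ) • P.interp f v (n * 256 ^ j) - P.interp f v (((n : ℝ) - 1) * 256 ^ j))
    rw [norm_sub_rev (f z) (P.interp f v (((n : ℝ) + 1) * 256 ^ j))] at htri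
    linarith
  by_cases c1 : P.dep g ≤ ((n : ℝ) + 1) * 256 ^ j + 256 ^ j / (256 * D)
  · refine Or.inl (turned g (subset_of_mem hg) (subset_of_mem (subset_of_mem hxg hs)) ?_)
    rw [abs_le]
    constructor <;> linarith
  by_cases c2 : ((n : ℝ) + 1) * 256 ^ j - 256 ^ j / (256 * D) ≤ P.dep (P.par g)
  · refine Or.inl (turned _ hpg (subset_of_mem (subset_of_mem hxpg hs)) ?_)
    rw [abs_le]
    constructor <;> linarith
  right
  refine ⟨g, Finset.mem_sdiff.2 ⟨hg, fun h => hx'.2 (subset_of_mem h hxg)⟩,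
    bl_eq ?_ hg2, ?_⟩
  · have := dep_mono (subset_of_mem hxpg)
    have := dep_par_le hx0
    linarith
  · rw [not_le] at c1 c2
    have hw : 256 ^ j / (128 * D) ≤ P.w g := by
      have e : (256 : ℝ) ^ j / (128 * D) = 256 ^ j / (256 * D) + 256 ^ j / (256 * D) := by
        field_simp
        norm_num
      rw [P.dep_of_ne hg0] at c1
      linarith
    rw [div_le_iff₀ (by positivity)] at hw
    linarith

end ParentTree
end Trichotomy

section Counting
open scoped Classical

namespace ParentTree

variable {V : Type*} {P : ParentTree V}

lemma sum_w_le_of_dep_par_mem {v : V} {B : Finset V} (hB : B ⊆ P.A v) {γ a b : ℝ}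
    (hw : ∀ x ∈ B, P.w x ≤ γ) (hab : a ≤ b + γ) :
    ∑ x ∈ B with a ≤ P.dep (P.par x) ∧ P.dep (P.par x) ≤ b, P.w x ≤ b - a + γ := by
  set g : V → ℝ := fun y => max a (min (P.dep y) (b + γ)) with hg
  have hmono : ∀ x ∈ P.A v, 0 ≤ g x - g (P.par x) := fun x hx =>
    sub_nonneg.2 (max_le_max le_rfl (min_le_min (dep_par_le (ne_root_of_mem hx)) le_rfl))
  calc ∑ x ∈ B with a ≤ P.dep (P.par x) ∧ P.dep (P.par x) ≤ b, P.w x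
      ≤ ∑ x ∈ B with a ≤ P.dep (P.par x) ∧ P.dep (P.par x) ≤ b, (g x - g (P.par x)) := by
        refine Finset.sum_le_sum fun x hx => ?_
        rw [Finset.mem_filter] at hx
        have hx0 := ne_root_of_mem (hB hx.1)
        have h1 := hw x hx.1
        have h2 := P.dep_of_ne hx0
        have h3 := P.w_pos x hx0
        simp only [hg]
        rw [min_eq_left (by linarith), min_eq_left (by linarith), max_eq_right (by linarith),
          max_eq_right (by linarith)]
        linarith
    _ ≤ ∑ x ∈ P.A v, (g x - g (P.par x)) :=
        Finset.sum_le_sum_of_subset_of_nonneg ((Finset.filter_subset _ _).trans hB)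
          fun x hx _ => hmono x hx
    _ = g v - g P.root := by
        have := sum_telescope (P := P) (fun y => - g y) v
        simp only [neg_sub_neg] at this
        rw [this]
    _ ≤ b - a + γ := by
        have h1 : g v ≤ b + γ := max_le hab (min_le_right _ _)
        have h2 : a ≤ g P.root := le_max_left _ _
        linarith

lemma card_Icc_bl (j : ℤ) {u v : V} (huv : P.A u ⊆ P.A v) :
    ((Finset.Icc (P.bl j u) (P.bl j v)).card : ℝ) * 256 ^ j ≤
      P.dep v - P.dep u + 2 * 256 ^ j := by
  rw [Nat.card_Icc, Nat.cast_sub ((bl_mono (dep_mono huv)).trans (Nat.le_succ _))]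
  have h1 := bl_mul_le (P := P) j v
  have h2 := lt_bl_mul (P := P) j u
  push_cast
  linarith

lemma card_of_injOn (j : ℤ) {u v : V} (huv : P.A u ⊆ P.A v) {S : Finset ℕ}
    (hS : S ⊆ Finset.Icc (P.bl j u) (P.bl j v)) (hinj : Set.InjOn (fun n => n / 256) S) :
    (S.card : ℝ) * 256 ^ j ≤ (P.dep v - P.dep u) / 256 + 2 * 256 ^ j := by
  have h1 : S.card ≤ (Finset.Icc (P.bl (j + 1) u) (P.bl (j + 1) v)).card := by
    refine Finset.card_le_card_of_injOn _ (fun n hn => ?_) hinj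
    have := Finset.mem_Icc.1 (hS hn)
    rw [Finset.mem_coe, Finset.mem_Icc, bl_succ, bl_succ]
    exact ⟨Nat.div_le_div_right this.1, Nat.div_le_div_right this.2⟩
  have h2 := card_Icc_bl (P := P) (j + 1) huv
  have h3 : (S.card : ℝ) ≤ (Finset.Icc (P.bl (j + 1) u) (P.bl (j + 1) v)).card := by
    exact_mod_cast h1
  rw [zpow_add_one₀ (by norm_num)] at h2
  have h4 := mul_le_mul_of_nonneg_right h3 (scale_pos j).le
  linarith

variable {H : Type*} [NormedAddCommGroup H] [NormedSpace ℝ H] {f : V → H}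

lemma Spoiled.injOn (j : ℤ) (v : V) :
    Set.InjOn (fun n => n / 256) {n | P.Spoiled f j v n} := by
  rintro n ⟨y, hy, hyy, hby, h⟩ n' ⟨y', hy', hyy', hby', h'⟩ (hnn : n / 256 = n' / 256)
  have h1 := h y' hy' hyy' (by rw [bl_succ, hby', hnn])
  have h2 := h' y hy hyy (by rw [bl_succ, hby, hnn])
  omega

/-- If the badly colored edges carry a large part of the length, then many blocks are turned or
killed. -/
lemma many_turned_or_killed (hlow : ∀ x y, P.d x y ≤ ‖f x - f y‖) {D : ℝ} (hD : 1 ≤ D)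
    (hlip : ∀ v, v ≠ P.root → ‖f v - f (P.par v)‖ ≤ D * P.w v) {j : ℤ} {u v : V}
    (huv : P.A u ⊆ P.A v) (hj : 1024 * 256 ^ j ≤ P.dep v - P.dep u)
    {B : Finset V} (hB : B ⊆ P.A v \ P.A u)
    (hbad : ∀ x ∈ B, P.classLen f u v x < 256 ^ j / 128)
    (hlarge : (P.dep v - P.dep u) / 4 < ∑ x ∈ B, P.w x) :
    (P.dep v - P.dep u) / 16 ≤
      ((Finset.Icc (P.bl j u) (P.bl j v)).filter fun n => n % 256 ≠ 0 ∧
        (P.Turned f j v n ∨ P.Killed D j u v n)).card * 256 ^ j := by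
  have hβ := scale_pos j
  set β : ℝ := 256 ^ j with hβdef
  set I := Finset.Icc (P.bl j u) (P.bl j v) with hI
  set L := P.dep v - P.dep u with hL
  have hBv : B ⊆ P.A v := hB.trans Finset.sdiff_subset
  have hBw : ∀ x ∈ B, P.w x ≤ β / 128 := fun x hx =>
    (w_le_classLen (hB hx)).trans (hbad x hx).le
  set hit : ℕ → Prop := fun n => n % 256 ≠ 0 ∧
    (P.Spoiled f j v n ∨ P.Turned f j v n ∨ P.Killed D j u v n) with hhit
  have hfib : ∑ n ∈ I, ∑ x ∈ B with P.bl j (P.par x) = n, P.w x = ∑ x ∈ B, P.w x := by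
    refine Finset.sum_fiberwise_of_maps_to (fun x hx => ?_) _
    have hx' := Finset.mem_sdiff.1 (hB hx)
    exact Finset.mem_Icc.2 ⟨bl_mono (dep_mono (A_subset_par huv hx'.1 hx'.2)),
      bl_mono (dep_mono (A_par_subset_of_mem hx'.1))⟩
  have hsub : ∀ (S S' : Finset V), S ⊆ B → S' ⊆ S → ∑ x ∈ S', P.w x ≤ ∑ x ∈ S, P.w x :=
    fun S S' hS h => Finset.sum_le_sum_of_subset_of_nonneg h fun x hx _ =>
      (P.w_pos x (ne_root_of_mem (hBv (hS hx)))).le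
  have hall : ∀ n : ℕ, ∑ x ∈ B with P.bl j (P.par x) = n, P.w x ≤ 2 * β := by
    intro n
    refine le_trans ?_ ((sum_w_le_of_dep_par_mem hBv (a := n * β) (b := (n + 1) * β) hBw
      (by linarith)).trans (by linarith))
    refine hsub _ _ (Finset.filter_subset _ _) fun x hx => ?_
    rw [Finset.mem_filter] at hx ⊢
    refine ⟨hx.1, ?_, ?_⟩
    · rw [← hx.2]; exact bl_mul_le _ _
    · rw [← hx.2]; exact (lt_bl_mul _ _).le
  have hmiss : ∀ n : ℕ, n % 256 ≠ 0 → P.dep u ≤ ((n : ℝ) - 1) * β → ((n : ℝ) + 2) * β ≤ P.dep v →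
      ¬ hit n → ∑ x ∈ B with P.bl j (P.par x) = n, P.w x ≤ β / 16 := by
    intro n h1 h2 h3 h4
    have hcover : (B.filter fun x => P.bl j (P.par x) = n) ⊆
        (B.filter fun x => n * β ≤ P.dep (P.par x) ∧ P.dep (P.par x) ≤ n * β + β / 128) ∪
        (B.filter fun x => (n + 1) * β - β / 32 ≤ P.dep (P.par x) ∧
          P.dep (P.par x) ≤ (n + 1) * β) := by
      intro x hx
      rw [Finset.mem_filter] at hx
      have e1 := bl_mul_le (P := P) j (P.par x)
      have e2 := lt_bl_mul (P := P) j (P.par x)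
      rw [hx.2] at e1 e2
      rw [Finset.mem_union, Finset.mem_filter, Finset.mem_filter]
      by_contra hcon
      rw [not_or] at hcon
      refine h4 ⟨h1, spoiled_or_turned_or_killed hlow hD hlip (Nat.pos_of_ne_zero ?_) huv
        (hB hx.1) (hbad x hx.1) h2 h3 ?_ ?_⟩
      · rintro rfl; exact h1 rfl
      · by_contra hc
        exact hcon.1 ⟨hx.1, e1, (not_le.1 hc).le⟩
      · by_contra hc
        exact hcon.2 ⟨hx.1, (not_le.1 hc).le, e2.le⟩
    have s1 := sum_w_le_of_dep_par_mem hBv (a := n * β) (b := n * β + β / 128) hBw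
      (by linarith)
    have s2 := sum_w_le_of_dep_par_mem hBv (a := (n + 1) * β - β / 32) (b := (n + 1) * β) hBw
      (by linarith)
    have s3 := hsub _ _ (Finset.union_subset (Finset.filter_subset _ _)
      (Finset.filter_subset _ _)) hcover
    have s4 := Finset.sum_union_inter (f := P.w)
      (s₁ := B.filter fun x => n * β ≤ P.dep (P.par x) ∧ P.dep (P.par x) ≤ n * β + β / 128)
      (s₂ := B.filter fun x => (n + 1) * β - β / 32 ≤ P.dep (P.par x) ∧
          P.dep (P.par x) ≤ (n + 1) * β)
    have s5 := hsub _ ∅ (Finset.filter_subset (fun x => n * β ≤ P.dep (P.par x) ∧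
        P.dep (P.par x) ≤ n * β + β / 128) B) (Finset.empty_subset _)
    have s6 : 0 ≤ ∑ x ∈ (B.filter fun x => n * β ≤ P.dep (P.par x) ∧
        P.dep (P.par x) ≤ n * β + β / 128) ∩
        (B.filter fun x => (n + 1) * β - β / 32 ≤ P.dep (P.par x) ∧
          P.dep (P.par x) ≤ (n + 1) * β), P.w x :=
      Finset.sum_nonneg fun x hx => (P.w_pos x (ne_root_of_mem
        (hBv (Finset.mem_filter.1 (Finset.mem_inter.1 hx).1).1))).le
    linarith
  set E := ({P.bl j u, P.bl j u + 1, P.bl j v - 1, P.bl j v} : Finset ℕ) with hE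
  have hEcard : (E.card : ℝ) ≤ 4 := by exact_mod_cast Finset.card_le_four
  set Z := I.filter fun n => n % 256 = 0 with hZ
  set T := I.filter hit with hT
  have hterm : ∀ n ∈ I, ∑ x ∈ B with P.bl j (P.par x) = n, P.w x ≤
      (if hit n then 2 * β else 0) + (if n % 256 = 0 then 2 * β else 0) +
        (if n ∈ E then 2 * β else 0) + β / 16 := by
    intro n hn
    have hn' := Finset.mem_Icc.1 hn
    have h2β : (0 : ℝ) ≤ 2 * β := by linarith
    have i1 : (0 : ℝ) ≤ if hit n then 2 * β else 0 := by split_ifs <;> simp [h2β]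
    have i2 : (0 : ℝ) ≤ if n % 256 = 0 then 2 * β else 0 := by split_ifs <;> simp [h2β]
    have i3 : (0 : ℝ) ≤ if n ∈ E then 2 * β else 0 := by split_ifs <;> simp [h2β]
    have ha := hall n
    by_cases c1 : hit n
    · rw [if_pos c1] at i1 ⊢
      linarith
    by_cases c2 : n % 256 = 0
    · rw [if_pos c2]
      linarith
    by_cases c3 : n ∈ E
    · rw [if_pos c3]
      linarith
    have := hmiss n c2 ?_ ?_ c1
    · linarith
    · simp only [hE, Finset.mem_insert, Finset.mem_singleton, not_or] at c3
      have : P.bl j u + 1 ≤ n - 1 := by omega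
      have h1 : ((P.bl j u : ℝ) + 1) ≤ (n : ℝ) - 1 := by
        have : P.bl j u + 1 + 1 ≤ n := by omega
        have : ((P.bl j u + 1 + 1 : ℕ) : ℝ) ≤ n := by exact_mod_cast this
        push_cast at this
        linarith
      exact (lt_bl_mul j u).le.trans (mul_le_mul_of_nonneg_right h1 hβ.le)
    · simp only [hE, Finset.mem_insert, Finset.mem_singleton, not_or] at c3
      have h1 : (n : ℝ) + 2 ≤ P.bl j v := by
        have : n + 2 ≤ P.bl j v := by omega
        exact_mod_cast this
      exact (mul_le_mul_of_nonneg_right h1 hβ.le).trans (bl_mul_le j v)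
  have hsum := Finset.sum_le_sum hterm
  rw [hfib, Finset.sum_add_distrib, Finset.sum_add_distrib, Finset.sum_add_distrib,
    ← Finset.sum_filter, ← Finset.sum_filter, ← Finset.sum_filter, Finset.sum_const,
    Finset.sum_const, Finset.sum_const, Finset.sum_const, nsmul_eq_mul, nsmul_eq_mul,
    nsmul_eq_mul, nsmul_eq_mul, ← hT, ← hZ] at hsum
  have hE' : ((I.filter fun n => n ∈ E).card : ℝ) ≤ 4 := by
    refine le_trans ?_ hEcard
    exact_mod_cast Finset.card_le_card fun n hn => (Finset.mem_filter.1 hn).2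
  have hE'' := mul_le_mul_of_nonneg_right hE' hβ.le
  have hIc := card_Icc_bl (P := P) j huv
  have hZc : (Z.card : ℝ) * β ≤ L / 256 + 2 * β := by
    refine card_of_injOn j huv (Finset.filter_subset _ _) fun n hn n' hn' h => ?_
    have e1 := (Finset.mem_filter.1 hn).2
    have e2 := (Finset.mem_filter.1 hn').2
    simp only at h
    omega
  have hSc : ((I.filter fun n => P.Spoiled f j v n).card : ℝ) * β ≤ L / 256 + 2 * β :=
    card_of_injOn j huv (Finset.filter_subset _ _) ((Spoiled.injOn (f := f) j v).mono
      fun n hn => (Finset.mem_filter.1 hn).2)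
  have hTc : (T.card : ℝ) ≤ (I.filter fun n => P.Spoiled f j v n).card +
      (I.filter fun n => n % 256 ≠ 0 ∧ (P.Turned f j v n ∨ P.Killed D j u v n)).card := by
    have : T ⊆ (I.filter fun n => P.Spoiled f j v n) ∪
        (I.filter fun n => n % 256 ≠ 0 ∧ (P.Turned f j v n ∨ P.Killed D j u v n)) := by
      intro n hn
      obtain ⟨h1, h2, h3⟩ := Finset.mem_filter.1 hn
      rw [Finset.mem_union, Finset.mem_filter, Finset.mem_filter]
      tauto
    exact_mod_cast (Finset.card_le_card this).trans (Finset.card_union_le _ _)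
  have hTc' := mul_le_mul_of_nonneg_right hTc hβ.le
  rw [← hI, ← hL] at hIc
  linarith

end ParentTree
end Counting

section Multiscale
open scoped Classical

namespace ParentTree

variable {V : Type*} {P : ParentTree V}

lemma sum_scale_le (j : ℤ) (k : ℕ) :
    ∑ i ∈ Finset.range (k + 1), (256 : ℝ) ^ (j + i) ≤ 2 * 256 ^ (j + k) := by
  induction k with
  | zero =>
    have := scale_pos j
    simp
    linarith
  | succ k ih =>
    rw [Finset.sum_range_succ]
    have := scale_pos (j + k)
    push_cast
    rw [← add_assoc, zpow_add_one₀ (by norm_num)]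
    linarith

lemma sum_scale_filter_le (j : ℤ) {W : ℝ} (hW : 0 ≤ W) (k : ℕ) :
    ∑ i ∈ Finset.range k with (256 : ℝ) ^ (j + (i : ℕ)) ≤ W, (256 : ℝ) ^ (j + (i : ℕ)) ≤ 2 * W := by
  induction k with
  | zero => simpa using hW
  | succ k ih =>
    by_cases h : (256 : ℝ) ^ (j + k) ≤ W
    · refine (Finset.sum_le_sum_of_subset_of_nonneg (Finset.filter_subset _ _)
        fun i _ _ => (scale_pos _).le).trans ((sum_scale_le j k).trans ?_)
      linarith
    · rwa [Finset.range_add_one, Finset.filter_insert, if_neg h]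

lemma sum_killed_le (D : ℝ) (hD : 0 ≤ D) (j : ℤ) (K : ℕ) {u v : V} (huv : P.A u ⊆ P.A v)
    (I : ℕ → Finset ℕ) :
    ∑ i ∈ Finset.range K, (((I i).filter fun n => P.Killed D (j + i) u v n).card : ℝ) *
      256 ^ (j + i) ≤ 256 * D * (P.dep v - P.dep u) := by
  have step : ∀ i : ℕ, (((I i).filter fun n => P.Killed D (j + i) u v n).card : ℝ) *
      256 ^ (j + i) ≤ ∑ x ∈ P.A v \ P.A u,
        if (256 : ℝ) ^ (j + i) ≤ 128 * D * P.w x then (256 : ℝ) ^ (j + i) else 0 := by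
    intro i
    rw [← Finset.sum_filter, Finset.sum_const, nsmul_eq_mul]
    refine mul_le_mul_of_nonneg_right ?_ (scale_pos _).le
    norm_cast
    refine le_trans (Finset.card_le_card fun n hn => ?_) (Finset.card_image_le
      (f := fun x => P.bl (j + i) (P.par x)))
    obtain ⟨x, hx, h1, h2⟩ := (Finset.mem_filter.1 hn).2
    exact Finset.mem_image.2 ⟨x, Finset.mem_filter.2 ⟨hx, h2⟩, h1⟩
  refine (Finset.sum_le_sum fun i _ => step i).trans ?_
  rw [Finset.sum_comm, ← sum_sdiff_w huv, Finset.mul_sum]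
  refine Finset.sum_le_sum fun x hx => ?_
  have hw := P.w_pos x (ne_root_of_mem (Finset.mem_sdiff.1 hx).1)
  rw [← Finset.sum_filter]
  refine (sum_scale_filter_le j (by positivity) K).trans (le_of_eq (by ring))

variable {H : Type*} [NormedAddCommGroup H] [InnerProductSpace ℝ H] {f : V → H}

lemma sum_turned_le {D : ℝ} (hD : 0 ≤ D)
    (hlip : ∀ v, v ≠ P.root → ‖f v - f (P.par v)‖ ≤ D * P.w v) (j : ℤ) (K : ℕ) {u v : V}
    (huv : P.A u ⊆ P.A v) :
    ∑ i ∈ Finset.range K, (((Finset.Icc (P.bl (j + i) u) (P.bl (j + i) v)).filter fun n =>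
      n % 256 ≠ 0 ∧ P.Turned f (j + i) v n).card : ℝ) * 256 ^ (j + i) ≤
      2 ^ 18 * D ^ 2 * (P.dep v - P.dep u + 2 * 256 ^ (j + K)) := by
  have hβ := scale_pos j
  set M := P.bl (j + K) u with hM
  set N := P.bl (j + K) v + 1 with hN
  have hMN : M ≤ N := (bl_mono (dep_mono huv)).trans (Nat.le_succ _)
  have hbl : ∀ x, ∀ i ≤ K, P.bl (j + K) x = P.bl (j + i) x / 256 ^ (K - i) := by
    intro x i hi
    obtain ⟨k, rfl⟩ := Nat.exists_eq_add_of_le hi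
    clear hi hM hN hMN M N
    induction k with
    | zero => simp
    | succ k ih =>
      rw [Nat.add_sub_cancel_left] at ih ⊢
      rw [pow_succ, ← Nat.div_div_eq_div_mul, ← ih, ← bl_succ]
      congr 1
      push_cast
      ring
  have hcast : ∀ (n i : ℕ), ((n * 256 ^ i : ℕ) : ℝ) * (256 : ℝ) ^ j = n * 256 ^ (j + i) := by
    intro n i
    rw [zpow_add₀ (by norm_num), zpow_natCast]
    push_cast
    ring
  have energy := energy_sum (b := 256) (fun n : ℕ => P.interp f v (n * 256 ^ j)) hMN K
  have upper : ∑ n ∈ Finset.Ico (M * 256 ^ K) (N * 256 ^ K),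
      ‖P.interp f v (((n + 1 : ℕ) : ℝ) * 256 ^ j) - P.interp f v (n * 256 ^ j)‖ ^ 2 ≤
      D ^ 2 * 256 ^ j * (P.dep v - P.dep u + 2 * 256 ^ (j + K)) := by
    have h1 : ∀ n ∈ Finset.Ico (M * 256 ^ K) (N * 256 ^ K),
        ‖P.interp f v (((n + 1 : ℕ) : ℝ) * 256 ^ j) - P.interp f v (n * 256 ^ j)‖ ^ 2 ≤
        (D * 256 ^ j) ^ 2 := by
      intro n _
      refine pow_le_pow_left₀ (norm_nonneg _) ((interp_lipschitz hD hlip v ?_).trans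
        (le_of_eq ?_)) 2
      · push_cast; linarith
      · push_cast; ring
    refine (Finset.sum_le_sum h1).trans ?_
    rw [Finset.sum_const, nsmul_eq_mul, Nat.card_Ico, ← Nat.sub_mul]
    have h2 := card_Icc_bl (P := P) (j + K) huv
    rw [Nat.card_Icc, ← hN, ← hM] at h2
    have h3 : (((N - M) * 256 ^ K : ℕ) : ℝ) * (D * 256 ^ j) ^ 2 =
        D ^ 2 * 256 ^ j * (((N - M : ℕ) : ℝ) * 256 ^ (j + K)) := by
      rw [← hcast]
      ring
    rw [h3]
    exact mul_le_mul_of_nonneg_left h2 (by positivity)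
  have lower : ∀ i ∈ Finset.range K,
      (((Finset.Icc (P.bl (j + i) u) (P.bl (j + i) v)).filter fun n =>
        n % 256 ≠ 0 ∧ P.Turned f (j + i) v n).card : ℝ) * 256 ^ (j + i) * (256 ^ j / 2 ^ 18) ≤
      ∑ n ∈ Finset.Ico (M * 256 ^ (K - i)) (N * 256 ^ (K - i)) with n % 256 ≠ 0,
        ‖P.interp f v (((n + 1) * 256 ^ i : ℕ) * 256 ^ j) -
          (2 : ℝ) • P.interp f v ((n * 256 ^ i : ℕ) * 256 ^ j) +
          P.interp f v (((n - 1) * 256 ^ i : ℕ) * 256 ^ j)‖ ^ 2 / 4 / ((256 : ℕ) : ℝ) ^ i := by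
    intro i hi
    have hiK := (Finset.mem_range.1 hi).le
    have hsub : ((Finset.Icc (P.bl (j + i) u) (P.bl (j + i) v)).filter fun n =>
        n % 256 ≠ 0 ∧ P.Turned f (j + i) v n) ⊆
        (Finset.Ico (M * 256 ^ (K - i)) (N * 256 ^ (K - i))).filter fun n => n % 256 ≠ 0 := by
      intro n hn
      obtain ⟨h1, h2, -⟩ := Finset.mem_filter.1 hn
      rw [Finset.mem_Icc] at h1
      refine Finset.mem_filter.2 ⟨Finset.mem_Ico.2 ⟨?_, ?_⟩, h2⟩
      · rw [hM, hbl u i hiK]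
        exact (Nat.div_mul_le_self _ _).trans h1.1
      · rw [hN, hbl v i hiK]
        exact h1.2.trans_lt ((Nat.div_lt_iff_lt_mul (by positivity)).1 (Nat.lt_succ_self _))
    refine le_trans ?_ (Finset.sum_le_sum_of_subset_of_nonneg hsub fun n _ _ => by positivity)
    rw [mul_assoc, ← nsmul_eq_mul, ← Finset.sum_const]
    refine Finset.sum_le_sum fun n hn => ?_
    obtain ⟨-, h2, h3⟩ := Finset.mem_filter.1 hn
    have hn1 : 1 ≤ n := Nat.one_le_iff_ne_zero.2 fun h => h2 (by rw [h])
    rw [hcast, hcast, hcast, Nat.cast_sub hn1]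
    push_cast
    rw [Turned] at h3
    have h4 := pow_le_pow_left₀ (by positivity) h3 2
    have h5 : (256 : ℝ) ^ (j + i) * (256 ^ j / 2 ^ 18) =
        (256 ^ (j + i) / 256) ^ 2 / 4 / 256 ^ i := by
      rw [zpow_add₀ (by norm_num), zpow_natCast]
      field_simp
      norm_num
    rw [h5]
    gcongr
  have total := (Finset.sum_le_sum lower).trans (energy.trans upper)
  rw [← Finset.sum_mul] at total
  refine le_of_mul_le_mul_right (total.trans (le_of_eq ?_))
    (show (0 : ℝ) < 256 ^ j / 2 ^ 18 by positivity)
  ring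

/-- The badly colored edges of a monotone path carry at most a quarter of its length. -/
lemma sum_bad_le (hlow : ∀ x y, P.d x y ≤ ‖f x - f y‖) {D : ℝ} (hD : 1 ≤ D)
    (hlip : ∀ v, v ≠ P.root → ‖f v - f (P.par v)‖ ≤ D * P.w v) {K : ℕ}
    (hK : 2 ^ 24 * D ^ 2 < K) {u v : V} (huv : P.A u ⊆ P.A v) :
    ∑ x ∈ P.A v \ P.A u with
      P.classLen f u v x < (P.dep v - P.dep u) / (128 * 1024 * 256 ^ K), P.w x ≤
      (P.dep v - P.dep u) / 4 := by
  by_contra hlarge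
  rw [not_le] at hlarge
  have hL0 : 0 < P.dep v - P.dep u := by
    rcases (sub_nonneg.2 (dep_mono huv)).eq_or_lt with h | h
    · have h1 := sum_sdiff_w huv
      rw [← h] at h1 hlarge
      have h2 := Finset.sum_le_sum_of_subset_of_nonneg (f := P.w)
        (Finset.filter_subset (fun x => P.classLen f u v x < 0 / (128 * 1024 * 256 ^ K))
          (P.A v \ P.A u))
        fun x hx _ => (P.w_pos x (ne_root_of_mem (Finset.mem_sdiff.1 hx).1)).le
      linarith
    · exact h
  set L := P.dep v - P.dep u with hL
  obtain ⟨j1, hj1⟩ := exists_mem_Ico_zpow (x := L / 1024) (y := (256 : ℝ)) (by positivity)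
    (by norm_num)
  obtain ⟨j, rfl⟩ : ∃ j : ℤ, j1 = j + K - 1 := ⟨j1 + 1 - K, by ring⟩
  rw [sub_add_cancel] at hj1
  obtain ⟨h1, h2⟩ := hj1
  have hK0 : 1 ≤ K := by
    rw [Nat.one_le_iff_ne_zero]
    rintro rfl
    have : 0 ≤ 2 ^ 24 * D ^ 2 := by positivity
    simp at hK
    linarith
  have hscale : ∀ i ∈ Finset.range K, 1024 * (256 : ℝ) ^ (j + i) ≤ L := by
    intro i hi
    have hi' : j + i ≤ j + K - 1 := by
      have := Finset.mem_range.1 hi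
      omega
    have := zpow_le_zpow_right₀ (a := (256 : ℝ)) (by norm_num) hi'
    linarith
  have hbad : ∀ i : ℕ, ∀ x ∈ (P.A v \ P.A u).filter
      (fun x => P.classLen f u v x < L / (128 * 1024 * 256 ^ K)),
      P.classLen f u v x < 256 ^ (j + i) / 128 := by
    intro i x hx
    refine (Finset.mem_filter.1 hx).2.trans_le ?_
    have h3 := zpow_le_zpow_right₀ (a := (256 : ℝ)) (by norm_num) (show j ≤ j + i by omega)
    rw [zpow_add₀ (by norm_num), zpow_natCast] at h2
    rw [div_le_div_iff₀ (by positivity) (by norm_num)]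
    have h4 := mul_le_mul_of_nonneg_right h3 (show (0 : ℝ) ≤ 256 ^ K by positivity)
    linarith
  have hmany := Finset.sum_le_sum fun i hi =>
    many_turned_or_killed hlow hD hlip huv (hscale i hi) (Finset.filter_subset _ _) (hbad i) hlarge
  rw [Finset.sum_const, Finset.card_range, nsmul_eq_mul, ← hL] at hmany
  have hsplit : ∀ i ∈ Finset.range K,
      (((Finset.Icc (P.bl (j + i) u) (P.bl (j + i) v)).filter fun n => n % 256 ≠ 0 ∧
        (P.Turned f (j + i) v n ∨ P.Killed D (j + i) u v n)).card : ℝ) * 256 ^ (j + i) ≤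
      (((Finset.Icc (P.bl (j + i) u) (P.bl (j + i) v)).filter fun n =>
        n % 256 ≠ 0 ∧ P.Turned f (j + i) v n).card : ℝ) * 256 ^ (j + i) +
      (((Finset.Icc (P.bl (j + i) u) (P.bl (j + i) v)).filter fun n =>
        P.Killed D (j + i) u v n).card : ℝ) * 256 ^ (j + i) := by
    intro i _
    rw [← add_mul]
    refine mul_le_mul_of_nonneg_right ?_ (scale_pos _).le
    norm_cast
    refine (Finset.card_le_card fun n hn => ?_).trans (Finset.card_union_le _ _)
    rw [Finset.mem_union, Finset.mem_filter, Finset.mem_filter]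
    obtain ⟨g1, g2, g3⟩ := Finset.mem_filter.1 hn
    tauto
  have hsplit' := Finset.sum_le_sum hsplit
  rw [Finset.sum_add_distrib] at hsplit'
  have hT := sum_turned_le (f := f) (by linarith : (0 : ℝ) ≤ D) hlip j K huv
  have hKd := sum_killed_le D (by linarith) j K huv
    fun i => Finset.Icc (P.bl (j + i) u) (P.bl (j + i) v)
  rw [← hL] at hT hKd
  have htop : (256 : ℝ) ^ (j + K) ≤ L / 4 := by
    have : (256 : ℝ) ^ (j + K) = 256 ^ (j + K - 1) * 256 := by
      rw [← zpow_add_one₀ (by norm_num), sub_add_cancel]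
    linarith
  have hD2 : D ≤ D ^ 2 := by nlinarith
  have hT' : 2 ^ 18 * D ^ 2 * (L + 2 * 256 ^ (j + K)) ≤ 2 ^ 18 * D ^ 2 * (L + 2 * (L / 4)) := by
    gcongr
  have hKd' : 256 * D * L ≤ 256 * D ^ 2 * L := by gcongr
  have hfinal : 2 ^ 24 * D ^ 2 * L < K * L := mul_lt_mul_of_pos_right hK hL0
  have hpos : 0 ≤ D ^ 2 * L := by positivity
  linarith

end ParentTree
end Multiscale

section Strong
open scoped Classical

namespace ParentTree

variable {V : Type*} {P : ParentTree V} {H : Type*} [NormedAddCommGroup H]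

lemma countable_of_embedding [TopologicalSpace.SeparableSpace H] {f : V → H}
    (hlow : ∀ x y, P.d x y ≤ ‖f x - f y‖) : Countable V := by
  have hX : ∀ x u v, x ∈ P.A u → x ∉ P.A v → P.w x ≤ ‖f u - f v‖ := by
    intro x u v hu hv
    refine le_trans ?_ (hlow u v)
    refine Finset.single_le_sum (f := P.w) (fun y hy => (P.w_pos y (ne_root_of_mem_X hy)).le) ?_
    rw [X, Finset.mem_symmDiff]
    exact Or.inl ⟨hu, hv⟩
  have key : ∀ x y, x ≠ P.root → y ≠ P.root → x ≠ y →
      P.w x ≤ dist (f x, f (P.par x)) (f y, f (P.par y)) := by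
    intro x y hx hy hxy
    by_cases h : x ∈ P.A y
    · have := hX x (P.par y) (P.par x) (mem_A_par h hxy) (notMem_A_par hx)
      rw [Prod.dist_eq, dist_comm (f (P.par x)), dist_eq_norm (f (P.par y))]
      exact this.trans (le_max_right _ _)
    · have := hX x x y (P.self_mem hx) h
      rw [Prod.dist_eq, dist_eq_norm (f x)]
      exact this.trans (le_max_left _ _)
  have hc : {v | v ≠ P.root}.Countable := by
    refine Set.PairwiseDisjoint.countable_of_isOpen
      (s := fun v => Metric.ball (f v, f (P.par v)) (P.w v / 2)) ?_ (fun v _ => Metric.isOpen_ball)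
      fun v hv => Metric.nonempty_ball.2 (half_pos (P.w_pos v hv))
    intro x hx y hy hxy
    refine Metric.ball_disjoint_ball ?_
    have h1 := key x y hx hy hxy
    have h2 := key y x hy hx hxy.symm
    rw [dist_comm] at h2
    linarith
  have huniv : (Set.univ : Set V) = insert P.root {v | v ≠ P.root} := by
    ext v
    simp [em]
  exact Set.countable_univ_iff.1 (huniv ▸ hc.insert _)

variable [InnerProductSpace ℝ H] {f : V → H}

lemma sum_good_ge (hlow : ∀ x y, P.d x y ≤ ‖f x - f y‖) {D : ℝ} (hD : 1 ≤ D)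
    (hlip : ∀ v, v ≠ P.root → ‖f v - f (P.par v)‖ ≤ D * P.w v) {K : ℕ}
    (hK : 2 ^ 24 * D ^ 2 < K) (ι : V → ℤ) {m v a b : V}
    (hmv : P.A m ⊆ P.A v) (hsub : P.A v \ P.A m ⊆ P.X a b) {t : ℝ}
    (ht : t ≤ (P.dep v - P.dep m) / (128 * 1024 * 256 ^ K)) :
    3 / 4 * (P.dep v - P.dep m) ≤
      ∑ x ∈ P.A v \ P.A m with t ≤ P.cl (fun y => ι (P.top f y)) (ι (P.top f x)) a b, P.w x := by
  have hbad := sum_bad_le hlow hD hlip hK hmv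
  have htot := sum_sdiff_w hmv
  rw [← Finset.sum_filter_add_sum_filter_not _ fun x => P.classLen f m v x <
    (P.dep v - P.dep m) / (128 * 1024 * 256 ^ K)] at htot
  have hle : ∑ x ∈ P.A v \ P.A m with ¬ (P.classLen f m v x <
      (P.dep v - P.dep m) / (128 * 1024 * 256 ^ K)), P.w x ≤
      ∑ x ∈ P.A v \ P.A m with t ≤ P.cl (fun y => ι (P.top f y)) (ι (P.top f x)) a b, P.w x := by
    refine Finset.sum_le_sum_of_subset_of_nonneg (fun x hx => ?_) fun x hx _ =>
      (P.w_pos x (ne_root_of_mem (Finset.mem_sdiff.1 (Finset.mem_filter.1 hx).1).1)).le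
    rw [Finset.mem_filter] at hx ⊢
    refine ⟨hx.1, ht.trans ((not_lt.1 hx.2).trans ?_)⟩
    rw [classLen, cl]
    refine Finset.sum_le_sum_of_subset_of_nonneg (fun y hy => ?_) fun y hy _ =>
      (P.w_pos y (ne_root_of_mem_X (Finset.mem_filter.1 hy).1)).le
    rw [Finset.mem_filter] at hy ⊢
    exact ⟨hsub hy.1, congrArg ι hy.2⟩
  linarith

/-- A tree that embeds with bounded distortion into a Hilbert space has a strong coloring. -/
lemma strong_of_embedding (hlow : ∀ x y, P.d x y ≤ ‖f x - f y‖) {D : ℝ} (hD : 1 ≤ D)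
    (hlip : ∀ v, v ≠ P.root → ‖f v - f (P.par v)‖ ≤ D * P.w v) {K : ℕ}
    (hK : 2 ^ 24 * D ^ 2 < K) {ι : V → ℤ} (hι : Function.Injective ι) :
    P.Strong (1 / (2 ^ 20 * 256 ^ K)) fun y => ι (P.top f y) := by
  refine ⟨mono_state subset_goal hι, fun u v => ?_⟩
  obtain ⟨m, hm⟩ := P.exists_lca u v
  have hd := d_eq_of_lca hm
  have hmu : P.A m ⊆ P.A u := hm ▸ Finset.inter_subset_left
  have hmv : P.A m ⊆ P.A v := hm ▸ Finset.inter_subset_right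
  have hu : P.A u \ P.A v = P.A u \ P.A m := by rw [hm, Finset.sdiff_inter_self_left]
  have hv : P.A v \ P.A u = P.A v \ P.A m := by rw [hm, Finset.sdiff_inter_self_right]
  have hsplit : ∑ x ∈ P.X u v with 1 / (2 ^ 20 * 256 ^ K) * P.d u v ≤
      P.cl (fun y => ι (P.top f y)) (ι (P.top f x)) u v, P.w x =
      ∑ x ∈ P.A u \ P.A m with 1 / (2 ^ 20 * 256 ^ K) * P.d u v ≤
        P.cl (fun y => ι (P.top f y)) (ι (P.top f x)) u v, P.w x +
      ∑ x ∈ P.A v \ P.A m with 1 / (2 ^ 20 * 256 ^ K) * P.d u v ≤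
        P.cl (fun y => ι (P.top f y)) (ι (P.top f x)) u v, P.w x := by
    simp_rw [Finset.sum_filter]
    rw [sum_X, hu, hv]
  have hsubu : P.A u \ P.A m ⊆ P.X u v := by
    rw [← hu, X, symmDiff]
    exact Finset.subset_union_left
  have hsubv : P.A v \ P.A m ⊆ P.X u v := by
    rw [← hv, X, symmDiff]
    exact Finset.subset_union_right
  have hnn : ∀ y (p : V → Prop), 0 ≤ ∑ x ∈ P.A y \ P.A m with p x, P.w x := fun y p =>
    Finset.sum_nonneg fun x hx =>
      (P.w_pos x (ne_root_of_mem (Finset.mem_sdiff.1 (Finset.mem_filter.1 hx).1).1)).le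
  have side : ∀ y, P.A m ⊆ P.A y → P.A y \ P.A m ⊆ P.X u v →
      P.d u v / 8 ≤ P.dep y - P.dep m → 3 / 4 * (P.dep y - P.dep m) ≤
      ∑ x ∈ P.A y \ P.A m with 1 / (2 ^ 20 * 256 ^ K) * P.d u v ≤
        P.cl (fun y => ι (P.top f y)) (ι (P.top f x)) u v, P.w x := by
    intro y h1 h2 h3
    refine sum_good_ge hlow hD hlip hK ι h1 h2 ?_
    rw [le_div_iff₀ (by positivity)]
    refine le_trans (le_of_eq ?_) h3
    field_simp
    ring
  have n1 := sub_nonneg.2 (dep_mono hmu)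
  have n2 := sub_nonneg.2 (dep_mono hmv)
  beta_reduce
  rw [hsplit]
  by_cases c1 : P.d u v / 8 ≤ P.dep u - P.dep m
  · have s1 := side u hmu hsubu c1
    by_cases c2 : P.d u v / 8 ≤ P.dep v - P.dep m
    · have s2 := side v hmv hsubv c2
      linarith
    · rw [not_le] at c2
      have := hnn v fun x => 1 / (2 ^ 20 * 256 ^ K) * P.d u v ≤
        P.cl (fun y => ι (P.top f y)) (ι (P.top f x)) u v
      linarith
  · rw [not_le] at c1
    have s2 := side v hmv hsubv (by linarith)
    have := hnn u fun x => 1 / (2 ^ 20 * 256 ^ K) * P.d u v ≤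
      P.cl (fun y => ι (P.top f y)) (ι (P.top f x)) u v
    linarith

end ParentTree
end Strong

section Main
open MeasureTheory

lemma deltaStar_bddAbove (T : MetricTree) (r : T.V) :
    BddAbove {δ : ℝ | 0 < δ ∧ δ < 1 ∧ ∃ χ : Sym2 T.V → ℤ, IsStrongColoring T r δ χ} :=
  ⟨1, fun _ hδ => hδ.2.1.le⟩

lemma deltaStar_le_one (T : MetricTree) (r : T.V) : deltaStar T r ≤ 1 :=
  Real.sSup_le (fun _ hδ => hδ.2.1.le) zero_le_one

/-- The distortion of an embedding into `L_2` controls the strong coloring parameter. -/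
lemma deltaStar_of_hasEmbedding (T : MetricTree) (r : T.V) {D : ℝ}
    (h : HasEmbedding T.dist (fun g h : LpSpace 2 => dist g h) D) :
    0 < deltaStar T r ∧ √(1 + Real.log (1 / deltaStar T r)) ≤ 2 ^ 14 * max 1 D := by
  obtain ⟨s, hs, f, hf⟩ := (hasEmbedding_iff _ _).1 h
  set P := T.parentTree r
  set D' := max 1 D with hD'
  have hD1 : 1 ≤ D' := le_max_left _ _
  have hnorm : ∀ x y, ‖s⁻¹ • f x - s⁻¹ • f y‖ = s⁻¹ * ‖f x - f y‖ := fun x y => by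
    rw [← smul_sub, norm_smul, Real.norm_of_nonneg (inv_nonneg.2 hs.le)]
  have hlow : ∀ x y, P.d x y ≤ ‖s⁻¹ • f x - s⁻¹ • f y‖ := by
    intro x y
    rw [hnorm, inv_mul_eq_div, le_div_iff₀ hs, mul_comm, ← T.dist_eq r]
    exact (hf x y).1
  have hup : ∀ x y, ‖s⁻¹ • f x - s⁻¹ • f y‖ ≤ D' * P.d x y := by
    intro x y
    have h1 := (hf x y).2
    rw [T.dist_eq r] at h1
    have h2 : s * D * P.d x y ≤ s * D' * P.d x y :=
      mul_le_mul_of_nonneg_right (mul_le_mul_of_nonneg_left (le_max_right _ _) hs.le)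
        (ParentTree.d_nonneg x y)
    rw [hnorm, inv_mul_eq_div, div_le_iff₀ hs]
    linarith
  have hlip : ∀ v, v ≠ P.root → ‖s⁻¹ • f v - s⁻¹ • f (P.par v)‖ ≤ D' * P.w v := by
    intro v hv
    refine (hup v (P.par v)).trans (le_of_eq ?_)
    rw [ParentTree.d_comm, ParentTree.d_of_subset (P.A_par_subset hv), P.dep_of_ne hv,
      add_sub_cancel_left]
  have : Fact ((2 : ℝ≥0∞) ≠ ⊤) := ⟨ENNReal.ofNat_ne_top⟩
  have : Countable T.V := ParentTree.countable_of_embedding hlow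
  obtain ⟨ι, hι⟩ := Countable.exists_injective_nat T.V
  set K := ⌊2 ^ 24 * D' ^ 2⌋₊ + 1 with hK
  have hK1 : 2 ^ 24 * D' ^ 2 < K := by
    rw [hK]
    exact_mod_cast Nat.lt_floor_add_one _
  have hK2 : (K : ℝ) ≤ 2 ^ 24 * D' ^ 2 + 1 := by
    rw [hK]
    push_cast
    linarith [Nat.floor_le (show 0 ≤ 2 ^ 24 * D' ^ 2 by positivity)]
  obtain ⟨χ, hχ⟩ := T.exists_strong r (ParentTree.strong_of_embedding hlow hD1 hlip hK1
    (Nat.cast_injective.comp hι : Function.Injective (fun v => ((ι v : ℕ) : ℤ))))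
  have hone : (1 : ℝ) < 2 ^ 20 * 256 ^ K := by
    have : (1 : ℝ) ≤ 256 ^ K := one_le_pow₀ (by norm_num)
    linarith
  have hle : 1 / (2 ^ 20 * 256 ^ K) ≤ deltaStar T r :=
    le_csSup (deltaStar_bddAbove T r)
      ⟨by positivity, (div_lt_one (by positivity)).2 hone, χ, hχ⟩
  have hpos : 0 < deltaStar T r := lt_of_lt_of_le (by positivity) hle
  refine ⟨hpos, ?_⟩
  have hlog : Real.log (1 / deltaStar T r) ≤ 20 + 8 * K := by
    have h1 : 1 / deltaStar T r ≤ 2 ^ (20 + 8 * K) := by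
      rw [div_le_iff₀ hpos]
      rw [div_le_iff₀ (by positivity)] at hle
      rw [pow_add, pow_mul]
      norm_num at hle ⊢
      linarith
    have h2 := Real.log_le_log (by positivity) h1
    rw [Real.log_pow] at h2
    have h3 : Real.log 2 ≤ 1 := by linarith [Real.log_two_lt_d9]
    have h4 := mul_le_mul_of_nonneg_left h3 (Nat.cast_nonneg (α := ℝ) (20 + 8 * K))
    push_cast at h2 h4
    linarith
  refine Real.sqrt_le_iff.2 ⟨by positivity, ?_⟩
  nlinarith

lemma sqrt_log_bound {δ t : ℝ} (ht : 0 < t) (ht1 : t ≤ 1) (hδ : t / 2 < δ) :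
    32 * √(2 + 4 * Real.log (2 / δ)) ≤ 128 * √(1 + Real.log (1 / t)) := by
  have hδ0 : 0 < δ := by linarith
  have h0 : 0 ≤ Real.log (1 / t) := Real.log_nonneg (by rwa [le_div_iff₀ ht, one_mul])
  have h1 : Real.log (2 / δ) ≤ 2 + Real.log (1 / t) := by
    have h2 : 2 / δ ≤ 2 ^ 2 * (1 / t) := by
      rw [mul_one_div, div_le_div_iff₀ hδ0 ht]
      linarith
    have h3 := Real.log_le_log (by positivity) h2
    rw [Real.log_mul (by norm_num) (by positivity), Real.log_pow] at h3
    push_cast at h3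
    linarith [Real.log_two_lt_d9]
  have h4 : √(2 + 4 * Real.log (2 / δ)) ≤ √(4 ^ 2 * (1 + Real.log (1 / t))) :=
    Real.sqrt_le_sqrt (by linarith)
  rw [Real.sqrt_mul (by norm_num), Real.sqrt_sq (by norm_num)] at h4
  linarith

end Main

/-- There are universal constants `a, b > 0` such that every rooted metric
tree `T` satisfies `a √(1 + log(1/δ*(T))) ≤ c_2(T) ≤ b √(1 + log(1/δ*(T)))`
(with both outer bounds interpreted as `∞` when `δ*(T) = 0`). -/
theorem euclidean_distortion_via_deltaStar :
    ∃ a b : ℝ, 0 < a ∧ 0 < b ∧ ∀ (T : MetricTree) (r : T.V),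
      ENNReal.ofReal a *
          (if deltaStar T r ≤ 0 then (⊤ : ℝ≥0∞)
           else ENNReal.ofReal (Real.sqrt (1 + Real.log (1 / deltaStar T r))))
        ≤ cLp 2 T.dist ∧
      cLp 2 T.dist ≤ ENNReal.ofReal b *
          (if deltaStar T r ≤ 0 then (⊤ : ℝ≥0∞)
           else ENNReal.ofReal (Real.sqrt (1 + Real.log (1 / deltaStar T r)))) := by
  refine ⟨1 / 2 ^ 14, 128, by norm_num, by norm_num, fun T r => ?_⟩
  split_ifs with h
  · have htop : cLp 2 T.dist = ⊤ := by
      rw [cLp, cDist, sInf_eq_top.2, sup_top_eq]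
      rintro c ⟨D, -, hD⟩
      exact absurd (deltaStar_of_hasEmbedding T r hD).1 (not_lt.2 h)
    rw [htop]
    exact ⟨le_top, (ENNReal.mul_top (by norm_num)).ge⟩
  · rw [not_le] at h
    rw [← ENNReal.ofReal_mul (by norm_num), ← ENNReal.ofReal_mul (by norm_num)]
    constructor
    · rw [cLp, cDist]
      by_cases h1 : 1 / 2 ^ 14 * √(1 + Real.log (1 / deltaStar T r)) ≤ 1
      · exact le_sup_of_le_left (ENNReal.ofReal_le_one.2 h1)
      · refine le_sup_of_le_right (le_sInf ?_)
        rintro c ⟨D, rfl, hD⟩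
        refine ENNReal.ofReal_le_ofReal ?_
        have h2 := (deltaStar_of_hasEmbedding T r hD).2
        rcases max_choice 1 D with h3 | h3 <;> rw [h3] at h2 <;> linarith
    · have hne : {δ : ℝ | 0 < δ ∧ δ < 1 ∧
          ∃ χ : Sym2 T.V → ℤ, IsStrongColoring T r δ χ}.Nonempty := by
        by_contra hemp
        rw [deltaStar, Set.not_nonempty_iff_eq_empty.1 hemp, Real.sSup_empty] at h
        exact lt_irrefl _ h
      obtain ⟨δ, ⟨hδ0, hδ1, χ, hχ⟩, hδ⟩ :=
        exists_lt_of_lt_csSup hne (show deltaStar T r / 2 < _ from half_lt_self h)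
      exact (cLp_le_of_strong T r hδ0 hδ1 hχ).trans
        (ENNReal.ofReal_le_ofReal (sqrt_log_bound h (deltaStar_le_one T r) hδ))

end TreePaper
end

section
/- For every weighted tree T and every p ≥ 1, c_p(T) ≤ 2^{1/p} / ε*(T). -/
open scoped ENNReal

namespace TreePaper

open SimpleGraph MeasureTheory
open scoped symmDiff

/-- Every path in a metric tree is the chosen one. -/
lemma MetricTree.path_eq_s4 (T : MetricTree) {u v : T.V} {q : T.G.Walk u v} (hq : q.IsPath) :
    T.path u v = q :=
  (T.isTree.existsUnique_path u v).unique (T.isTree.existsUnique_path u v).exists.choose_spec hq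

lemma MetricTree.path_isPath_s4 (T : MetricTree) (u v : T.V) : (T.path u v).IsPath :=
  (T.isTree.existsUnique_path u v).exists.choose_spec

lemma MetricTree.w_pos_of_mem_path (T : MetricTree) {u v : T.V} {e : Sym2 T.V}
    (he : e ∈ (T.path u v).edges) : 0 < T.w e :=
  T.w_pos e ((T.path u v).edges_subset_edgeSet he)

open Classical in
/-- The set of edges on the path between two vertices. -/
noncomputable def MetricTree.pathEdges (T : MetricTree) (u v : T.V) : Finset (Sym2 T.V) :=
  (T.path u v).edges.toFinset

lemma MetricTree.mem_pathEdges (T : MetricTree) {u v : T.V} {e : Sym2 T.V} :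
    e ∈ T.pathEdges u v ↔ e ∈ (T.path u v).edges := by
  classical
  simp [MetricTree.pathEdges]

lemma MetricTree.dist_eq_sum (T : MetricTree) (u v : T.V) :
    T.dist u v = ∑ e ∈ T.pathEdges u v, T.w e := by
  classical
  rw [MetricTree.pathEdges, List.sum_toFinset _ (T.path_isPath_s4 u v).isTrail.edges_nodup]
  rfl

/-- If `y` lies on the path from `r` to `b`, the path from `r` to `y` is an initial segment. -/
lemma MetricTree.path_eq_takeUntil (T : MetricTree) [DecidableEq T.V] {r b y : T.V}
    (hy : y ∈ (T.path r b).support) : T.path r y = (T.path r b).takeUntil y hy :=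
  T.path_eq_s4 ((T.path_isPath_s4 r b).takeUntil hy)

lemma MetricTree.pathEdges_mono (T : MetricTree) {r b y : T.V}
    (hy : y ∈ (T.path r b).support) : T.pathEdges r y ⊆ T.pathEdges r b := by
  classical
  intro e he
  rw [T.mem_pathEdges] at he ⊢
  rw [T.path_eq_takeUntil hy] at he
  exact Walk.edges_takeUntil_subset_edges _ hy he

/-- The path between two vertices of a path is contained in it. -/
lemma MetricTree.pathEdges_subset (T : MetricTree) {u v a b : T.V}
    (ha : a ∈ (T.path u v).support) (hb : b ∈ (T.path u v).support) :
    T.pathEdges a b ⊆ T.pathEdges u v := by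
  classical
  intro e he
  rw [T.mem_pathEdges] at he ⊢
  have hp := T.path_isPath_s4 u v
  have hsplit := ha
  rw [← Walk.take_spec (T.path u v) hb, Walk.mem_support_append_iff] at hsplit
  rcases hsplit with h | h
  · rw [T.path_eq_s4 ((hp.takeUntil hb).dropUntil h)] at he
    exact Walk.edges_takeUntil_subset_edges _ hb (Walk.edges_dropUntil_subset_edges _ h he)
  · rw [T.path_eq_s4 ((hp.dropUntil hb).takeUntil h).reverse, Walk.edges_reverse,
      List.mem_reverse] at he
    exact Walk.edges_dropUntil_subset_edges _ hb (Walk.edges_takeUntil_subset_edges _ h he)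

/-- The vertices on a path from the root form a chain. -/
lemma MetricTree.support_chain (T : MetricTree) {r b y z : T.V}
    (hy : y ∈ (T.path r b).support) (hz : z ∈ (T.path r b).support) :
    y ∈ (T.path r z).support ∨ z ∈ (T.path r y).support := by
  obtain ⟨i, rfl, hi⟩ := Walk.mem_support_iff_exists_getVert.mp hy
  obtain ⟨j, rfl, hj⟩ := Walk.mem_support_iff_exists_getVert.mp hz
  have key : ∀ i j, i ≤ j → (T.path r b).getVert i ∈
      (T.path r ((T.path r b).getVert j)).support := by
    intro i j hij
    rw [T.path_eq_s4 ((T.path_isPath_s4 r b).take j)]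
    have := ((T.path r b).take j).getVert_mem_support i
    rwa [Walk.take_getVert, min_eq_right hij] at this
  rcases le_total i j with h | h
  · exact Or.inl (key i j h)
  · exact Or.inr (key j i h)

open Classical in
/-- Of two adjacent vertices, one is reached from the root through the other. -/
lemma MetricTree.pathEdges_insert_of_adj (T : MetricTree) (r : T.V) {x y : T.V}
    (h : T.G.Adj x y) (hy : y ∉ (T.path r x).support) :
    T.pathEdges r y = insert s(x, y) (T.pathEdges r x) := by
  ext e
  rw [T.mem_pathEdges, Finset.mem_insert, T.mem_pathEdges,
    T.path_eq_s4 ((T.path_isPath_s4 r x).concat hy h), Walk.edges_concat]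
  simp [or_comm]

open Classical in
lemma MetricTree.pathEdges_eq_insert_of_mem (T : MetricTree) (r : T.V) {x y : T.V}
    (h : T.G.Adj x y) (hy : y ∈ (T.path r x).support) :
    T.pathEdges r x = insert s(x, y) (T.pathEdges r y) := by
  have hx : x ∉ (T.path r y).support := by
    rw [T.path_eq_takeUntil hy]
    exact Walk.endpoint_notMem_support_takeUntil (T.path_isPath_s4 r x) hy h.ne
  rw [T.pathEdges_insert_of_adj r h.symm hx, Sym2.eq_swap]

lemma MetricTree.notMem_pathEdges_of_notMem_support (T : MetricTree) {r x y : T.V}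
    (hy : y ∉ (T.path r x).support) : s(x, y) ∉ T.pathEdges r x := by
  rw [T.mem_pathEdges]
  exact fun h => hy ((T.path r x).snd_mem_support_of_mem_edges h)

open Classical in
/-- Root paths of adjacent vertices differ exactly in the edge joining them. -/
lemma MetricTree.symmDiff_of_adj (T : MetricTree) (r : T.V) {x y : T.V} (h : T.G.Adj x y) :
    T.pathEdges r x ∆ T.pathEdges r y = {s(x, y)} := by
  have key : ∀ {x y : T.V}, T.G.Adj x y → y ∉ (T.path r x).support →
      T.pathEdges r x ∆ T.pathEdges r y = {s(x, y)} := by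
    intro x y h hy
    have hn := T.notMem_pathEdges_of_notMem_support hy
    rw [T.pathEdges_insert_of_adj r h hy]
    ext e
    simp only [Finset.mem_symmDiff, Finset.mem_insert, Finset.mem_singleton]
    grind
  by_cases hy : y ∈ (T.path r x).support
  · have hx : x ∉ (T.path r y).support := by
      rw [T.path_eq_takeUntil hy]
      exact Walk.endpoint_notMem_support_takeUntil (T.path_isPath_s4 r x) hy h.ne
    rw [symmDiff_comm, key h.symm hx, Sym2.eq_swap]
  · exact key h hy

open Classical in
lemma MetricTree.symmDiff_of_isTrail (T : MetricTree) (r : T.V) {u v : T.V} (q : T.G.Walk u v)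
    (hq : q.IsTrail) : T.pathEdges r u ∆ T.pathEdges r v = q.edges.toFinset := by
  induction q with
  | nil => simp
  | @cons u x v h q ih =>
    rw [Walk.isTrail_cons] at hq
    have h1 := ih hq.1
    have h2 := T.symmDiff_of_adj r h
    have h3 : T.pathEdges r u ∆ T.pathEdges r v =
        (T.pathEdges r u ∆ T.pathEdges r x) ∆ (T.pathEdges r x ∆ T.pathEdges r v) := by
      rw [symmDiff_assoc, symmDiff_symmDiff_cancel_left]
    rw [h3, h1, h2, Walk.edges_cons, List.toFinset_cons]
    ext e
    have := hq.2
    simp only [Finset.mem_symmDiff, Finset.mem_insert, Finset.mem_singleton, List.mem_toFinset]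
    grind

open Classical in
/-- The edges between `u` and `v` are those on exactly one of the paths from the root. -/
lemma MetricTree.symmDiff_pathEdges (T : MetricTree) (r u v : T.V) :
    T.pathEdges r u ∆ T.pathEdges r v = T.pathEdges u v :=
  T.symmDiff_of_isTrail r _ (T.path_isPath_s4 u v).isTrail

/-- Every edge has a lower endpoint: one through which all root paths using the edge pass. -/
lemma MetricTree.exists_lower_endpoint (T : MetricTree) (r : T.V) {e : Sym2 T.V}
    (he : e ∈ T.G.edgeSet) : ∃ y : T.V, e ∈ T.pathEdges r y ∧
      ∀ z, e ∈ T.pathEdges r z → y ∈ (T.path r z).support := by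
  classical
  induction e using Sym2.ind with
  | _ x y =>
    rw [mem_edgeSet] at he
    by_cases hy : y ∈ (T.path r x).support
    · refine ⟨x, ?_, fun z hz => ?_⟩
      · rw [T.pathEdges_eq_insert_of_mem r he hy]
        exact Finset.mem_insert_self _ _
      · exact Walk.fst_mem_support_of_mem_edges _ (T.mem_pathEdges.mp hz)
    · refine ⟨y, ?_, fun z hz => ?_⟩
      · rw [T.pathEdges_insert_of_adj r he hy]
        exact Finset.mem_insert_self _ _
      · exact Walk.snd_mem_support_of_mem_edges _ (T.mem_pathEdges.mp hz)

/-- Two edges on a common root path cannot be separated in both directions by root paths. -/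
lemma MetricTree.mem_pathEdges_or_of_common (T : MetricTree) {r b u v : T.V} {e e' : Sym2 T.V}
    (he : e ∈ T.pathEdges r b) (he' : e' ∈ T.pathEdges r b)
    (hu : e ∈ T.pathEdges r u) (hv : e' ∈ T.pathEdges r v) :
    e ∈ T.pathEdges r v ∨ e' ∈ T.pathEdges r u := by
  have hmem : ∀ {f}, f ∈ T.pathEdges r b → f ∈ T.G.edgeSet := fun hf =>
    (T.path r b).edges_subset_edgeSet (T.mem_pathEdges.mp hf)
  obtain ⟨y, hy, hy'⟩ := T.exists_lower_endpoint r (hmem he)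
  obtain ⟨z, hz, hz'⟩ := T.exists_lower_endpoint r (hmem he')
  rcases T.support_chain (hy' b he) (hz' b he') with h | h
  · exact Or.inl (T.pathEdges_mono (hz' v hv) (T.pathEdges_mono h hy))
  · exact Or.inr (T.pathEdges_mono (hy' u hu) (T.pathEdges_mono h hz))

lemma IsMonotoneColoring.mem_pathEdges_or {T : MetricTree} {r : T.V} {χ : Sym2 T.V → ℤ}
    (hχ : IsMonotoneColoring T r χ) {u v : T.V} {e e' : Sym2 T.V} (hee : χ e = χ e')
    (hu : e ∈ T.pathEdges r u) (hv : e' ∈ T.pathEdges r v) :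
    e ∈ T.pathEdges r v ∨ e' ∈ T.pathEdges r u := by
  obtain ⟨a, b, hab, hcol⟩ := hχ (χ e')
  have hsub := T.pathEdges_subset hab (T.path r b).end_mem_support
  refine T.mem_pathEdges_or_of_common (b := b) (hsub ?_) (hsub ?_) hu hv
  · exact T.mem_pathEdges.mpr ((hcol e ((T.path r u).edges_subset_edgeSet
      (T.mem_pathEdges.mp hu))).mp hee)
  · exact T.mem_pathEdges.mpr ((hcol e' ((T.path r v).edges_subset_edgeSet
      (T.mem_pathEdges.mp hv))).mp rfl)

/-- If one of two finite sets contains the other, the sum over the symmetric difference is at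
most the distance between the sums. -/
lemma sum_symmDiff_le_abs {α : Type*} [DecidableEq α] {A B : Finset α} (w : α → ℝ)
    (h : A ⊆ B ∨ B ⊆ A) : ∑ e ∈ A ∆ B, w e ≤ |∑ e ∈ A, w e - ∑ e ∈ B, w e| := by
  rcases h with h | h
  · rw [symmDiff_of_le h, ← Finset.sum_sdiff h, abs_sub_comm, add_sub_cancel_right]
    exact le_abs_self _
  · rw [symmDiff_of_ge h, ← Finset.sum_sdiff h, add_sub_cancel_right]
    exact le_abs_self _

/-- For a monotone coloring, the length of color `k` between `u` and `v` is at most the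
difference of the lengths of color `k` on the two root paths. -/
lemma IsMonotoneColoring.sum_filter_le {T : MetricTree} {r : T.V} {χ : Sym2 T.V → ℤ}
    (hχ : IsMonotoneColoring T r χ) (k : ℤ) (u v : T.V) :
    ∑ e ∈ T.pathEdges u v with χ e = k, T.w e ≤
      |∑ e ∈ T.pathEdges r u with χ e = k, T.w e -
        ∑ e ∈ T.pathEdges r v with χ e = k, T.w e| := by
  classical
  have hfilter : (T.pathEdges u v).filter (fun e => χ e = k) =
      (T.pathEdges r u).filter (fun e => χ e = k) ∆
        (T.pathEdges r v).filter (fun e => χ e = k) := by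
    rw [← T.symmDiff_pathEdges r u v]
    ext e
    simp only [Finset.mem_filter, Finset.mem_symmDiff]
    tauto
  rw [hfilter]
  refine sum_symmDiff_le_abs T.w ?_
  by_contra! hcon
  obtain ⟨e, he, he'⟩ := Finset.not_subset.mp hcon.1
  obtain ⟨f, hf, hf'⟩ := Finset.not_subset.mp hcon.2
  rw [Finset.mem_filter] at he hf he' hf'
  have := hχ.mem_pathEdges_or (he.2.trans hf.2.symm) he.1 hf.1
  tauto

/-- The step function taking the value `∑ w e` over the edges `e ∈ A` of color `k` on
`[k, k + 1)`. -/
noncomputable def stepFun {α : Type*} (χ : α → ℤ) (w : α → ℝ) (A : Finset α) : ℝ → ℝ :=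
  ∑ e ∈ A, (Set.Ico (χ e : ℝ) (χ e + 1)).indicator (fun _ => w e)

lemma stepFun_apply {α : Type*} (χ : α → ℤ) (w : α → ℝ) (A : Finset α) {k : ℤ} {x : ℝ}
    (hx : x ∈ Set.Ico (k : ℝ) (k + 1)) : stepFun χ w A x = ∑ e ∈ A with χ e = k, w e := by
  rw [stepFun, Finset.sum_apply, Finset.sum_filter]
  refine Finset.sum_congr rfl fun e _ => ?_
  rw [Set.indicator_apply]
  congr 1
  rw [Set.mem_Ico, ← Int.floor_eq_iff, ← Int.floor_eq_iff.mpr hx]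
  exact propext eq_comm

lemma memLp_stepFun {α : Type*} (χ : α → ℤ) (w : α → ℝ) (A : Finset α) (q : ℝ≥0∞) :
    MemLp (stepFun χ w A) q volume :=
  memLp_finsetSum' _ fun _ _ =>
    memLp_indicator_const _ measurableSet_Ico _ (Or.inr (by simp))

lemma eLpNorm_indicator_Ico_const {q : ℝ≥0∞} (hq : q ≠ 0) (hq' : q ≠ ⊤) (k : ℤ) (c : ℝ) :
    eLpNorm ((Set.Ico (k : ℝ) (k + 1)).indicator fun _ => c) q volume = ‖c‖ₑ := by
  rw [eLpNorm_indicator_const measurableSet_Ico hq hq']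
  simp

lemma eLpNorm_stepFun_le {α : Type*} (χ : α → ℤ) (w : α → ℝ) (A : Finset α) {q : ℝ≥0∞}
    (hq : 1 ≤ q) (hq' : q ≠ ⊤) : eLpNorm (stepFun χ w A) q volume ≤ ∑ e ∈ A, ‖w e‖ₑ := by
  refine (eLpNorm_sum_le (fun e _ =>
    (aestronglyMeasurable_const.indicator measurableSet_Ico)) hq).trans ?_
  exact Finset.sum_le_sum fun e _ =>
    (eLpNorm_indicator_Ico_const (one_pos.trans_le hq).ne' hq' _ _).le

lemma eLpNorm_stepFun_sub_le {α : Type*} [DecidableEq α] (χ : α → ℤ) (w : α → ℝ)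
    (A B : Finset α) {q : ℝ≥0∞} (hq : 1 ≤ q) (hq' : q ≠ ⊤) :
    eLpNorm (stepFun χ w A - stepFun χ w B) q volume ≤ ∑ e ∈ A ∆ B, ‖w e‖ₑ := by
  have hsub : stepFun χ w A - stepFun χ w B = stepFun χ w (A \ B) - stepFun χ w (B \ A) :=
    Finset.sum_sdiff_sub_sum_sdiff.symm
  rw [hsub]
  refine (eLpNorm_sub_le (memLp_stepFun _ _ _ q).1 (memLp_stepFun _ _ _ q).1 hq).trans ?_
  rw [symmDiff_def, Finset.sup_eq_union, Finset.sum_union disjoint_sdiff_sdiff]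
  exact add_le_add (eLpNorm_stepFun_le _ _ _ hq hq') (eLpNorm_stepFun_le _ _ _ hq hq')

lemma enorm_sub_le_eLpNorm_stepFun_sub {α : Type*} (χ : α → ℤ) (w : α → ℝ) (A B : Finset α)
    (k : ℤ) {q : ℝ≥0∞} (hq : 1 ≤ q) (hq' : q ≠ ⊤) :
    ‖∑ e ∈ A with χ e = k, w e - ∑ e ∈ B with χ e = k, w e‖ₑ ≤
      eLpNorm (stepFun χ w A - stepFun χ w B) q volume := by
  rw [← eLpNorm_indicator_Ico_const (one_pos.trans_le hq).ne' hq' k]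
  refine le_trans (le_of_eq ?_)
    (eLpNorm_indicator_le (s := Set.Ico (k : ℝ) (k + 1)) (stepFun χ w A - stepFun χ w B))
  congr 1
  refine Set.indicator_congr fun x hx => ?_
  rw [Pi.sub_apply, stepFun_apply χ w A hx, stepFun_apply χ w B hx]

/-- Mapping finite sets of colored edges to step functions in `L_p`. -/
lemma exists_lpSpace_map {α : Type*} [DecidableEq α] (χ : α → ℤ) (w : α → ℝ) {p : ℝ}
    (hp : 1 ≤ p) : ∃ f : Finset α → LpSpace p, ∀ A B : Finset α,
      Dist.dist (f A) (f B) ≤ ∑ e ∈ A ∆ B, |w e| ∧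
      ∀ k : ℤ, |∑ e ∈ A with χ e = k, w e - ∑ e ∈ B with χ e = k, w e| ≤
        Dist.dist (f A) (f B) := by
  have hq : 1 ≤ ENNReal.ofReal p := ENNReal.one_le_ofReal.mpr hp
  have hq' : ENNReal.ofReal p ≠ ⊤ := ENNReal.ofReal_ne_top
  refine ⟨fun A => (memLp_stepFun χ w A (ENNReal.ofReal p)).toLp, fun A B => ?_⟩
  have hdist : Dist.dist
      (show LpSpace p from (memLp_stepFun χ w A (ENNReal.ofReal p)).toLp)
      (show LpSpace p from (memLp_stepFun χ w B (ENNReal.ofReal p)).toLp) =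
      (eLpNorm (stepFun χ w A - stepFun χ w B) (ENNReal.ofReal p) volume).toReal := by
    rw [← Lp.edist_toLp_toLp _ _ (memLp_stepFun χ w A _) (memLp_stepFun χ w B _)]
    exact Lp.dist_edist _ _
  have htop := ((memLp_stepFun χ w A (ENNReal.ofReal p)).sub (memLp_stepFun χ w B _)).2.ne
  refine ⟨hdist.trans_le ?_, fun k => le_of_le_of_eq ?_ hdist.symm⟩
  · refine ENNReal.toReal_le_of_le_ofReal (Finset.sum_nonneg fun _ _ => abs_nonneg _) ?_
    rw [ENNReal.ofReal_sum_of_nonneg fun _ _ => abs_nonneg _]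
    simpa only [Real.enorm_eq_ofReal_abs] using eLpNorm_stepFun_sub_le χ w A B hq hq'
  · rw [← ENNReal.ofReal_le_iff_le_toReal htop, ← Real.enorm_eq_ofReal_abs]
    exact enorm_sub_le_eLpNorm_stepFun_sub χ w A B k hq hq'

/-- An `ε`-good coloring yields a map to `L_p` that is `1`-Lipschitz and contracts distances by
at most `ε`. -/
lemma IsGoodColoring.exists_map {T : MetricTree} {r : T.V} {ε : ℝ} {χ : Sym2 T.V → ℤ}
    (hχ : IsGoodColoring T r ε χ) {p : ℝ} (hp : 1 ≤ p) :
    ∃ f : T.V → LpSpace p, ∀ u v : T.V, ε * T.dist u v ≤ Dist.dist (f u) (f v) ∧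
      Dist.dist (f u) (f v) ≤ T.dist u v := by
  classical
  obtain ⟨f, hf⟩ := exists_lpSpace_map χ T.w hp
  refine ⟨fun u => f (T.pathEdges r u), fun u v => ?_⟩
  obtain ⟨hup, hlow⟩ := hf (T.pathEdges r u) (T.pathEdges r v)
  constructor
  · rcases eq_or_ne u v with rfl | huv
    · rw [T.dist_eq_sum, ← T.symmDiff_pathEdges r u u, symmDiff_self, Finset.bot_eq_empty,
        Finset.sum_empty, mul_zero]
      exact (abs_nonneg _).trans (hlow 0)
    obtain ⟨a, b, ha, hb, ⟨k, hk⟩, hab⟩ := hχ.2 u v huv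
    refine hab.trans ?_
    rw [T.dist_eq_sum]
    refine le_trans ?_ ((hχ.1.sum_filter_le k u v).trans (hlow k))
    refine Finset.sum_le_sum_of_subset_of_nonneg (fun e he => ?_) fun e he _ => ?_
    · exact Finset.mem_filter.mpr ⟨T.pathEdges_subset ha hb he, hk e (T.mem_pathEdges.mp he)⟩
    · exact (T.w_pos_of_mem_path (T.mem_pathEdges.mp (Finset.mem_filter.mp he).1)).le
  · refine hup.trans_eq ?_
    rw [T.symmDiff_pathEdges, T.dist_eq_sum]
    exact Finset.sum_congr rfl fun e he =>
      abs_of_pos (T.w_pos_of_mem_path (T.mem_pathEdges.mp he))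

lemma MetricTree.dist_nonneg (T : MetricTree) (u v : T.V) : 0 ≤ T.dist u v := by
  rw [T.dist_eq_sum]
  exact Finset.sum_nonneg fun e he => (T.w_pos_of_mem_path (T.mem_pathEdges.mp he)).le

lemma IsGoodColoring.cLp_le {T : MetricTree} {r : T.V} {ε : ℝ} {χ : Sym2 T.V → ℤ}
    (hχ : IsGoodColoring T r ε χ) (hε : 0 < ε) (hε1 : ε ≤ 1) {p : ℝ} (hp : 1 ≤ p) :
    cLp p T.dist ≤ ENNReal.ofReal (1 / ε) := by
  refine sup_le ?_ (sInf_le ⟨1 / ε, rfl, ?_⟩)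
  · exact ENNReal.one_le_ofReal.mpr ((one_le_div hε).mpr hε1)
  · obtain ⟨f, hf⟩ := hχ.exists_map hp
    refine ⟨f, ε, hε, fun u v => ⟨(hf u v).1, ?_⟩⟩
    rw [mul_one_div_cancel hε.ne', one_mul]
    exact (hf u v).2

/-- For every rooted weighted tree `T` and every `p ≥ 1`,
`c_p(T) ≤ 2^{1/p} / ε*(T)`. -/
theorem good_coloring_embedding (T : MetricTree) (r : T.V) (p : ℝ) (hp : 1 ≤ p) :
    cLp p T.dist ≤
      ENNReal.ofReal ((2 : ℝ) ^ (1 / p)) / ENNReal.ofReal (epsilonStar T r) := by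
  have hc : (1 : ℝ) ≤ 2 ^ (1 / p) := Real.one_le_rpow one_le_two (by positivity)
  have hc' : (1 : ℝ≥0∞) ≤ ENNReal.ofReal (2 ^ (1 / p)) := ENNReal.one_le_ofReal.mpr hc
  refine le_trans ?_ (ENNReal.div_le_div_right hc' _)
  rw [one_div, ENNReal.le_inv_iff_le_inv]
  have hfin : (cLp p T.dist)⁻¹ ≠ ⊤ :=
    ENNReal.inv_ne_top.mpr (one_pos.trans_le (le_sup_left (a := (1 : ℝ≥0∞)))).ne'
  refine ENNReal.ofReal_le_of_le_toReal (Real.sSup_le ?_ ENNReal.toReal_nonneg)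
  rintro ε ⟨hε, hε1, χ, hχ⟩
  rw [← ENNReal.ofReal_le_iff_le_toReal hfin, ENNReal.le_inv_iff_le_inv,
    ← ENNReal.ofReal_inv_of_pos hε, ← one_div]
  exact hχ.cLp_le hε hε1 hp

end TreePaper
end
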